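/- For a two-player network design game on an undirected graph G with terminal pairs (s_1,t_1),(s_2,t_2), the following three statements are equivalent: (1) (G,(s_1,t_1),(s_2,t_2)) does not contain a subgraph which is a Bad Configuration; (2) (G,(s_1,t_1),(s_2,t_2)) is efficient; (3) (G,(s_1,t_1),(s_2,t_2)) is strongly efficient. -/

import Mathlib

namespace NDG

variable {V : Type*} [DecidableEq V]

/-- Total cost of a finite set of edges. -/
def cost (c : Sym2 V → ℝ) (F : Finset (Sym2 V)) : ℝ := ∑ e ∈ F, c e

/-- A Steiner forest: an acyclic set of edges of `G` connecting both
terminal pairs. -/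
def IsSteinerForest (G : SimpleGraph V) (s₁ t₁ s₂ t₂ : V) (F : Finset (Sym2 V)) : Prop :=
  (↑F ⊆ G.edgeSet) ∧
  (SimpleGraph.fromEdgeSet (↑F : Set (Sym2 V))).IsAcyclic ∧
  (∃ p : G.Walk s₁ t₁, p.IsPath ∧ ∀ e ∈ p.edges, e ∈ F) ∧
  (∃ p : G.Walk s₂ t₂, p.IsPath ∧ ∀ e ∈ p.edges, e ∈ F)

/-- An optimal Steiner forest: one of minimum total cost. -/
def IsOptimalSteinerForest (G : SimpleGraph V) (s₁ t₁ s₂ t₂ : V) (c : Sym2 V → ℝ)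
    (F : Finset (Sym2 V)) : Prop :=
  IsSteinerForest G s₁ t₁ s₂ t₂ F ∧
  ∀ F', IsSteinerForest G s₁ t₁ s₂ t₂ F' → cost c F ≤ cost c F'

/-- A strategy of a player: a simple path between her terminals. -/
abbrev Strat (G : SimpleGraph V) (s t : V) := {p : G.Walk s t // p.IsPath}

/-- A cost sharing protocol: cost shares for both players on every edge,
depending on the chosen strategy profile. -/
abbrev Protocol (G : SimpleGraph V) (s₁ t₁ s₂ t₂ : V) :=
  Strat G s₁ t₁ → Strat G s₂ t₂ → Fin 2 → Sym2 V → ℝ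

/-- The set of players using edge `e` in the profile `(P₁, P₂)`. -/
def usedBy {G : SimpleGraph V} {s₁ t₁ s₂ t₂ : V}
    (P₁ : Strat G s₁ t₁) (P₂ : Strat G s₂ t₂) (e : Sym2 V) : Finset (Fin 2) :=
  (if e ∈ P₁.1.edges then {0} else ∅) ∪ (if e ∈ P₂.1.edges then {1} else ∅)

/-- The total cost player 1 pays. -/
def cost₁ {G : SimpleGraph V} {s₁ t₁ s₂ t₂ : V} (Ξ : Protocol G s₁ t₁ s₂ t₂)
    (P₁ : Strat G s₁ t₁) (P₂ : Strat G s₂ t₂) : ℝ :=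
  ∑ e ∈ P₁.1.edges.toFinset, Ξ P₁ P₂ 0 e

/-- The total cost player 2 pays. -/
def cost₂ {G : SimpleGraph V} {s₁ t₁ s₂ t₂ : V} (Ξ : Protocol G s₁ t₁ s₂ t₂)
    (P₁ : Strat G s₁ t₁) (P₂ : Strat G s₂ t₂) : ℝ :=
  ∑ e ∈ P₂.1.edges.toFinset, Ξ P₁ P₂ 1 e

/-- Pure Nash equilibrium of the two-player game induced by the protocol `Ξ`. -/
def IsPNE {G : SimpleGraph V} {s₁ t₁ s₂ t₂ : V} (Ξ : Protocol G s₁ t₁ s₂ t₂)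
    (P₁ : Strat G s₁ t₁) (P₂ : Strat G s₂ t₂) : Prop :=
  (∀ Q₁, cost₁ Ξ P₁ P₂ ≤ cost₁ Ξ Q₁ P₂) ∧ (∀ Q₂, cost₂ Ξ P₁ P₂ ≤ cost₂ Ξ P₁ Q₂)

/-- A separable cost sharing protocol: nonnegative, budget-balanced, stable and
separable (cost shares on an edge depend only on the set of players using it). -/
structure IsSeparable {G : SimpleGraph V} {s₁ t₁ s₂ t₂ : V} (c : Sym2 V → ℝ)
    (Ξ : Protocol G s₁ t₁ s₂ t₂) : Prop where
  nonneg : ∀ P₁ P₂ i e, 0 ≤ Ξ P₁ P₂ i e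
  budget : ∀ P₁ P₂ e, (usedBy P₁ P₂ e).Nonempty →
    ∑ i ∈ usedBy P₁ P₂ e, Ξ P₁ P₂ i e = c e
  stable : ∃ P₁ P₂, IsPNE Ξ P₁ P₂
  separable : ∀ P₁ P₂ Q₁ Q₂ e, usedBy P₁ P₂ e = usedBy Q₁ Q₂ e →
    ∀ i, Ξ P₁ P₂ i e = Ξ Q₁ Q₂ i e

/-- A Steiner forest `F` is enforceable if the profile of the unique paths of
the two players inside `F` is a pure Nash equilibrium of the game induced by
some separable cost sharing protocol. -/
def Enforceable (G : SimpleGraph V) (s₁ t₁ s₂ t₂ : V) (c : Sym2 V → ℝ)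
    (F : Finset (Sym2 V)) : Prop :=
  ∃ (P₁ : Strat G s₁ t₁) (P₂ : Strat G s₂ t₂),
    (∀ e ∈ P₁.1.edges, e ∈ F) ∧ (∀ e ∈ P₂.1.edges, e ∈ F) ∧
    (∀ Q₁ : Strat G s₁ t₁, (∀ e ∈ Q₁.1.edges, e ∈ F) → Q₁ = P₁) ∧
    (∀ Q₂ : Strat G s₂ t₂, (∀ e ∈ Q₂.1.edges, e ∈ F) → Q₂ = P₂) ∧
    ∃ Ξ : Protocol G s₁ t₁ s₂ t₂, IsSeparable c Ξ ∧ IsPNE Ξ P₁ P₂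

/-- `(G,(s₁,t₁),(s₂,t₂))` is efficient: for every nonnegative cost function
some optimal Steiner forest is enforceable (the PoS is 1). -/
def Efficient (G : SimpleGraph V) (s₁ t₁ s₂ t₂ : V) : Prop :=
  ∀ c : Sym2 V → ℝ, (∀ e, 0 ≤ c e) →
    ∃ F, IsOptimalSteinerForest G s₁ t₁ s₂ t₂ c F ∧ Enforceable G s₁ t₁ s₂ t₂ c F

/-- `(G,(s₁,t₁),(s₂,t₂))` is strongly efficient: for every nonnegative cost
function every optimal Steiner forest is enforceable. -/
def StronglyEfficient (G : SimpleGraph V) (s₁ t₁ s₂ t₂ : V) : Prop :=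
  ∀ c : Sym2 V → ℝ, (∀ e, 0 ≤ c e) →
    ∀ F, IsOptimalSteinerForest G s₁ t₁ s₂ t₂ c F → Enforceable G s₁ t₁ s₂ t₂ c F

/-- A preliminary bad configuration (PBC) for the terminal pairs `(u,v)` and
`(w,x)`: the path `P_u = Lu ++ M ++ Ru` of one player and the path
`P_ℓ = Ll ++ M ++ Rl` of the other player meet exactly in the nonempty,
consistently oriented common subpath `M`; `q₁` closes a unique cycle with `P_u`
(intersecting it in the segment `S1`, which contains edges of `R_u` and of `M`),
`q₂` and `q₃` close unique cycles with `P_ℓ` (intersecting it in the segments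
`S2` resp. `S3`, containing edges of `L_ℓ` resp. `R_ℓ` and of `M`, and missing
part of `M`); moreover `C := C₂ ∩ C₃ ∩ M` is nonempty and contained in `C₁`, and
`(M ∩ C₁ ∩ C₂) \ C` and `(M ∩ C₁ ∩ C₃) \ C` each contain an edge. -/
structure PBC (G : SimpleGraph V) (u v w x : V) where
  a : V
  b : V
  Lu : G.Walk u a
  M : G.Walk a b
  Ru : G.Walk b v
  Ll : G.Walk w a
  Rl : G.Walk b x
  hM_ne : M.edges ≠ []
  hPu : ((Lu.append M).append Ru).IsPath
  hPl : ((Ll.append M).append Rl).IsPath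
  hforest : (SimpleGraph.fromEdgeSet
      {e | e ∈ ((Lu.append M).append Ru).edges ∨ e ∈ ((Ll.append M).append Rl).edges}).IsAcyclic
  hmeet : ∀ e, e ∈ ((Lu.append M).append Ru).edges →
      e ∈ ((Ll.append M).append Rl).edges → e ∈ M.edges
  hRu_ne : Ru.edges ≠ []
  hLl_ne : Ll.edges ≠ []
  hRl_ne : Rl.edges ≠ []
  a1 : V
  b1 : V
  q1 : G.Walk a1 b1
  S1 : G.Walk a1 b1
  hq1path : q1.IsPath
  hq1_ne : q1.edges ≠ []
  hS1 : S1.darts <:+: ((Lu.append M).append Ru).darts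
  hq1closes : ∀ y ∈ q1.support, y ∈ ((Lu.append M).append Ru).support → y = a1 ∨ y = b1
  hC1Ru : ∃ e ∈ S1.edges, e ∈ Ru.edges
  hC1M : ∃ e ∈ S1.edges, e ∈ M.edges
  a2 : V
  b2 : V
  q2 : G.Walk a2 b2
  S2 : G.Walk a2 b2
  hq2path : q2.IsPath
  hq2_ne : q2.edges ≠ []
  hS2 : S2.darts <:+: ((Ll.append M).append Rl).darts
  hq2closes : ∀ y ∈ q2.support, y ∈ ((Ll.append M).append Rl).support → y = a2 ∨ y = b2
  hC2Ll : ∃ e ∈ S2.edges, e ∈ Ll.edges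
  hC2M : ∃ e ∈ S2.edges, e ∈ M.edges
  hMC2 : ∃ e ∈ M.edges, e ∉ S2.edges
  a3 : V
  b3 : V
  q3 : G.Walk a3 b3
  S3 : G.Walk a3 b3
  hq3path : q3.IsPath
  hq3_ne : q3.edges ≠ []
  hS3 : S3.darts <:+: ((Ll.append M).append Rl).darts
  hq3closes : ∀ y ∈ q3.support, y ∈ ((Ll.append M).append Rl).support → y = a3 ∨ y = b3
  hC3Rl : ∃ e ∈ S3.edges, e ∈ Rl.edges
  hC3M : ∃ e ∈ S3.edges, e ∈ M.edges
  hMC3 : ∃ e ∈ M.edges, e ∉ S3.edges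
  hC_ne : ∃ e ∈ M.edges, e ∈ S2.edges ∧ e ∈ S3.edges
  hC_sub : ∀ e ∈ M.edges, e ∈ S2.edges → e ∈ S3.edges → e ∈ S1.edges
  hC1C2 : ∃ e ∈ M.edges, e ∈ S1.edges ∧ e ∈ S2.edges ∧ e ∉ S3.edges
  hC1C3 : ∃ e ∈ M.edges, e ∈ S1.edges ∧ e ∈ S3.edges ∧ e ∉ S2.edges

namespace PBC

variable {G : SimpleGraph V} {u v w x : V}

/-- The path of the "upper" player (terminals `u`, `v`). -/
def Pu (B : PBC G u v w x) : G.Walk u v := (B.Lu.append B.M).append B.Ru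

/-- The path of the "lower" player (terminals `w`, `x`). -/
def Pl (B : PBC G u v w x) : G.Walk w x := (B.Ll.append B.M).append B.Rl

/-- `q₁` is small: the cycle `C₁` contains no edge of `L_u`. -/
def Small (B : PBC G u v w x) : Prop := ∀ e ∈ B.S1.edges, e ∉ B.Lu.edges

/-- `q₁` is big: the cycle `C₁` contains an edge of `L_u`. -/
def Big (B : PBC G u v w x) : Prop := ∃ e ∈ B.S1.edges, e ∈ B.Lu.edges

/-- Node-disjointness of two walks. -/
def NodeDisj {y z y' z' : V} (p : G.Walk y z) (q : G.Walk y' z') : Prop :=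
  ∀ s ∈ p.support, s ∉ q.support

/-- `q` is internally node-disjoint from `P_u ∪ P_ℓ`. -/
def InternDisj (B : PBC G u v w x) {y z : V} (q : G.Walk y z) : Prop :=
  ∀ s ∈ q.support, s ≠ y → s ≠ z → s ∉ B.Pu.support ∧ s ∉ B.Pl.support

/-- The two walks intersect exactly in a common (possibly reversed) subpath. -/
def CommonMid {y z y' z' : V} (p : G.Walk y z) (q : G.Walk y' z') : Prop :=
  ∃ (c d : V) (m : G.Walk c d), m.IsPath ∧
    m.darts <:+: p.darts ∧ (m.darts <:+: q.darts ∨ m.reverse.darts <:+: q.darts) ∧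
    ∀ s, s ∈ p.support → s ∈ q.support → s ∈ m.support

/-- `q` contains no node of `L_u` or `R_u`. -/
def AvoidsUpperOuter (B : PBC G u v w x) {y z : V} (q : G.Walk y z) : Prop :=
  ∀ s ∈ q.support, s ∉ B.Lu.support ∧ s ∉ B.Ru.support

/-- In BC3/BC4, `q₁` avoids `R_ℓ` and the start node of `q₂`, and its initial
segment `α₁` (up to the last node contained in `L_ℓ`) runs inside the cycle
`C₂` along `L_ℓ`. -/
def LlTraverse (B : PBC G u v w x) : Prop :=
  (∀ s ∈ B.q1.support, s ∉ B.Rl.support) ∧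
  B.a2 ∉ B.q1.support ∧
  ∃ (y : V) (α : G.Walk B.a1 y) (β : G.Walk y B.b1),
    B.q1 = α.append β ∧ y ∈ B.Ll.support ∧
    (∀ e ∈ α.edges, e ∈ B.S2.edges) ∧
    (∀ s ∈ β.support, s ∈ B.Ll.support → s = y)

/-- Types BC1a (`q₁` small) and BC1b (`q₁` big): `q₁,q₂,q₃` pairwise
node-disjoint and internally node-disjoint from `P_u ∪ P_ℓ`. -/
def BC1 (B : PBC G u v w x) : Prop :=
  NodeDisj B.q1 B.q2 ∧ NodeDisj B.q1 B.q3 ∧ NodeDisj B.q2 B.q3 ∧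
  B.InternDisj B.q1 ∧ B.InternDisj B.q2 ∧ B.InternDisj B.q3

/-- Types BC2a–d: `q₃` node-disjoint with `q₁` and `q₂`; `q₁` and `q₂` overlap
exactly in a common subpath (`α₂ = β₂`); everything internally node-disjoint
from `P_u ∪ P_ℓ` (the subtypes corresponding to `q₁` small/big and the two
orientations of the common subpath are subsumed). -/
def BC2 (B : PBC G u v w x) : Prop :=
  NodeDisj B.q3 B.q1 ∧ NodeDisj B.q3 B.q2 ∧
  ¬ NodeDisj B.q1 B.q2 ∧ CommonMid B.q1 B.q2 ∧
  B.InternDisj B.q1 ∧ B.InternDisj B.q2 ∧ B.InternDisj B.q3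

/-- Type BC3. -/
def BC3 (B : PBC G u v w x) : Prop :=
  B.Small ∧ (∀ e ∈ B.M.edges, e ∈ B.S1.edges) ∧
  NodeDisj B.q1 B.q2 ∧ NodeDisj B.q1 B.q3 ∧ NodeDisj B.q2 B.q3 ∧
  B.AvoidsUpperOuter B.q2 ∧ B.AvoidsUpperOuter B.q3 ∧
  B.LlTraverse

/-- Types BC4a/b. -/
def BC4 (B : PBC G u v w x) : Prop :=
  B.Small ∧ (∀ e ∈ B.M.edges, e ∈ B.S1.edges) ∧
  NodeDisj B.q3 B.q1 ∧ NodeDisj B.q3 B.q2 ∧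
  ¬ NodeDisj B.q1 B.q2 ∧ CommonMid B.q1 B.q2 ∧
  B.AvoidsUpperOuter B.q2 ∧ B.AvoidsUpperOuter B.q3 ∧
  B.LlTraverse

/-- A PBC is a bad configuration if it is of one of the nine types
BC1a, BC1b, BC2a, BC2b, BC2c, BC2d, BC3, BC4a, BC4b. -/
def IsBC (B : PBC G u v w x) : Prop := B.BC1 ∨ B.BC2 ∨ B.BC3 ∨ B.BC4

end PBC

/-- `(G,(s₁,t₁),(s₂,t₂))` contains a subgraph which is a bad configuration,
for some assignment of the terminal pairs to `(u,v)` and `(w,x)`. -/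
def ContainsBC (G : SimpleGraph V) (s₁ t₁ s₂ t₂ : V) : Prop :=
  (∃ B : PBC G s₁ t₁ s₂ t₂, B.IsBC) ∨ (∃ B : PBC G s₁ t₁ t₂ s₂, B.IsBC) ∨
  (∃ B : PBC G t₁ s₁ s₂ t₂, B.IsBC) ∨ (∃ B : PBC G t₁ s₁ t₂ s₂, B.IsBC) ∨
  (∃ B : PBC G s₂ t₂ s₁ t₁, B.IsBC) ∨ (∃ B : PBC G s₂ t₂ t₁ s₁, B.IsBC) ∨
  (∃ B : PBC G t₂ s₂ s₁ t₁, B.IsBC) ∨ (∃ B : PBC G t₂ s₂ t₁ s₁, B.IsBC)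


end NDG

namespace NDG
variable {V : Type*} [DecidableEq V]

set_option linter.unusedSectionVars false
open SimpleGraph

section walks
variable {G : SimpleGraph V}

theorem isPath_append_iff {a b d : V} (p : G.Walk a b) (q : G.Walk b d) :
    (p.append q).IsPath ↔ p.IsPath ∧ q.IsPath ∧
      ∀ y ∈ p.support, y ∈ q.support → y = b := by
  induction p with
  | nil =>
    simp
  | cons h p ih =>
    rw [Walk.cons_append, Walk.cons_isPath_iff, Walk.cons_isPath_iff, ih q,
      Walk.mem_support_append_iff]
    constructor
    · rintro ⟨⟨h1, h2, h3⟩, h4⟩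
      push Not at h4
      refine ⟨⟨h1, h4.1⟩, h2, ?_⟩
      intro y hy hy'
      rw [Walk.support_cons, List.mem_cons] at hy
      rcases hy with rfl | hy
      · exact absurd hy' h4.2
      · exact h3 y hy hy'
    · rintro ⟨⟨h1, h2⟩, h3, h4⟩
      refine ⟨⟨h1, h3, fun y hy hy' => h4 y (by simp [hy]) hy'⟩, ?_⟩
      push Not
      refine ⟨h2, fun hc => ?_⟩
      have := h4 _ (by simp) hc
      subst this
      exact h2 (by simp)

/-- First vertex of a walk satisfying a predicate. -/
theorem firstHit (S : V → Prop) {a b : V} (p : G.Walk a b) (hb : ∃ y ∈ p.support, S y) :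
    ∃ (z : V) (p1 : G.Walk a z) (p2 : G.Walk z b), p = p1.append p2 ∧ S z ∧
      ∀ y ∈ p1.support, S y → y = z := by
  induction p with
  | nil =>
    obtain ⟨y, hy, hS⟩ := hb
    simp at hy; subst hy
    exact ⟨_, Walk.nil, Walk.nil, by simp, hS, by simp⟩
  | @cons a a' b h p ih =>
    by_cases ha : S a
    · exact ⟨a, Walk.nil, Walk.cons h p, by simp, ha, by simp⟩
    · have : ∃ y ∈ p.support, S y := by
        obtain ⟨y, hy, hS⟩ := hb
        rw [Walk.support_cons, List.mem_cons] at hy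
        rcases hy with rfl | hy
        · exact absurd hS ha
        · exact ⟨y, hy, hS⟩
      obtain ⟨z, p1, p2, rfl, hz, h1⟩ := ih this
      refine ⟨z, Walk.cons h p1, p2, by simp, hz, ?_⟩
      intro y hy hS
      rw [Walk.support_cons, List.mem_cons] at hy
      rcases hy with rfl | hy
      · exact absurd hS ha
      · exact h1 y hy hS

theorem lastHit (S : V → Prop) {a b : V} (p : G.Walk a b) (hb : ∃ y ∈ p.support, S y) :
    ∃ (z : V) (p1 : G.Walk a z) (p2 : G.Walk z b), p = p1.append p2 ∧ S z ∧
      ∀ y ∈ p2.support, S y → y = z := by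
  obtain ⟨z, p1, p2, h, hz, h1⟩ := firstHit S p.reverse (by simpa using hb)
  refine ⟨z, p2.reverse, p1.reverse, ?_, hz, by simpa using h1⟩
  have := congrArg Walk.reverse h
  simpa using this

theorem splitAt {a b z : V} (p : G.Walk a b) (hz : z ∈ p.support) :
    ∃ (p1 : G.Walk a z) (p2 : G.Walk z b), p = p1.append p2 :=
  ⟨p.takeUntil z hz, p.dropUntil z hz, (p.take_spec hz).symm⟩

/-- cost of a walk -/
def wc (c : Sym2 V → ℝ) {a b : V} (p : G.Walk a b) : ℝ := (p.edges.map c).sum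

@[simp] theorem wc_nil (c : Sym2 V → ℝ) {a : V} : wc c (Walk.nil : G.Walk a a) = 0 := by simp [wc]

@[simp] theorem wc_append (c : Sym2 V → ℝ) {a b d : V} (p : G.Walk a b) (q : G.Walk b d) :
    wc c (p.append q) = wc c p + wc c q := by simp [wc]

@[simp] theorem wc_cons (c : Sym2 V → ℝ) {a b d : V} (h : G.Adj a b) (q : G.Walk b d) :
    wc c (Walk.cons h q) = c s(a, b) + wc c q := by simp [wc]

@[simp] theorem wc_reverse (c : Sym2 V → ℝ) {a b : V} (p : G.Walk a b) :
    wc c p.reverse = wc c p := by simp [wc]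

theorem wc_nonneg {c : Sym2 V → ℝ} (hc : ∀ e, 0 ≤ c e) {a b : V} (p : G.Walk a b) :
    0 ≤ wc c p := by
  apply List.sum_nonneg
  simp only [List.mem_map]
  rintro _ ⟨e, _, rfl⟩
  exact hc e

/-- sum over a path's edge finset is the walk cost -/
theorem sum_edges_eq_wc (c : Sym2 V → ℝ) {a b : V} (p : G.Walk a b) (hp : p.IsPath) :
    ∑ e ∈ p.edges.toFinset, c e = wc c p := by
  rw [wc, List.sum_toFinset _ hp.isTrail.edges_nodup]

theorem sum_toFinset_le (c : Sym2 V → ℝ) (hc : ∀ e, 0 ≤ c e) (l : List (Sym2 V)) :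
    ∑ e ∈ l.toFinset, c e ≤ (l.map c).sum := by
  induction l with
  | nil => simp
  | cons e l ih =>
    rw [List.toFinset_cons, List.map_cons, List.sum_cons]
    by_cases h : e ∈ l.toFinset
    · rw [Finset.insert_eq_of_mem h]; linarith [hc e]
    · rw [Finset.sum_insert h]; linarith

/-- every pair of walks contains a Steiner forest -/
theorem exists_steiner {s₁ t₁ s₂ t₂ : V} (p : G.Walk s₁ t₁) (q : G.Walk s₂ t₂) :
    ∃ F : Finset (Sym2 V), F ⊆ (p.edges ++ q.edges).toFinset ∧
      IsSteinerForest G s₁ t₁ s₂ t₂ F := by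
  classical
  set E : Finset (Sym2 V) := (p.edges ++ q.edges).toFinset with hE
  have hEG : (↑E : Set (Sym2 V)) ⊆ G.edgeSet := by
    intro e he
    simp only [hE, List.coe_toFinset, Set.mem_setOf_eq, List.mem_append] at he
    rcases he with he | he
    · exact p.edges_subset_edgeSet he
    · exact q.edges_subset_edgeSet he
  obtain ⟨F, hF1, hF2, hF3⟩ :=
    (SimpleGraph.fromEdgeSet (↑E : Set (Sym2 V))).exists_isAcyclic_reachable_eq_le
  have hle : F ≤ G := by
    refine hF1.trans ?_
    intro a b hab
    rw [SimpleGraph.fromEdgeSet_adj] at hab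
    exact hEG hab.1
  have hsub : F.edgeSet ⊆ ↑E := by
    intro e
    induction e with
    | _ a b =>
      intro h
      have := hF1 h
      rw [SimpleGraph.fromEdgeSet_adj] at this
      exact this.1
  have hfin : F.edgeSet.Finite := E.finite_toSet.subset hsub
  refine ⟨hfin.toFinset, ?_, ?_, ?_, ?_, ?_⟩
  · intro e he
    exact hsub (by simpa using he)
  · intro e he
    have : e ∈ F.edgeSet := by simpa using he
    exact hEG (hsub this)
  · simpa using hF2
  · have hr : F.Reachable s₁ t₁ := by
      rw [hF3]
      refine ⟨p.transfer _ ?_⟩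
      intro e he
      rw [SimpleGraph.edgeSet_fromEdgeSet]
      refine ⟨by simp [hE, he], ?_⟩
      exact G.not_isDiag_of_mem_edgeSet (p.edges_subset_edgeSet he)
    obtain ⟨r, hr⟩ := hr.exists_isPath
    refine ⟨r.mapLe hle, by simpa using hr, ?_⟩
    intro e he
    have : e ∈ r.edges := by simpa using he
    simpa using r.edges_subset_edgeSet this
  · have hr : F.Reachable s₂ t₂ := by
      rw [hF3]
      refine ⟨q.transfer _ ?_⟩
      intro e he
      rw [SimpleGraph.edgeSet_fromEdgeSet]
      refine ⟨by simp [hE, he], ?_⟩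
      exact G.not_isDiag_of_mem_edgeSet (q.edges_subset_edgeSet he)
    obtain ⟨r, hr⟩ := hr.exists_isPath
    refine ⟨r.mapLe hle, by simpa using hr, ?_⟩
    intro e he
    have : e ∈ r.edges := by simpa using he
    simpa using r.edges_subset_edgeSet this

/-- Existence of an optimal Steiner forest -/
theorem exists_optimal [Fintype V] (G : SimpleGraph V) {s₁ t₁ s₂ t₂ : V}
    (h₁ : G.Reachable s₁ t₁) (h₂ : G.Reachable s₂ t₂) (c : Sym2 V → ℝ) :
    ∃ F, IsOptimalSteinerForest G s₁ t₁ s₂ t₂ c F := by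
  classical
  obtain ⟨p⟩ := h₁
  obtain ⟨q⟩ := h₂
  obtain ⟨F, _, hF⟩ := exists_steiner p q
  obtain ⟨F0, h0, hmin⟩ := Finset.exists_min_image
    (Finset.univ.filter fun F => IsSteinerForest G s₁ t₁ s₂ t₂ F) (cost c) ⟨F, by simpa using hF⟩
  refine ⟨F0, by simpa using h0, fun F' hF' => hmin F' (by simpa using hF')⟩

/-- minimum cost walk -/
theorem exists_min_walk [Fintype V] (c : Sym2 V → ℝ) (hc : ∀ e, 0 ≤ c e) {a b : V}
    (h : G.Reachable a b) : ∃ p : G.Walk a b, p.IsPath ∧ ∀ q : G.Walk a b, wc c p ≤ wc c q := by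
  classical
  haveI : Nonempty (G.Path a b) := by
    obtain ⟨p, hp⟩ := h.exists_isPath
    exact ⟨⟨p, hp⟩⟩
  obtain ⟨p, hp⟩ := Finite.exists_min (fun p : G.Path a b => wc c p.1)
  refine ⟨p.1, p.2, fun q => (hp ⟨q.bypass, q.bypass_isPath⟩).trans ?_⟩
  show wc c q.bypass ≤ wc c q
  rw [← sum_edges_eq_wc c _ q.bypass_isPath]
  refine (Finset.sum_le_sum_of_subset_of_nonneg (t := q.edges.toFinset) ?_ fun e _ _ => hc e).trans
    (sum_toFinset_le c hc _)
  intro e he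
  simp only [List.mem_toFinset] at he ⊢
  exact q.edges_bypass_subset he

end walks
end NDG

namespace NDG
variable {V : Type*} [DecidableEq V]
set_option linter.unusedSectionVars false
open SimpleGraph

/-- A piece: a walk with its endpoints bundled. -/
abbrev Piece (G : SimpleGraph V) := Σ a : V, Σ b : V, G.Walk a b

/-- bundle a walk -/
def pc {G : SimpleGraph V} {a b : V} (p : G.Walk a b) : Piece G := ⟨a, b, p⟩

/-- total cost of pieces -/
def tot {G : SimpleGraph V} (c : Sym2 V → ℝ) (L : List (Piece G)) : ℝ :=
  (L.map fun t => wc c t.2.2).sum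

/-- pieces connect y and z -/
def Conn {G : SimpleGraph V} (L : List (Piece G)) (y z : V) : Prop :=
  ∀ S : V → Prop, (∀ t ∈ L, (S t.1 ↔ S t.2.1)) → (S y → S z)

section
variable {G : SimpleGraph V}

theorem Conn.walk {L : List (Piece G)} {y z : V} (h : Conn L y z) :
    ∃ p : G.Walk y z, ∀ e ∈ p.edges, e ∈ L.flatMap (fun t => t.2.2.edges) := by
  let E : Set (Sym2 V) := {e | e ∈ L.flatMap (fun t => t.2.2.edges)}
  have hEG : E ⊆ G.edgeSet := by
    intro e he
    simp only [E, Set.mem_ofPred_eq, List.mem_flatMap] at he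
    obtain ⟨t, _, ht⟩ := he
    exact t.2.2.edges_subset_edgeSet ht
  have hle : SimpleGraph.fromEdgeSet E ≤ G := by
    intro a b hab
    rw [SimpleGraph.fromEdgeSet_adj] at hab
    exact hEG hab.1
  have hr := h (fun s => (SimpleGraph.fromEdgeSet E).Reachable y s) (by
    rintro t ht
    have : (SimpleGraph.fromEdgeSet E).Reachable t.1 t.2.1 := by
      refine ⟨t.2.2.transfer _ ?_⟩
      intro e he
      rw [SimpleGraph.edgeSet_fromEdgeSet]
      exact ⟨List.mem_flatMap.2 ⟨t, ht, he⟩,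
        G.not_isDiag_of_mem_edgeSet (t.2.2.edges_subset_edgeSet he)⟩
    exact ⟨fun h => h.trans this, fun h => h.trans this.symm⟩) (Reachable.refl _)
  obtain ⟨r⟩ := hr
  refine ⟨r.mapLe hle, fun e he => ?_⟩
  have : e ∈ r.edges := by simpa using he
  have := r.edges_subset_edgeSet this
  rw [SimpleGraph.edgeSet_fromEdgeSet] at this
  exact this.1

/-- the exchange lemma -/
theorem exch_aux {u v w x : V} {c : Sym2 V → ℝ} (hc : ∀ e, 0 ≤ c e) {T : ℝ}
    (hopt : ∀ (p : G.Walk u v) (q : G.Walk w x), T ≤ ∑ e ∈ (p.edges ++ q.edges).toFinset, c e)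
    (L : List (Piece G)) (hu : Conn L u v) (hw : Conn L w x) : T ≤ tot c L := by
  obtain ⟨p, hp⟩ := hu.walk
  obtain ⟨q, hq⟩ := hw.walk
  refine (hopt p q).trans ?_
  have h1 : ∑ e ∈ (p.edges ++ q.edges).toFinset, c e ≤
      ∑ e ∈ (L.flatMap (fun t => t.2.2.edges)).toFinset, c e := by
    apply Finset.sum_le_sum_of_subset_of_nonneg
    · intro e he
      simp only [List.mem_toFinset, List.mem_append] at he ⊢
      rcases he with he | he
      · exact hp e he
      · exact hq e he
    · exact fun e _ _ => hc e
  refine h1.trans ((sum_toFinset_le c hc _).trans (le_of_eq ?_))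
  unfold tot
  clear h1 hp hq hu hw
  induction L with
  | nil => simp
  | cons t L ih => simp [ih, wc]

end

/-- two paths meeting in a common subpath, forming a forest that is optimal -/
structure HC (G : SimpleGraph V) (c : Sym2 V → ℝ) (u v w x : V) where
  a : V
  b : V
  Lu : G.Walk u a
  M : G.Walk a b
  Ru : G.Walk b v
  Ll : G.Walk w a
  Rl : G.Walk b x
  hc : ∀ e, 0 ≤ c e
  hPu : ((Lu.append M).append Ru).IsPath
  hPl : ((Ll.append M).append Rl).IsPath
  hforest : (SimpleGraph.fromEdgeSet
      {e | e ∈ ((Lu.append M).append Ru).edges ∨ e ∈ ((Ll.append M).append Rl).edges}).IsAcyclic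
  hdisj : ∀ y, y ∈ ((Lu.append M).append Ru).support →
      y ∈ ((Ll.append M).append Rl).support → y ∈ M.support
  hopt : ∀ (p : G.Walk u v) (q : G.Walk w x),
    wc c Lu + wc c M + wc c Ru + wc c Ll + wc c Rl ≤ ∑ e ∈ (p.edges ++ q.edges).toFinset, c e

namespace HC
variable {G : SimpleGraph V} {c : Sym2 V → ℝ} {u v w x : V}

/-- total cost -/
def T (H : HC G c u v w x) : ℝ :=
    wc c H.Lu + wc c H.M + wc c H.Ru + wc c H.Ll + wc c H.Rl

theorem exch (H : HC G c u v w x) (L : List (Piece G)) 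
    (hu : Conn L u v := by
      (unfold Conn; simp only [List.forall_mem_cons, pc, List.not_mem_nil, false_imp_iff, implies_true, and_true]; grind))
    (hw : Conn L w x := by
      (unfold Conn; simp only [List.forall_mem_cons, pc, List.not_mem_nil, false_imp_iff, implies_true, and_true]; grind)) :
    wc c H.Lu + wc c H.M + wc c H.Ru + wc c H.Ll + wc c H.Rl ≤ tot c L :=
  exch_aux H.hc H.hopt L hu hw

/-- exchange the players -/
def swap (H : HC G c u v w x) : HC G c w x u v where
  a := H.a
  b := H.b
  Lu := H.Ll
  M := H.M
  Ru := H.Rl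
  Ll := H.Lu
  Rl := H.Ru
  hc := H.hc
  hPu := H.hPl
  hPl := H.hPu
  hforest := by
    have := H.hforest
    convert this using 3
    funext e
    exact propext or_comm
  hdisj := fun y h1 h2 => H.hdisj y h2 h1
  hopt := fun p q => by
    have := H.hopt q p
    have h2 : (q.edges ++ p.edges).toFinset = (p.edges ++ q.edges).toFinset := by
      ext; simp [or_comm]
    rw [h2] at this
    linarith

/-- reverse both paths -/
def rev (H : HC G c u v w x) : HC G c v u x w where
  a := H.b
  b := H.a
  Lu := H.Ru.reverse
  M := H.M.reverse
  Ru := H.Lu.reverse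
  Ll := H.Rl.reverse
  Rl := H.Ll.reverse
  hc := H.hc
  hPu := by
    have := H.hPu.reverse
    simpa [Walk.reverse_append, Walk.append_assoc] using this
  hPl := by
    have := H.hPl.reverse
    simpa [Walk.reverse_append, Walk.append_assoc] using this
  hforest := by
    have := H.hforest
    convert this using 3
    funext e
    apply propext
    simp only [Walk.edges_append, Walk.edges_reverse, List.mem_append, List.mem_reverse]
    tauto
  hdisj := fun y h1 h2 => by
    have := H.hdisj y
    simp only [Walk.mem_support_append_iff, Walk.support_reverse, List.mem_reverse] at *
    tauto
  hopt := fun p q => by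
    have := H.hopt p.reverse q.reverse
    have h2 : (p.reverse.edges ++ q.reverse.edges).toFinset = (p.edges ++ q.edges).toFinset := by
      ext; simp
    rw [h2] at this
    simp only [wc_reverse]
    linarith


theorem LuM (H : HC G c u v w x) {y : V} (h1 : y ∈ H.Lu.support) (h2 : y ∈ H.M.support) :
    y = H.a := by
  have := H.hPu
  rw [isPath_append_iff, isPath_append_iff] at this
  exact this.1.2.2 y h1 h2

theorem MRu (H : HC G c u v w x) {y : V} (h1 : y ∈ H.M.support) (h2 : y ∈ H.Ru.support) :
    y = H.b := by
  have := H.hPu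
  rw [isPath_append_iff, isPath_append_iff] at this
  exact this.2.2 y (by simp [h1]) h2

theorem LuRu (H : HC G c u v w x) {y : V} (h1 : y ∈ H.Lu.support) (h2 : y ∈ H.Ru.support) :
    y = H.a ∧ y = H.b := by
  have := H.hPu
  rw [isPath_append_iff, isPath_append_iff] at this
  have h := this.2.2 y (by simp [h1]) h2
  subst h
  exact ⟨this.1.2.2 _ h1 (by simp), rfl⟩

theorem LlM (H : HC G c u v w x) {y : V} (h1 : y ∈ H.Ll.support) (h2 : y ∈ H.M.support) :
    y = H.a := H.swap.LuM h1 h2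

theorem MRl (H : HC G c u v w x) {y : V} (h1 : y ∈ H.M.support) (h2 : y ∈ H.Rl.support) :
    y = H.b := H.swap.MRu h1 h2

theorem LlRl (H : HC G c u v w x) {y : V} (h1 : y ∈ H.Ll.support) (h2 : y ∈ H.Rl.support) :
    y = H.a ∧ y = H.b := H.swap.LuRu h1 h2

theorem LuLl (H : HC G c u v w x) {y : V} (h1 : y ∈ H.Lu.support) (h2 : y ∈ H.Ll.support) :
    y = H.a := H.LuM h1 (H.hdisj y (by simp [h1]) (by simp [h2]))

theorem RuRl (H : HC G c u v w x) {y : V} (h1 : y ∈ H.Ru.support) (h2 : y ∈ H.Rl.support) :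
    y = H.b := H.MRu (H.hdisj y (by simp [h1]) (by simp [h2])) h1

theorem LuRl (H : HC G c u v w x) {y : V} (h1 : y ∈ H.Lu.support) (h2 : y ∈ H.Rl.support) :
    y = H.a ∧ y = H.b :=
  have h := H.hdisj y (by simp [h1]) (by simp [h2])
  ⟨H.LuM h1 h, H.MRl h h2⟩

theorem LlRu (H : HC G c u v w x) {y : V} (h1 : y ∈ H.Ll.support) (h2 : y ∈ H.Ru.support) :
    y = H.a ∧ y = H.b := H.swap.LuRl h1 h2

theorem mem_edge_support {y z : V} {p : G.Walk y z} {e : Sym2 V} (he : e ∈ p.edges) :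
    ∀ r ∈ e, r ∈ p.support := by
  induction e with
  | _ s t =>
    intro r hr
    rw [Sym2.mem_iff] at hr
    rcases hr with rfl | rfl
    · exact p.fst_mem_support_of_mem_edges he
    · exact p.snd_mem_support_of_mem_edges he

theorem edge_disj {y z y' z' s : V} {p : G.Walk y z} {q : G.Walk y' z'}
    (h : ∀ r, r ∈ p.support → r ∈ q.support → r = s) {e : Sym2 V} (he : e ∈ p.edges)
    (he' : e ∈ q.edges) : False := by
  have h1 := mem_edge_support he
  have h2 := mem_edge_support he'
  have hd := G.not_isDiag_of_mem_edgeSet (p.edges_subset_edgeSet he)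
  induction e with
  | _ s' t =>
    have a1 := h s' (h1 _ (by simp)) (h2 _ (by simp))
    have a2 := h t (h1 _ (by simp)) (h2 _ (by simp))
    apply hd
    simp [a1, a2]

theorem hmeet (H : HC G c u v w x) : ∀ e, e ∈ ((H.Lu.append H.M).append H.Ru).edges →
      e ∈ ((H.Ll.append H.M).append H.Rl).edges → e ∈ H.M.edges := by
  intro e h1 h2
  simp only [Walk.edges_append, List.mem_append] at h1 h2
  rcases h1 with (h1 | h1) | h1
  · rcases h2 with (h2 | h2) | h2
    · exact (edge_disj (fun r => H.LuLl) h1 h2).elim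
    · exact h2
    · exact (edge_disj (fun r h h' => (H.LuRl h h').1) h1 h2).elim
  · exact h1
  · rcases h2 with (h2 | h2) | h2
    · exact (edge_disj (fun r h h' => (H.LlRu h h').1) h2 h1).elim
    · exact h2
    · exact (edge_disj (fun r => H.RuRl) h1 h2).elim

end HC
end NDG

namespace NDG
variable {V : Type*} [DecidableEq V]
set_option linter.unusedSectionVars false
open SimpleGraph

section
variable {G : SimpleGraph V}

/-- reroute `p` along `q` between the first and the last common vertex -/
theorem splice {s t y z : V} (p : G.Walk s t) (q : G.Walk y z) (hp : p.IsPath) (hq : q.IsPath)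
    (hpq : ∃ r ∈ p.support, r ∈ q.support) :
    ∃ p' : G.Walk s t, p'.IsPath ∧ PBC.CommonMid p' q ∧
      (∀ r ∈ p'.support, r ∈ p.support ∨ r ∈ q.support) ∧
      (y ∈ p'.support → y ∈ p.support) ∧ (z ∈ p'.support → z ∈ p.support) ∧
      (∃ r ∈ p'.support, r ∈ q.support) := by
  obtain ⟨c, p1, p2, rfl, hc, h1⟩ := firstHit (fun r => r ∈ q.support) p hpq
  obtain ⟨d, p3, p4, rfl, hd, h4⟩ := lastHit (fun r => r ∈ q.support) p2 ⟨c, by simp, hc⟩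
  rw [isPath_append_iff, isPath_append_iff] at hp
  obtain ⟨hp1, ⟨hp3, hp4, h34⟩, h134⟩ := hp
  simp only [Walk.mem_support_append_iff] at *
  have key : ∀ m : G.Walk c d, m.IsPath → (m.darts <:+: q.darts ∨ m.reverse.darts <:+: q.darts) →
      (∀ r ∈ m.support, r ∈ q.support) →
      (y ∈ m.support → y = c ∨ y = d) → (z ∈ m.support → z = c ∨ z = d) →
    ∃ p' : G.Walk s t, p'.IsPath ∧ PBC.CommonMid p' q ∧
      (∀ r ∈ p'.support, (r ∈ p1.support ∨ r ∈ p3.support ∨ r ∈ p4.support) ∨ r ∈ q.support) ∧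
      (y ∈ p'.support → (y ∈ p1.support ∨ y ∈ p3.support ∨ y ∈ p4.support)) ∧
      (z ∈ p'.support → (z ∈ p1.support ∨ z ∈ p3.support ∨ z ∈ p4.support)) ∧
      (∃ r ∈ p'.support, r ∈ q.support) := by
    intro m hm hmq hms hy hz
    have hcm := m.start_mem_support
    have hdm := m.end_mem_support
    have hc1 := p1.end_mem_support
    have hd4 := p4.start_mem_support
    refine ⟨p1.append (m.append p4), ?_, ⟨c, d, m, hm, ?_, hmq, ?_⟩, ?_, ?_, ?_, ?_⟩
    · rw [isPath_append_iff, isPath_append_iff]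
      refine ⟨hp1, ⟨hm, hp4, fun r h h' => h4 r h' (hms r h)⟩, ?_⟩
      intro r hr hr'
      simp only [Walk.mem_support_append_iff] at hr'
      rcases hr' with h | h
      · exact h1 r hr (hms r h)
      · exact h134 r hr (Or.inr h)
    · simp only [Walk.darts_append]
      exact ⟨p1.darts, p4.darts, by simp⟩
    · intro r hr hrq
      simp only [Walk.mem_support_append_iff] at hr
      rcases hr with h | h | h
      · rw [h1 r h hrq]; exact hcm
      · exact h
      · rw [h4 r h hrq]; exact hdm
    · intro r hr
      simp only [Walk.mem_support_append_iff] at hr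
      rcases hr with h | h | h
      · exact Or.inl (Or.inl h)
      · exact Or.inr (hms r h)
      · exact Or.inl (Or.inr (Or.inr h))
    · intro hr
      simp only [Walk.mem_support_append_iff] at hr
      grind
    · intro hr
      simp only [Walk.mem_support_append_iff] at hr
      grind
    · exact ⟨c, by simp, hc⟩
  obtain ⟨qa, qb, rfl⟩ := splitAt q hc
  rw [isPath_append_iff] at hq
  obtain ⟨hqa, hqb, hqab⟩ := hq
  have hya := qa.start_mem_support
  have hzb := qb.end_mem_support
  simp only [Walk.mem_support_append_iff] at *
  rcases hd with hd | hd
  · obtain ⟨qc, m, rfl⟩ := splitAt qa hd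
    rw [isPath_append_iff] at hqa
    obtain ⟨x1, x2, x3⟩ := hqa
    refine key m.reverse x2.reverse (Or.inr ?_) ?_ ?_ ?_
    · simp only [Walk.darts_append, Walk.reverse_reverse]
      exact ⟨qc.darts, qb.darts, by simp⟩
    · simp only [Walk.mem_support_append_iff, Walk.support_reverse, List.mem_reverse]
      intro r hr
      exact Or.inl (Or.inr hr)
    · simp only [Walk.support_reverse, List.mem_reverse]
      intro hy
      exact Or.inr (x3 y qc.start_mem_support hy)
    · simp only [Walk.support_reverse, List.mem_reverse]
      intro hy
      exact Or.inl (hqab z (by simp [hy]) hzb)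
  · obtain ⟨m, qc, rfl⟩ := splitAt qb hd
    rw [isPath_append_iff] at hqb
    obtain ⟨x1, x2, x3⟩ := hqb
    refine key m x1 (Or.inl ?_) ?_ ?_ ?_
    · simp only [Walk.darts_append]
      exact ⟨qa.darts, qc.darts, by simp⟩
    · simp only [Walk.mem_support_append_iff]
      intro r hr
      exact Or.inr (Or.inl hr)
    · intro hy
      exact Or.inl (hqab y hya (by simp [hy]))
    · intro hy
      exact Or.inr (x3 z hy qc.end_mem_support)

theorem edges_ne_nil_of_ne {y z : V} (p : G.Walk y z) (h : y ≠ z) : p.edges ≠ [] := by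
  intro hh
  cases p with
  | nil => exact h rfl
  | cons => simp at hh

theorem exists_edge_of_ne {y z : V} (p : G.Walk y z) (h : y ≠ z) : ∃ e, e ∈ p.edges :=
  List.exists_mem_of_ne_nil _ (edges_ne_nil_of_ne p h)

end

namespace HC
variable {G : SimpleGraph V} {c : Sym2 V → ℝ} {u v w x : V}

/-- data of q2, q3 for a bad configuration -/
structure Ears (H : HC G c u v w x) where
  J' : V
  J : V
  M0 : G.Walk H.a J'
  My : G.Walk J' J
  Mz : G.Walk J H.b
  hM : H.M = (M0.append My).append Mz
  hM0 : H.a ≠ J'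
  hMy : J' ≠ J
  hMz : J ≠ H.b
  a2 : V
  Ll1 : G.Walk w a2
  Ll2 : G.Walk a2 H.a
  hLl : H.Ll = Ll1.append Ll2
  ha2 : a2 ≠ H.a
  q2 : G.Walk a2 J
  hq2 : q2.IsPath
  hq2u : ∀ y ∈ q2.support, y ∈ ((H.Lu.append H.M).append H.Ru).support → y = a2 ∨ y = J
  hq2l : ∀ y ∈ q2.support, y ∈ ((H.Ll.append H.M).append H.Rl).support → y = a2 ∨ y = J
  b3 : V
  Rl1 : G.Walk H.b b3
  Rl2 : G.Walk b3 x
  hRl : H.Rl = Rl1.append Rl2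
  hb3 : b3 ≠ H.b
  q3 : G.Walk J' b3
  hq3 : q3.IsPath
  hq3u : ∀ y ∈ q3.support, y ∈ ((H.Lu.append H.M).append H.Ru).support → y = J' ∨ y = b3
  hq3l : ∀ y ∈ q3.support, y ∈ ((H.Ll.append H.M).append H.Rl).support → y = J' ∨ y = b3
  hq23 : ∀ y ∈ q2.support, y ∉ q3.support

/-- assemble a PBC -/
def Ears.mk' {H : HC G c u v w x} (E : H.Ears) {a1 b1 : V} (q1 S1 : G.Walk a1 b1)
    (hab : a1 ≠ b1)
    (hq1path : q1.IsPath) (hS1 : S1.darts <:+: ((H.Lu.append H.M).append H.Ru).darts)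
    (hq1closes : ∀ y ∈ q1.support, y ∈ ((H.Lu.append H.M).append H.Ru).support → y = a1 ∨ y = b1)
    (hRu : ∃ e ∈ S1.edges, e ∈ H.Ru.edges)
    (hMy : ∀ e ∈ E.My.edges, e ∈ S1.edges)
    (hM0 : ∃ e ∈ E.M0.edges, e ∈ S1.edges)
    (hMz : ∃ e ∈ E.Mz.edges, e ∈ S1.edges) : PBC G u v w x where
  a := H.a
  b := H.b
  Lu := H.Lu
  M := H.M
  Ru := H.Ru
  Ll := H.Ll
  Rl := H.Rl
  hM_ne := by
    obtain ⟨e, he, _⟩ := hMz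
    rw [E.hM]
    simp only [Walk.edges_append]
    intro h
    simp only [List.append_eq_nil_iff] at h
    rw [h.2] at he
    simp at he
  hPu := H.hPu
  hPl := H.hPl
  hforest := H.hforest
  hmeet := H.hmeet
  hRu_ne := by
    obtain ⟨e, _, he⟩ := hRu
    exact List.ne_nil_of_mem he
  hLl_ne := by
    rw [E.hLl, Walk.edges_append]
    have := edges_ne_nil_of_ne E.Ll2 E.ha2
    simp [this]
  hRl_ne := by
    rw [E.hRl, Walk.edges_append]
    have := edges_ne_nil_of_ne E.Rl1 E.hb3.symm
    simp [this]
  a1 := a1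
  b1 := b1
  q1 := q1
  S1 := S1
  hq1path := hq1path
  hq1_ne := edges_ne_nil_of_ne _ hab
  hS1 := hS1
  hq1closes := hq1closes
  hC1Ru := hRu
  hC1M := by
    obtain ⟨e, he, h⟩ := hMz
    refine ⟨e, h, ?_⟩
    simp [E.hM, he]
  a2 := E.a2
  b2 := E.J
  q2 := E.q2
  S2 := E.Ll2.append (E.M0.append E.My)
  hq2path := E.hq2
  hq2_ne := by
    apply edges_ne_nil_of_ne
    rintro h
    have h1 : E.a2 ∈ H.Ll.support := by simp [E.hLl]
    have h2 : E.a2 ∈ H.M.support := by simp [E.hM, h]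
    exact E.ha2 (H.LlM h1 h2)
  hS2 := by
    rw [E.hLl, E.hM, E.hRl]
    simp only [Walk.darts_append]
    exact ⟨E.Ll1.darts, E.Mz.darts ++ E.Rl1.darts ++ E.Rl2.darts, by simp⟩
  hq2closes := E.hq2l
  hC2Ll := by
    obtain ⟨e, he⟩ := exists_edge_of_ne E.Ll2 E.ha2
    exact ⟨e, by simp [he], by simp [E.hLl, he]⟩
  hC2M := by
    obtain ⟨e, he⟩ := exists_edge_of_ne E.M0 E.hM0
    exact ⟨e, by simp [he], by simp [E.hM, he]⟩
  hMC2 := by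
    obtain ⟨e, he⟩ := exists_edge_of_ne E.Mz E.hMz
    refine ⟨e, by simp [E.hM, he], ?_⟩
    have hn := H.hPl.isTrail.edges_nodup
    rw [E.hLl, E.hM, E.hRl] at hn
    simp only [Walk.edges_append, List.nodup_append, List.mem_append] at hn ⊢
    grind
  a3 := E.J'
  b3 := E.b3
  q3 := E.q3
  S3 := E.My.append (E.Mz.append E.Rl1)
  hq3path := E.hq3
  hq3_ne := by
    apply edges_ne_nil_of_ne
    rintro h
    have h1 : E.b3 ∈ H.Rl.support := by simp [E.hRl]
    have h2 : E.b3 ∈ H.M.support := by simp [E.hM, ← h]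
    exact E.hb3 (H.MRl h2 h1)
  hS3 := by
    rw [E.hLl, E.hM, E.hRl]
    simp only [Walk.darts_append]
    exact ⟨E.Ll1.darts ++ E.Ll2.darts ++ E.M0.darts, E.Rl2.darts, by simp⟩
  hq3closes := E.hq3l
  hC3Rl := by
    obtain ⟨e, he⟩ := exists_edge_of_ne E.Rl1 E.hb3.symm
    exact ⟨e, by simp [he], by simp [E.hRl, he]⟩
  hC3M := by
    obtain ⟨e, he⟩ := exists_edge_of_ne E.Mz E.hMz
    exact ⟨e, by simp [he], by simp [E.hM, he]⟩
  hMC3 := by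
    obtain ⟨e, he⟩ := exists_edge_of_ne E.M0 E.hM0
    refine ⟨e, by simp [E.hM, he], ?_⟩
    have hn := H.hPl.isTrail.edges_nodup
    rw [E.hLl, E.hM, E.hRl] at hn
    simp only [Walk.edges_append, List.nodup_append, List.mem_append] at hn ⊢
    grind
  hC_ne := by
    obtain ⟨e, he⟩ := exists_edge_of_ne E.My E.hMy
    exact ⟨e, by simp [E.hM, he], by simp [he], by simp [he]⟩
  hC_sub := by
    intro e _ h2 h3
    apply hMy
    have hn := H.hPl.isTrail.edges_nodup
    rw [E.hLl, E.hM, E.hRl] at hn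
    simp only [Walk.edges_append, List.nodup_append, List.mem_append] at hn h2 h3
    grind
  hC1C2 := by
    obtain ⟨e, he, h⟩ := hM0
    refine ⟨e, by simp [E.hM, he], h, by simp [he], ?_⟩
    have hn := H.hPl.isTrail.edges_nodup
    rw [E.hLl, E.hM, E.hRl] at hn
    simp only [Walk.edges_append, List.nodup_append, List.mem_append] at hn ⊢
    grind
  hC1C3 := by
    obtain ⟨e, he, h⟩ := hMz
    refine ⟨e, by simp [E.hM, he], h, by simp [he], ?_⟩
    have hn := H.hPl.isTrail.edges_nodup
    rw [E.hLl, E.hM, E.hRl] at hn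
    simp only [Walk.edges_append, List.nodup_append, List.mem_append] at hn ⊢
    grind

end HC
end NDG

namespace NDG
variable {V : Type*} [DecidableEq V]
set_option linter.unusedSectionVars false
open SimpleGraph

namespace HC
variable {G : SimpleGraph V} {c : Sym2 V → ℝ} {u v w x : V}
variable {H : HC G c u v w x}

theorem M_isPath (H : HC G c u v w x) : H.M.IsPath := by
  have := H.hPu
  rw [isPath_append_iff, isPath_append_iff] at this
  exact this.1.2.1

theorem Ru_isPath (H : HC G c u v w x) : H.Ru.IsPath := by
  have := H.hPu
  rw [isPath_append_iff, isPath_append_iff] at this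
  exact this.2.1

theorem Lu_isPath (H : HC G c u v w x) : H.Lu.IsPath := by
  have := H.hPu
  rw [isPath_append_iff, isPath_append_iff] at this
  exact this.1.1

theorem Ears.J_ne_a (E : H.Ears) : E.J ≠ H.a := by
  intro h
  have := H.M_isPath
  rw [E.hM, isPath_append_iff, isPath_append_iff] at this
  exact E.hM0 (this.1.2.2 H.a (by simp) (by simp [← h]))

theorem Ears.J'_ne_b (E : H.Ears) : E.J' ≠ H.b := by
  intro h
  have := H.M_isPath
  rw [E.hM, isPath_append_iff, isPath_append_iff] at this
  exact E.hMz (this.2.2 H.b (by simp [← h]) (by simp)).symm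

theorem Ears.J_mem (E : H.Ears) : E.J ∈ H.M.support := by simp [E.hM]
theorem Ears.J'_mem (E : H.Ears) : E.J' ∈ H.M.support := by simp [E.hM]
theorem Ears.a2_mem (E : H.Ears) : E.a2 ∈ H.Ll.support := by simp [E.hLl]
theorem Ears.b3_mem (E : H.Ears) : E.b3 ∈ H.Rl.support := by simp [E.hRl]
theorem Ears.M0_sub (E : H.Ears) {y : V} (h : y ∈ E.M0.support) : y ∈ H.M.support := by
  simp [E.hM, h]
theorem Ears.ab (E : H.Ears) : H.a ≠ H.b := by
  intro h
  have := H.M_isPath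
  rw [E.hM, isPath_append_iff, isPath_append_iff] at this
  have h1 := E.J_ne_a
  have h2 := this.2.2 H.a (by simp) (by simp [h])
  exact h1 h2.symm
theorem Ears.J_nM0 (E : H.Ears) : E.J ∉ E.M0.support := by
  intro h
  have := H.M_isPath
  rw [E.hM, isPath_append_iff, isPath_append_iff] at this
  exact E.hMy (this.1.2.2 _ h (by simp)).symm

theorem Ears.exS1 (E : H.Ears) {a1 b1 : V} 
    (ha1 : a1 ∈ H.Lu.support ∨ (a1 ∈ E.M0.support ∧ a1 ≠ E.J')) (hb1 : b1 ∈ H.Ru.support)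
    (hb1' : b1 ≠ H.b) : ∃ S1 : G.Walk a1 b1, 
      S1.darts <:+: ((H.Lu.append H.M).append H.Ru).darts ∧
      (∃ e ∈ S1.edges, e ∈ H.Ru.edges) ∧ (∀ e ∈ E.My.edges, e ∈ S1.edges) ∧
      (∃ e ∈ E.M0.edges, e ∈ S1.edges) ∧ (∃ e ∈ E.Mz.edges, e ∈ S1.edges) ∧ 
      (a1 = H.a → (∀ e ∈ H.M.edges, e ∈ S1.edges) ∧ ∀ e ∈ S1.edges, e ∉ H.Lu.edges) := by
  obtain ⟨Ru1, Ru2, hRu⟩ := splitAt H.Ru hb1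
  obtain ⟨er, her⟩ := exists_edge_of_ne Ru1 hb1'.symm
  obtain ⟨ez, hez⟩ := exists_edge_of_ne E.Mz E.hMz
  obtain ⟨e0, he0⟩ := exists_edge_of_ne E.M0 E.hM0
  by_cases ha : a1 = H.a
  · subst ha
    refine ⟨H.M.append Ru1, ?_, ⟨er, by simp [her], by simp [hRu, her]⟩, ?_, ⟨e0, he0, ?_⟩, ⟨ez, hez, ?_⟩, ?_⟩
    · rw [hRu]
      simp only [Walk.darts_append]
      exact ⟨H.Lu.darts, Ru2.darts, by simp⟩
    · intro e he
      simp [E.hM, he]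
    · simp [E.hM, he0]
    · simp [E.hM, hez]
    · intro _
      refine ⟨fun e he => by simp [he], ?_⟩
      have hn := H.hPu.isTrail.edges_nodup
      rw [hRu] at hn
      simp only [Walk.edges_append, List.nodup_append, List.mem_append] at hn ⊢
      grind
  rcases ha1 with ha1 | ⟨ha1, ha1'⟩
  · obtain ⟨Lu1, Lu2, hLu⟩ := splitAt H.Lu ha1
    refine ⟨Lu2.append (H.M.append Ru1), ?_, ⟨er, by simp [her], by simp [hRu, her]⟩, ?_, ⟨e0, he0, ?_⟩, ⟨ez, hez, ?_⟩, fun h => absurd h ha⟩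
    · rw [hRu, hLu]
      simp only [Walk.darts_append]
      exact ⟨Lu1.darts, Ru2.darts, by simp⟩
    · intro e he
      simp [E.hM, he]
    · simp [E.hM, he0]
    · simp [E.hM, hez]
  · obtain ⟨M1, M2, hM0⟩ := splitAt E.M0 ha1
    obtain ⟨e1, he1⟩ := exists_edge_of_ne M2 ha1'
    refine ⟨M2.append (E.My.append (E.Mz.append Ru1)), ?_, ⟨er, by simp [her], by simp [hRu, her]⟩, ?_, ⟨e1, ?_, ?_⟩, ⟨ez, hez, ?_⟩, fun h => absurd h ha⟩
    · rw [hRu, E.hM, hM0]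
      simp only [Walk.darts_append]
      exact ⟨H.Lu.darts ++ M1.darts, Ru2.darts, by simp⟩
    · intro e he
      simp [he]
    · rw [hM0]; simp [he1]
    · simp [he1]
    · simp [hez]

theorem Ears.top_i (E : H.Ears) {a1 b1 : V} (q1 : G.Walk a1 b1) (hq1 : q1.IsPath)
    (ha1 : a1 ∈ H.Lu.support ∨ (a1 ∈ E.M0.support ∧ a1 ≠ E.J')) (hb1 : b1 ∈ H.Ru.support)
    (hb1' : b1 ≠ H.b)
    (hcl : ∀ y ∈ q1.support, y ∈ ((H.Lu.append H.M).append H.Ru).support → y = a1 ∨ y = b1)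
    (h3 : ∀ y ∈ q1.support, y ∉ E.q3.support) (hRl : ∀ y ∈ q1.support, y ∉ H.Rl.support)
    (hLl1 : ∀ y ∈ q1.support, y ∉ E.Ll1.support)
    (hLl : ∀ y ∈ q1.support, y ∈ H.Ll.support → y = H.a) :
    ∃ B : PBC G u v w x, B.IsBC := by
  obtain ⟨S1, hS1, h1, h2, h4, h5, -⟩ := E.exS1 ha1 hb1 hb1'
  have hJ := E.J_mem
  have hJ' := E.J'_mem
  have hJa := E.J_ne_a
  have hJb := E.J'_ne_b
  have hJ1 : E.J ∉ q1.support := by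
    intro h
    rcases hcl _ h (by simp [hJ]) with h | h
    · rcases ha1 with ha1 | ha1
      · rw [← h] at ha1
        exact hJa (H.LuM ha1 hJ)
      · rw [← h] at ha1
        exact E.J_nM0 ha1.1
    · rw [← h] at hb1
      exact E.hMz (H.MRu hJ hb1)
  have ha21 : E.a2 ∉ q1.support := fun h => hLl1 _ h (by simp)
  have hab : a1 ≠ b1 := by
    rintro rfl
    rcases ha1 with ha1 | ha1
    · exact hb1' (H.LuRu ha1 hb1).2
    · exact hb1' (H.MRu (E.M0_sub ha1.1) hb1)
  have hq2i : ∀ s ∈ E.q2.support, s ≠ E.a2 → s ≠ E.J →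
      s ∉ ((H.Lu.append H.M).append H.Ru).support ∧ s ∉ ((H.Ll.append H.M).append H.Rl).support := by
    intro s hs n1 n2
    have e1 := E.hq2u s hs
    have e2 := E.hq2l s hs
    tauto
  have hq3i : ∀ s ∈ E.q3.support, s ≠ E.J' → s ≠ E.b3 →
      s ∉ ((H.Lu.append H.M).append H.Ru).support ∧ s ∉ ((H.Ll.append H.M).append H.Rl).support := by
    intro s hs n1 n2
    have e1 := E.hq3u s hs
    have e2 := E.hq3l s hs
    tauto
  have hq1i : ∀ s ∈ q1.support, s ≠ a1 → s ≠ b1 →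
      s ∉ ((H.Lu.append H.M).append H.Ru).support ∧ s ∉ ((H.Ll.append H.M).append H.Rl).support := by
    intro s hs n1 n2
    have e1 : s ∉ ((H.Lu.append H.M).append H.Ru).support := fun h => (hcl s hs h).elim n1 n2
    refine ⟨e1, ?_⟩
    simp only [Walk.mem_support_append_iff] at e1 ⊢
    rintro ((h | h) | h)
    · have := hLl s hs h
      subst this
      exact e1 (by simp)
    · exact e1 (by simp [h])
    · exact hRl s hs h
  by_cases hm : ∃ r ∈ q1.support, r ∈ E.q2.support
  · obtain ⟨p, hp, hmid, hsub, hy, hz, hne⟩ := splice q1 E.q2 hq1 E.hq2 hm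
    have hcl' : ∀ y ∈ p.support, y ∈ ((H.Lu.append H.M).append H.Ru).support →
        y = a1 ∨ y = b1 := by
      intro y hy1 hy2
      rcases hsub y hy1 with h | h
      · exact hcl y h hy2
      · rcases E.hq2u y h hy2 with h | h
        · subst h; exact absurd (hy hy1) ha21
        · subst h; exact absurd (hz hy1) hJ1
    refine ⟨E.mk' p S1 hab hp hS1 hcl' h1 h2 h4 h5, Or.inr (Or.inl ⟨?_, ?_, ?_, hmid, ?_, hq2i, hq3i⟩)⟩
    · intro s hs hs'
      rcases hsub s hs' with h | h
      · exact h3 s h hs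
      · exact E.hq23 s h hs
    · exact fun s hs hs' => E.hq23 s hs' hs
    · obtain ⟨r, hr, hr'⟩ := hne
      exact fun h => h r hr hr'
    · intro s hs n1 n2
      rcases hsub s hs with h | h
      · exact hq1i s h n1 n2
      · refine hq2i s h ?_ ?_
        · rintro rfl; exact ha21 (hy hs)
        · rintro rfl; exact hJ1 (hz hs)
  · push Not at hm
    exact ⟨E.mk' q1 S1 hab hq1 hS1 hcl h1 h2 h4 h5, Or.inl ⟨hm, h3, E.hq23, hq1i, hq2i, hq3i⟩⟩

theorem Ears.top (E : H.Ears) {a1 b1 : V} (q1 : G.Walk a1 b1) (hq1 : q1.IsPath)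
    (ha1 : a1 ∈ H.Lu.support ∨ (a1 ∈ E.M0.support ∧ a1 ≠ E.J')) (hb1 : b1 ∈ H.Ru.support)
    (hb1' : b1 ≠ H.b)
    (hcl : ∀ y ∈ q1.support, y ∈ ((H.Lu.append H.M).append H.Ru).support → y = a1 ∨ y = b1)
    (h3 : ∀ y ∈ q1.support, y ∉ E.q3.support) (hRl : ∀ y ∈ q1.support, y ∉ H.Rl.support)
    (hLl1 : ∀ y ∈ q1.support, y ∉ E.Ll1.support) :
    ∃ B : PBC G u v w x, B.IsBC := by
  by_cases hLl : ∀ y ∈ q1.support, y ∈ H.Ll.support → y = H.a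
  · exact E.top_i q1 hq1 ha1 hb1 hb1' hcl h3 hRl hLl1 hLl
  push Not at hLl
  obtain ⟨y0, hy0, hy0', hy0a⟩ := hLl
  have hJ := E.J_mem
  have hJ' := E.J'_mem
  have hJa := E.J_ne_a
  have hJb := E.J'_ne_b
  have hLlb : H.b ∉ H.Ll.support := fun h => E.ab (H.LlM h (by simp)).symm
  obtain ⟨y, α, β, rfl, hyL, hβ⟩ := lastHit (fun r => r ∈ H.Ll.support) q1 ⟨y0, hy0, hy0'⟩
  rw [isPath_append_iff] at hq1
  obtain ⟨hα, hβp, hαβ⟩ := hq1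
  simp only [Walk.mem_support_append_iff] at hcl h3 hRl hLl1 hy0
  have hyn1 : y ∉ E.Ll1.support := hLl1 y (by simp)
  have ha1M : a1 ∈ H.Lu.support ∨ a1 ∈ H.M.support := ha1.imp id fun h => E.M0_sub h.1
  have hya : y ≠ H.a := by
    rintro rfl
    have : H.a = a1 := by
      rcases hcl H.a (by simp) (by simp) with h | h
      · exact h
      · rw [← h] at hb1
        exact absurd (H.MRu (by simp) hb1) E.ab
    subst this
    have hnil := Walk.isPath_iff_eq_nil.1 hα
    subst hnil
    have : y0 ∈ β.support := by
      rcases hy0 with h | h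
      · simp at h; subst h; simp
      · exact h
    exact hy0a (hβ y0 this hy0')
  have hy_a1 : y ≠ a1 := by
    rintro rfl
    rcases ha1M with h | h
    · exact hya (H.LuLl h hyL)
    · exact hya (H.LlM hyL h)
  have ha1β : a1 ∉ β.support := fun h => hy_a1 (hαβ a1 (by simp) h).symm
  have hL2 : y ∈ E.Ll2.support := by
    have := hyL
    rw [E.hLl, Walk.mem_support_append_iff] at this
    exact this.resolve_left hyn1
  obtain ⟨K1, K2, hK⟩ := splitAt E.Ll2 hL2
  have hLp : H.Ll.IsPath := H.swap.Lu_isPath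
  have hKLl : ∀ r ∈ K2.support, r ∈ H.Ll.support := by
    intro r hr
    rw [E.hLl, hK]; simp [hr]
  have ha2K : E.a2 ∉ K2.support := by
    intro h
    rw [E.hLl, hK, isPath_append_iff, isPath_append_iff] at hLp
    have := hLp.2.1.2.2 E.a2 (by simp) h
    exact hyn1 (by rw [← this]; simp)
  have hK2p : K2.IsPath := by
    rw [E.hLl, hK, isPath_append_iff, isPath_append_iff] at hLp
    exact hLp.2.1.2.1
  obtain ⟨S1, hS1, h1, h2, h4, h5, h6⟩ := E.exS1 (a1 := H.a) (Or.inl (by simp)) hb1 hb1'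
  have h6 := h6 rfl
  have hJβ : E.J ∉ β.support := by
    intro h
    rcases hcl _ (Or.inr h) (by simp [hJ]) with h | h
    · rcases ha1 with ha1 | ha1
      · rw [← h] at ha1
        exact hJa (H.LuM ha1 hJ)
      · rw [← h] at ha1
        exact E.J_nM0 ha1.1
    · rw [← h] at hb1
      exact E.hMz (H.MRu hJ hb1)
  have ha2β : E.a2 ∉ β.support := fun h => hLl1 _ (Or.inr h) (by simp)
  have hab : H.a ≠ b1 := by
    rintro rfl
    exact E.ab (H.MRu (by simp) hb1)
  have hq2L : ∀ r ∈ E.q2.support, r ∈ H.Ll.support → r = E.a2 := by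
    intro r hr hr'
    rcases E.hq2l r hr (by simp [hr']) with h | h
    · exact h
    · subst h; exact absurd (H.LlM hr' hJ) hJa
  have hq2P : ∀ r ∈ E.q2.support, r ∈ ((H.Lu.append H.M).append H.Ru).support → r = E.J := by
    intro r hr hr'
    rcases E.hq2u r hr hr' with h | h
    · subst h
      exact absurd (H.LlM E.a2_mem (H.hdisj _ hr' (by simp [E.a2_mem]))) E.ha2
    · exact h
  have key : ∀ β' : G.Walk y b1, β'.IsPath → 
      (∀ r ∈ β'.support, r ∈ β.support ∨ (r ∈ E.q2.support ∧ r ≠ E.a2 ∧ r ≠ E.J)) →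
      (PBC.NodeDisj β' E.q2 ∨ (¬ PBC.NodeDisj β' E.q2 ∧ PBC.CommonMid β' E.q2)) →
      ∃ B : PBC G u v w x, B.IsBC := by
    intro β' hβ'p hsub hcase
    have hβL : ∀ r ∈ β'.support, r ∈ H.Ll.support → r = y := by
      intro r hr hr'
      rcases hsub r hr with h | h
      · exact hβ r h hr'
      · exact absurd (hq2L r h.1 hr') h.2.1
    have hp : (K2.reverse.append β').IsPath := by
      rw [isPath_append_iff]
      refine ⟨hK2p.reverse, hβ'p, ?_⟩
      intro r hr hr'
      simp only [Walk.support_reverse, List.mem_reverse] at hr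
      exact hβL r hr' (hKLl r hr)
    have hcl' : ∀ r ∈ (K2.reverse.append β').support,
        r ∈ ((H.Lu.append H.M).append H.Ru).support → r = H.a ∨ r = b1 := by
      intro r hr hr'
      simp only [Walk.mem_support_append_iff, Walk.support_reverse, List.mem_reverse] at hr
      rcases hr with h | h
      · left
        exact H.LlM (hKLl r h) (H.hdisj r hr' (by simp [hKLl r h]))
      · rcases hsub r h with h | h
        · rcases hcl r (Or.inr h) (by simpa using hr') with h' | h'
          · subst h'; exact absurd h ha1β
          · exact Or.inr h'
        · exact absurd (hq2P r h.1 hr') h.2.2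
    have hK2q2 : ∀ r ∈ K2.support, r ∉ E.q2.support := by
      intro r hr hr'
      have := hq2L r hr' (hKLl r hr)
      subst this
      exact ha2K hr
    have hq13 : ∀ s ∈ (K2.reverse.append β').support, s ∉ E.q3.support := by
      intro s hs hs'
      simp only [Walk.mem_support_append_iff, Walk.support_reverse, List.mem_reverse] at hs
      rcases hs with h | h
      · rcases E.hq3l s hs' (by simp [hKLl s h]) with h' | h'
        · subst h'; exact E.hM0 (H.LlM (hKLl _ h) hJ').symm
        · subst h'; exact E.ab ((H.LlRl (hKLl _ h) E.b3_mem).1.symm.trans (H.LlRl (hKLl _ h) E.b3_mem).2)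
      · rcases hsub s h with h | h
        · exact h3 s (Or.inr h) hs'
        · exact E.hq23 s h.1 hs'
    have hav2 : ∀ s ∈ E.q2.support, s ∉ H.Lu.support ∧ s ∉ H.Ru.support := by
      intro s hs
      constructor
      · intro h
        have := hq2P s hs (by simp [h])
        subst this
        exact hJa (H.LuM h hJ)
      · intro h
        have := hq2P s hs (by simp [h])
        subst this
        exact E.hMz (H.MRu hJ h)
    have hav3 : ∀ s ∈ E.q3.support, s ∉ H.Lu.support ∧ s ∉ H.Ru.support := by
      intro s hs
      constructor
      · intro h
        rcases E.hq3u s hs (by simp [h]) with h' | h'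
        · subst h'; exact E.hM0 (H.LuM h hJ').symm
        · subst h'; exact E.ab ((H.LuRl h E.b3_mem).1.symm.trans (H.LuRl h E.b3_mem).2)
      · intro h
        rcases E.hq3u s hs (by simp [h]) with h' | h'
        · subst h'; exact hJb (H.MRu hJ' h)
        · subst h'; exact E.hb3 (H.RuRl h E.b3_mem)
    have htr : PBC.LlTraverse (E.mk' (K2.reverse.append β') S1 hab hp hS1 hcl' h1 h2 h4 h5) := by
      refine ⟨?_, ?_, y, K2.reverse, β', rfl, hyL, ?_, ?_⟩
      · show ∀ s ∈ (K2.reverse.append β').support, s ∉ H.Rl.support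
        intro s hs hs'
        simp only [Walk.mem_support_append_iff, Walk.support_reverse, List.mem_reverse] at hs
        rcases hs with h | h
        · exact E.ab ((H.LlRl (hKLl _ h) hs').1.symm.trans (H.LlRl (hKLl _ h) hs').2)
        · rcases hsub s h with h | h
          · exact hRl s (Or.inr h) hs'
          · exact (E.hq2l s h.1 (by simp [hs'])).elim h.2.1 h.2.2
      · show E.a2 ∉ (K2.reverse.append β').support
        simp only [Walk.mem_support_append_iff, Walk.support_reverse, List.mem_reverse]
        rintro (h | h)
        · exact ha2K h
        · rcases hsub _ h with h | h
          · exact ha2β h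
          · exact h.2.1 rfl
      · show ∀ e ∈ K2.reverse.edges, e ∈ (E.Ll2.append (E.M0.append E.My)).edges
        intro e he
        rw [hK]
        simp only [Walk.edges_reverse, List.mem_reverse] at he
        simp [he]
      · exact hβL
    rcases hcase with hd | ⟨hnd, hmid⟩
    · refine ⟨E.mk' (K2.reverse.append β') S1 hab hp hS1 hcl' h1 h2 h4 h5,
        Or.inr (Or.inr (Or.inl ⟨h6.2, h6.1, ?_, hq13, E.hq23, hav2, hav3, htr⟩))⟩
      show ∀ s ∈ (K2.reverse.append β').support, s ∉ E.q2.support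
      intro s hs
      simp only [Walk.mem_support_append_iff, Walk.support_reverse, List.mem_reverse] at hs
      rcases hs with h | h
      · exact hK2q2 s h
      · exact hd s h
    · refine ⟨E.mk' (K2.reverse.append β') S1 hab hp hS1 hcl' h1 h2 h4 h5,
        Or.inr (Or.inr (Or.inr ⟨h6.2, h6.1, fun s hs hs' => hq13 s hs' hs,
          fun s hs hs' => E.hq23 s hs' hs, ?_, ?_, hav2, hav3, htr⟩))⟩
      · intro hh
        apply hnd
        intro s hs
        exact hh s (by show s ∈ (K2.reverse.append β').support; simp [hs])
      · obtain ⟨c1, d1, m, hm1, hm2, hm3, hm4⟩ := hmid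
        refine ⟨c1, d1, m, hm1, ?_, hm3, ?_⟩
        · show m.darts <:+: (K2.reverse.append β').darts
          rw [Walk.darts_append]
          exact hm2.trans (List.suffix_append _ _).isInfix
        · show ∀ s, s ∈ (K2.reverse.append β').support → s ∈ E.q2.support → s ∈ m.support
          intro s hs hs'
          simp only [Walk.mem_support_append_iff, Walk.support_reverse, List.mem_reverse] at hs
          rcases hs with h | h
          · exact absurd hs' (hK2q2 s h)
          · exact hm4 s h hs'
  by_cases hm : ∃ r ∈ β.support, r ∈ E.q2.support
  · obtain ⟨p, hp, hmid, hsub, hy', hz, r, hr, hr'⟩ := splice β E.q2 hβp E.hq2 hm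
    refine key p hp ?_ (Or.inr ⟨fun h => h r hr hr', hmid⟩)
    intro r hr
    rcases hsub r hr with h | h
    · exact Or.inl h
    · refine Or.inr ⟨h, ?_, ?_⟩
      · rintro rfl; exact ha2β (hy' hr)
      · rintro rfl; exact hJβ (hz hr)
  · push Not at hm
    exact key β hβp (fun r hr => Or.inl hr) (Or.inl hm)

end HC
end NDG

namespace NDG
variable {V : Type*} [DecidableEq V]
set_option linter.unusedSectionVars false
open SimpleGraph

theorem wc_bypass_le {G : SimpleGraph V} {c : Sym2 V → ℝ} (hc : ∀ e, 0 ≤ c e) {a b : V}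
    (q : G.Walk a b) : wc c q.bypass ≤ wc c q := by
  rw [← sum_edges_eq_wc c _ q.bypass_isPath]
  refine (Finset.sum_le_sum_of_subset_of_nonneg (t := q.edges.toFinset) ?_ fun e _ _ => hc e).trans
    (sum_toFinset_le c hc _)
  intro e he
  simp only [List.mem_toFinset] at he ⊢
  exact q.edges_bypass_subset_edges he

theorem append_copy' {G : SimpleGraph V} {a b d d' : V} (p : G.Walk a b) (q : G.Walk b d)
    (h : d = d') : (p.append q).copy rfl h = p.append (q.copy rfl h) := by
  subst h; rfl

namespace HC
variable {G : SimpleGraph V} {c : Sym2 V → ℝ} {u v w x : V}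

/-- vertices of M -/
def mv (H : HC G c u v w x) (i : ℕ) : V := H.M.getVert i
/-- number of edges of M -/
def n (H : HC G c u v w x) : ℕ := H.M.length
/-- initial costs -/
def C (H : HC G c u v w x) (i : ℕ) : ℝ := wc c (H.M.take i)
/-- initial part of M -/
def m0 (H : HC G c u v w x) (i : ℕ) : G.Walk H.a (H.mv i) := H.M.take i
/-- suffix of M -/
def mn (H : HC G c u v w x) (i : ℕ) : G.Walk (H.mv i) H.b := H.M.drop i

theorem exmm (H : HC G c u v w x) (i j : ℕ) : ∃ m : G.Walk (H.mv i) (H.mv j), i ≤ j →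
    H.m0 j = (H.m0 i).append m := by
  by_cases h : i ≤ j
  · obtain ⟨k, rfl⟩ := Nat.exists_eq_add_of_le h
    exact ⟨((H.M.drop i).take k).copy rfl (by simp [mv, Walk.drop_getVert]),
      fun _ => (H.M.take_add_eq i k).trans (append_copy' _ _ _)⟩
  · exact ⟨(H.m0 i).reverse.append (H.m0 j), fun h' => absurd h' h⟩

/-- middle segment of M -/
noncomputable def mm (H : HC G c u v w x) (i j : ℕ) : G.Walk (H.mv i) (H.mv j) :=
  Classical.choose (H.exmm i j)

theorem mm_spec (H : HC G c u v w x) {i j : ℕ} (h : i ≤ j) : H.m0 j = (H.m0 i).append (H.mm i j) :=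
  Classical.choose_spec (H.exmm i j) h

theorem M_split (H : HC G c u v w x) (j : ℕ) : H.M = (H.m0 j).append (H.mn j) :=
  (H.M.append_take_drop_eq j).symm

@[simp] theorem wc_m0 (H : HC G c u v w x) (i : ℕ) : wc c (H.m0 i) = H.C i := rfl
@[simp] theorem wc_mn (H : HC G c u v w x) (i : ℕ) : wc c (H.mn i) = wc c H.M - H.C i := by
  have := congrArg (wc c) (H.M_split i)
  simp at this
  linarith
theorem wc_mm (H : HC G c u v w x) {i j : ℕ} (h : i ≤ j) : wc c (H.mm i j) = H.C j - H.C i := by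
  have := congrArg (wc c) (H.mm_spec h)
  simp at this
  linarith
theorem C_mono (H : HC G c u v w x) {i j : ℕ} (h : i ≤ j) : H.C i ≤ H.C j := by
  have := H.wc_mm h
  have := wc_nonneg H.hc (H.mm i j)
  linarith
@[simp] theorem mv_zero (H : HC G c u v w x) : H.mv 0 = H.a := by simp [mv]
@[simp] theorem mv_n (H : HC G c u v w x) : H.mv H.n = H.b := by simp [mv, n]
@[simp] theorem C_zero (H : HC G c u v w x) : H.C 0 = 0 := by simp [C, Walk.take_zero, wc]
theorem C_n (H : HC G c u v w x) : H.C H.n = wc c H.M := by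
  have := Walk.take_of_length_le (p := H.M) (n := H.n) le_rfl
  simp [C, this, wc]
theorem C_le (H : HC G c u v w x) (i : ℕ) : H.C i ≤ wc c H.M := by
  have := wc_nonneg H.hc (H.mn i)
  simp at this
  linarith
theorem mv_mem (H : HC G c u v w x) (i : ℕ) : H.mv i ∈ H.M.support := H.M.getVert_mem_support i
theorem exists_idx (H : HC G c u v w x) {y : V} (h : y ∈ H.M.support) :
    ∃ i, i ≤ H.n ∧ H.mv i = y := by
  obtain ⟨i, h1, h2⟩ := Walk.mem_support_iff_exists_getVert.1 h
  exact ⟨i, h2, h1⟩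
theorem mv_inj (H : HC G c u v w x) {i j : ℕ} (hi : i ≤ H.n) (hj : j ≤ H.n)
    (h : H.mv i = H.mv j) : i = j := H.M_isPath.getVert_injOn hi hj h
theorem rev_mv (H : HC G c u v w x) (i : ℕ) : H.rev.mv i = H.mv (H.n - i) := by
  simp [mv, rev, n, Walk.getVert_reverse]
theorem rev_n (H : HC G c u v w x) : H.rev.n = H.n := by simp [n, rev]
theorem swap_mv (H : HC G c u v w x) (i : ℕ) : H.swap.mv i = H.mv i := rfl

end HC

theorem ContainsBC.swap {G : SimpleGraph V} {u v w x : V} (h : ContainsBC G w x u v) :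
    ContainsBC G u v w x := by
  unfold ContainsBC at *
  tauto

theorem ContainsBC.rev {G : SimpleGraph V} {u v w x : V} (h : ContainsBC G v u x w) :
    ContainsBC G u v w x := by
  unfold ContainsBC at *
  tauto

end NDG

namespace NDG
variable {V : Type*} [DecidableEq V]
set_option linter.unusedSectionVars false
open SimpleGraph

theorem tot_cons {G : SimpleGraph V} (c : Sym2 V → ℝ) {a b : V} (p : G.Walk a b)
    (L : List (Piece G)) : tot c (pc p :: L) = wc c p + tot c L := by simp [tot, pc]
theorem tot_nil {G : SimpleGraph V} (c : Sym2 V → ℝ) : tot c ([] : List (Piece G)) = 0 := by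
  simp [tot]

namespace HC
variable {G : SimpleGraph V} {c : Sym2 V → ℝ} {u v w x : V}
variable {H : HC G c u v w x}

/-- reversal of ears -/
def Ears.rev (E : H.Ears) : H.rev.Ears where
  J' := E.J
  J := E.J'
  M0 := E.Mz.reverse
  My := E.My.reverse
  Mz := E.M0.reverse
  hM := by
    show H.M.reverse = _
    rw [E.hM]
    simp only [Walk.reverse_append, Walk.append_assoc]
    rfl
  hM0 := E.hMz.symm
  hMy := E.hMy.symm
  hMz := E.hM0.symm
  a2 := E.b3
  Ll1 := E.Rl2.reverse
  Ll2 := E.Rl1.reverse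
  hLl := by
    show H.Rl.reverse = _
    rw [E.hRl]
    simp only [Walk.reverse_append]
    rfl
  ha2 := E.hb3
  q2 := E.q3.reverse
  hq2 := E.hq3.reverse
  hq2u := by
    have := E.hq3u
    simp only [HC.rev, Walk.mem_support_append_iff, Walk.support_reverse, List.mem_reverse] at this ⊢
    grind
  hq2l := by
    have := E.hq3l
    simp only [HC.rev, Walk.mem_support_append_iff, Walk.support_reverse, List.mem_reverse] at this ⊢
    grind
  b3 := E.a2
  Rl1 := E.Ll2.reverse
  Rl2 := E.Ll1.reverse
  hRl := by
    show H.Ll.reverse = _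
    rw [E.hLl]
    simp only [Walk.reverse_append]
    rfl
  hb3 := E.ha2
  q3 := E.q2.reverse
  hq3 := E.hq2.reverse
  hq3u := by
    have := E.hq2u
    simp only [HC.rev, Walk.mem_support_append_iff, Walk.support_reverse, List.mem_reverse] at this ⊢
    grind
  hq3l := by
    have := E.hq2l
    simp only [HC.rev, Walk.mem_support_append_iff, Walk.support_reverse, List.mem_reverse] at this ⊢
    grind
  hq23 := by
    have := E.hq23
    simp only [Walk.support_reverse, List.mem_reverse]
    grind

/-- the ears plus Q1 are cheaper than optimal -/
def Ears.Cheap (E : H.Ears) (Q1 : G.Walk u v) : Prop :=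
  wc c Q1 + wc c E.Ll1 + wc c E.q2 + wc c E.q3 + wc c E.Rl2 <
    wc c H.Lu + wc c H.M + wc c H.Ru + wc c H.Ll + wc c H.Rl

theorem Ears.Cheap.rev {E : H.Ears} {Q1 : G.Walk u v} (h : E.Cheap Q1) : E.rev.Cheap Q1.reverse := by
  unfold Ears.Cheap at *
  simp only [Ears.rev, HC.rev, wc_reverse]
  linarith

theorem Ears.wM (E : H.Ears) : wc c H.M = wc c E.M0 + wc c E.My + wc c E.Mz := by
  rw [E.hM]; simp
theorem Ears.wLl (E : H.Ears) : wc c H.Ll = wc c E.Ll1 + wc c E.Ll2 := by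
  rw [E.hLl]; simp
theorem Ears.wRl (E : H.Ears) : wc c H.Rl = wc c E.Rl1 + wc c E.Rl2 := by
  rw [E.hRl]; simp

theorem Ears.c1 (E : H.Ears) {Q1 : G.Walk u v} (h : E.Cheap Q1) {z : V} (hz : z ∈ Q1.support)
    (hz' : z ∈ E.Ll1.support) : False := by
  obtain ⟨A, B, rfl⟩ := splitAt Q1 hz
  obtain ⟨L1, L2, hL⟩ := splitAt E.Ll1 hz'
  have e1 := H.exch [pc A, pc L1, pc L2, pc E.q2, pc E.Mz, pc H.Ru, pc H.Rl]
  have e2 := H.exch [pc B, pc E.q3, pc E.Rl2, pc L1, pc L2, pc E.Ll2, pc E.M0, pc H.Lu]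
  have h1 := congrArg (wc c) hL
  have h2 := wc_nonneg H.hc E.My
  simp only [Ears.Cheap, tot_cons, tot_nil, wc_append] at *
  linarith [E.wM, E.wLl, E.wRl]

theorem Ears.c2 (E : H.Ears) {Q1 : G.Walk u v} (h : E.Cheap Q1) {z : V} (hz : z ∈ Q1.support)
    (hz' : z ∈ E.My.support) : False := by
  obtain ⟨A, B, rfl⟩ := splitAt Q1 hz
  obtain ⟨L1, L2, hL⟩ := splitAt E.My hz'
  have e1 := H.exch [pc A, pc E.Ll1, pc E.q2, pc L2, pc E.Mz, pc H.Ru, pc H.Rl]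
  have e2 := H.exch [pc B, pc E.q3, pc E.Rl2, pc L1, pc E.M0, pc H.Ll, pc H.Lu]
  have h1 := congrArg (wc c) hL
  simp only [Ears.Cheap, tot_cons, tot_nil, wc_append] at *
  linarith [E.wM, E.wLl, E.wRl]

theorem Ears.left_walk (E : H.Ears) {y : V} (hy : y ∈ H.Ll.support ∨ y ∈ E.q2.support) :
    ∃ W : G.Walk w y, wc c W ≤ wc c E.Ll1 + wc c E.q2 := by
  rcases hy with hy | hy
  · obtain ⟨L1, L2, hL⟩ := splitAt H.Ll hy
    have e1 := H.exch [pc H.Lu, pc E.M0, pc E.My, pc E.Mz, pc H.Ru, pc E.Ll1, pc E.q2, pc H.Rl]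
    have h1 := congrArg (wc c) hL
    have h2 := wc_nonneg H.hc L2
    refine ⟨L1, ?_⟩
    simp only [tot_cons, tot_nil, wc_append] at *
    linarith [E.wM, E.wLl, E.wRl]
  · obtain ⟨L1, L2, hL⟩ := splitAt E.q2 hy
    have h1 := congrArg (wc c) hL
    have h2 := wc_nonneg H.hc L2
    refine ⟨E.Ll1.append L1, ?_⟩
    simp only [wc_append] at *
    linarith

theorem Ears.right_walk (E : H.Ears) {y : V} (hy : y ∈ H.Rl.support ∨ y ∈ E.q3.support) :
    ∃ W : G.Walk y x, wc c W ≤ wc c E.q3 + wc c E.Rl2 := by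
  obtain ⟨W, hW⟩ := E.rev.left_walk (y := y) (by
    simpa only [Ears.rev, HC.rev, Walk.support_reverse, List.mem_reverse] using hy)
  refine ⟨W.reverse, ?_⟩
  simp only [Ears.rev, wc_reverse] at *
  linarith

theorem Ears.c3a (E : H.Ears) {Q1 : G.Walk u v} (h : E.Cheap Q1) {y z : V} 
    (hy' : y ∈ H.Ll.support ∨ y ∈ E.q2.support) (hz' : z ∈ H.Rl.support ∨ z ∈ E.q3.support)
    (hy : y ∈ Q1.support) (hz : z ∈ Q1.support) : False := by
  obtain ⟨W, hW⟩ := E.left_walk hy'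
  obtain ⟨X, hX⟩ := E.right_walk hz'
  obtain ⟨A, B, rfl⟩ := splitAt Q1 hy
  simp only [Walk.mem_support_append_iff] at hz
  rcases hz with hz | hz
  · obtain ⟨A1, A2, rfl⟩ := splitAt A hz
    have e1 := H.exch [pc A1, pc A2, pc B, pc W, pc X]
    simp only [Ears.Cheap, tot_cons, tot_nil, wc_append] at *
    linarith
  · obtain ⟨A1, A2, rfl⟩ := splitAt B hz
    have e1 := H.exch [pc A1, pc A2, pc A, pc W, pc X]
    simp only [Ears.Cheap, tot_cons, tot_nil, wc_append] at *
    linarith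

theorem Ears.c3b (E : H.Ears) {Q1 : G.Walk u v} (h : E.Cheap Q1) {y z : V} 
    (hy' : y ∈ E.M0.support) (hz' : z ∈ H.Rl.support ∨ z ∈ E.q3.support)
    (hy : y ∈ Q1.support) (hz : z ∈ Q1.support) : False := by
  obtain ⟨m, m', hm⟩ := splitAt E.M0 hy'
  have h1 := congrArg (wc c) hm
  have := wc_nonneg H.hc m'
  have := wc_nonneg H.hc E.My
  have wM := E.wM
  obtain ⟨A, B, rfl⟩ := splitAt Q1 hy
  simp only [Walk.mem_support_append_iff] at hz
  rcases hz with hz | hz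
  · obtain ⟨A, B', rfl⟩ := splitAt A hz
    rcases hz' with hz' | hz'
    · obtain ⟨X, hX⟩ := E.right_walk (Or.inl hz')
      obtain ⟨R1, R2, hR⟩ := splitAt H.Rl hz'
      have h2 := congrArg (wc c) hR
      have e1 := H.exch [pc H.Lu, pc H.Ll, pc m, pc B', pc B, pc X]
      have e2 := H.exch [pc A, pc E.Ll1, pc E.q2, pc E.Mz, pc H.Ru, pc R1, pc R2]
      simp only [Ears.Cheap, tot_cons, tot_nil, wc_append] at *
      linarith
    · obtain ⟨R1, R2, hR⟩ := splitAt E.q3 hz'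
      have h2 := congrArg (wc c) hR
      have e1 := H.exch [pc H.Lu, pc H.Ll, pc m, pc B', pc B, pc R2, pc E.Rl2]
      have e2 := H.exch [pc A, pc R1, pc E.Ll1, pc E.q2, pc E.My, pc E.Mz, pc H.Ru, pc H.Rl]
      simp only [Ears.Cheap, tot_cons, tot_nil, wc_append] at *
      linarith
  · obtain ⟨X, hX⟩ := E.right_walk hz'
    obtain ⟨B, D, rfl⟩ := splitAt B hz
    have e1 := H.exch [pc H.Lu, pc H.Ll, pc m, pc B, pc D, pc X]
    have e2 := H.exch [pc A, pc E.Ll1, pc E.q2, pc m', pc E.My, pc E.Mz, pc H.Ru, pc H.Rl]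
    simp only [Ears.Cheap, tot_cons, tot_nil, wc_append] at *
    linarith

theorem Ears.c3c (E : H.Ears) {Q1 : G.Walk u v} (h : E.Cheap Q1) {y z : V} 
    (hy' : y ∈ H.Ll.support ∨ y ∈ E.q2.support) (hz' : z ∈ E.Mz.support)
    (hy : y ∈ Q1.support) (hz : z ∈ Q1.support) : False := by
  refine E.rev.c3b h.rev (y := z) (z := y) ?_ ?_ (by simpa using hz) (by simpa using hy) <;>
  simpa only [Ears.rev, HC.rev, Walk.support_reverse, List.mem_reverse]

theorem Ears.c3d (E : H.Ears) {Q1 : G.Walk u v} (h : E.Cheap Q1) {y z : V} 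
    (hy' : y ∈ E.M0.support) (hz' : z ∈ E.Mz.support)
    (hy : y ∈ Q1.support) (hz : z ∈ Q1.support) : False := by
  obtain ⟨m, m', hm⟩ := splitAt E.M0 hy'
  obtain ⟨k, k', hk⟩ := splitAt E.Mz hz'
  have h1 := congrArg (wc c) hm
  have h2 := congrArg (wc c) hk
  have := wc_nonneg H.hc E.My
  have := wc_nonneg H.hc m'
  have := wc_nonneg H.hc k
  have wM := E.wM
  obtain ⟨A, B, rfl⟩ := splitAt Q1 hy
  simp only [Walk.mem_support_append_iff] at hz
  rcases hz with hz | hz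
  · obtain ⟨A, B', rfl⟩ := splitAt A hz
    have := wc_nonneg H.hc B'
    have e1 := H.exch [pc A, pc E.Ll1, pc E.q2, pc k, pc k', pc H.Ru, pc H.Rl]
    have e2 := H.exch [pc B, pc E.q3, pc E.Rl2, pc m, pc m', pc H.Lu, pc H.Ll]
    simp only [Ears.Cheap, tot_cons, tot_nil, wc_append] at *
    linarith
  · obtain ⟨B, D, rfl⟩ := splitAt B hz
    have e1 := H.exch [pc A, pc E.Ll1, pc E.q2, pc m', pc E.My, pc k, pc k', pc H.Ru, pc H.Rl]
    have e2 := H.exch [pc D, pc E.q3, pc E.Rl2, pc m, pc m', pc E.My, pc k, pc H.Lu, pc H.Ll]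
    have e3 := H.exch [pc H.Lu, pc m, pc B, pc k', pc H.Ru, pc H.Rl, pc H.Ll]
    simp only [Ears.Cheap, tot_cons, tot_nil, wc_append] at *
    linarith

/-- right contact -/
def Ears.R (E : H.Ears) (z : V) : Prop :=
  z ∈ H.Rl.support ∨ z ∈ E.q3.support ∨ z ∈ E.Mz.support

theorem Ears.v3c (E : H.Ears) {Q1 : G.Walk u v} (h : E.Cheap Q1)
    (hR : ∀ z ∈ Q1.support, ¬ E.R z) : ∃ B : PBC G u v w x, B.IsBC := by
  have c1 := fun z => E.c1 h (z := z)
  have c2 := fun z => E.c2 h (z := z)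
  obtain ⟨a1, A, D, rfl, ha1, hD⟩ :=
    lastHit (fun y => y ∈ H.Lu.support ∨ y ∈ H.M.support) Q1 ⟨u, by simp, by simp⟩
  obtain ⟨b1, q, D2, rfl, hb1, hq⟩ := firstHit (fun y => y ∈ H.Ru.support) D ⟨v, by simp, by simp⟩
  simp only [Walk.mem_support_append_iff] at *
  have hsub : ∀ y ∈ q.bypass.support, y ∈ q.support := fun y hy => q.support_bypass_subset_support hy
  refine E.top q.bypass q.bypass_isPath ?_ hb1 ?_ ?_ ?_ ?_ ?_
  · rcases ha1 with h1 | h1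
    · exact Or.inl h1
    · right
      have h2 := h1
      rw [E.hM, Walk.mem_support_append_iff, Walk.mem_support_append_iff] at h2
      rcases h2 with (h2 | h2) | h2
      · refine ⟨h2, ?_⟩
        rintro rfl
        exact c2 E.J' (by simp) (by simp)
      · exact (c2 _ (by simp) h2).elim
      · exact absurd (Or.inr (Or.inr h2)) (hR a1 (by simp))
  · rintro rfl
    exact hR H.b (by simp) (Or.inl (by simp))
  · intro y hy hy'
    simp only [Walk.mem_support_append_iff] at hy'
    rcases hy' with h1 | h1
    · exact Or.inl (hD y (Or.inl (hsub y hy)) h1)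
    · exact Or.inr (hq y (hsub y hy) h1)
  · intro y hy hy'
    exact hR y (Or.inr (Or.inl (hsub y hy))) (Or.inr (Or.inl hy'))
  · intro y hy hy'
    exact hR y (Or.inr (Or.inl (hsub y hy))) (Or.inl hy')
  · intro y hy hy'
    exact c1 y (Or.inr (Or.inl (hsub y hy))) hy'

theorem Ears.v3 (E : H.Ears) {Q1 : G.Walk u v} (h : E.Cheap Q1) : ContainsBC G u v w x := by
  by_cases hR : ∀ z ∈ Q1.support, ¬ E.R z
  · exact Or.inl (E.v3c h hR)
  · push Not at hR
    obtain ⟨z, hz, hRz⟩ := hR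
    apply ContainsBC.rev
    refine Or.inl (E.rev.v3c h.rev ?_)
    intro y hy hRy
    simp only [Ears.R, Ears.rev, HC.rev, Walk.support_reverse, List.mem_reverse] at *
    rcases hRz with h1 | h1 | h1 <;> rcases hRy with h2 | h2 | h2
    · exact E.c3a h (Or.inl h2) (Or.inl h1) hy hz
    · exact E.c3a h (Or.inr h2) (Or.inl h1) hy hz
    · exact E.c3b h h2 (Or.inl h1) hy hz
    · exact E.c3a h (Or.inl h2) (Or.inr h1) hy hz
    · exact E.c3a h (Or.inr h2) (Or.inr h1) hy hz
    · exact E.c3b h h2 (Or.inr h1) hy hz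
    · exact E.c3c h (Or.inl h2) h1 hy hz
    · exact E.c3c h (Or.inr h2) h1 hy hz
    · exact E.c3d h h2 h1 hy hz

end HC
end NDG

namespace NDG
variable {V : Type*} [DecidableEq V]
set_option linter.unusedSectionVars false
open SimpleGraph

namespace HC
variable {G : SimpleGraph V} {c : Sym2 V → ℝ} {u v w x : V}

theorem normQ2 (H : HC G c u v w x) {J' J : V} {j' j : ℕ} (hJ' : H.mv j' = J') (hJ : H.mv j = J)
    (hj : j' < j) (Q1 : G.Walk u v) (Q2 : G.Walk w J) (Q3 : G.Walk J' x)
    (hlt : wc c Q1 + wc c Q2 + wc c Q3 <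
      wc c H.Lu + wc c H.M + wc c H.Ru + wc c H.Ll + wc c H.Rl) :
    ∃ (j2 : ℕ) (a2 : V) (Ll1 : G.Walk w a2) (Ll2 : G.Walk a2 H.a) (q2 : G.Walk a2 (H.mv j2)),
      j' < j2 ∧ j2 < H.n ∧ H.Ll = Ll1.append Ll2 ∧ a2 ≠ H.a ∧ q2.IsPath ∧
      (∀ y ∈ q2.support, y ∈ ((H.Lu.append H.M).append H.Ru).support → y = a2 ∨ y = H.mv j2) ∧
      (∀ y ∈ q2.support, y ∈ ((H.Ll.append H.M).append H.Rl).support → y = a2 ∨ y = H.mv j2) ∧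
      wc c Ll1 + wc c q2 ≤ wc c Q2 := by
  subst hJ' hJ
  have hQ3 : wc c H.Rl ≤ wc c Q3 := by
    have e := H.exch [pc H.Lu, pc H.Ll, pc (H.m0 j'), pc (H.mn j'), pc H.Ru, pc Q3]
    simp only [tot_cons, tot_nil, wc_m0, wc_mn] at e
    linarith
  obtain ⟨z, A, B, rfl, hz, hA⟩ := firstHit (fun y => y ∈ H.M.support) Q2 ⟨_, by simp, H.mv_mem j⟩
  obtain ⟨i, hin, rfl⟩ := H.exists_idx hz
  have hB := wc_nonneg H.hc B
  have hi : j' < i := by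
    by_contra hi
    push Not at hi
    have e1 := H.exch [pc Q1, pc A, pc (H.mm i j'), pc Q3]
    have e2 := H.exch [pc H.Lu, pc H.Ll, pc (H.m0 i), pc B, pc (H.mn j), pc H.Ru, pc H.Rl]
    have h1 := H.wc_mm hi
    have h2 := H.C_mono hj.le
    simp only [tot_cons, tot_nil, wc_m0, wc_mn, wc_append] at *
    linarith
  have hCij := H.C_mono hi.le
  have hmm := H.wc_mm hi.le
  have hARl : ∀ z ∈ A.support, z ∉ H.Rl.support := by
    intro z h1 h2
    obtain ⟨A1, A2, rfl⟩ := splitAt A h1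
    obtain ⟨R1, R2, hR⟩ := splitAt H.Rl h2
    have hR := congrArg (wc c) hR
    have := wc_nonneg H.hc A2
    have := wc_nonneg H.hc R1
    have e1 := H.exch [pc Q1, pc A1, pc R2]
    simp only [tot_cons, tot_nil, wc_m0, wc_mn, wc_append] at *
    linarith
  have hALu : ∀ z ∈ A.support, z ∉ H.Lu.support := by
    intro z h1 h2
    obtain ⟨A1, A2, rfl⟩ := splitAt A h1
    obtain ⟨R1, R2, hR⟩ := splitAt H.Lu h2
    have hR := congrArg (wc c) hR
    have := wc_nonneg H.hc R2
    have e1 := H.exch [pc R1, pc A1, pc A2, pc (H.mn i), pc H.Ru, pc H.Rl]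
    have e2 := H.exch [pc Q1, pc Q3, pc (H.m0 j'), pc H.Ll]
    simp only [tot_cons, tot_nil, wc_m0, wc_mn, wc_append] at *
    linarith [wc_nonneg H.hc H.Lu]
  have hARu : ∀ z ∈ A.support, z ∉ H.Ru.support := by
    intro z h1 h2
    obtain ⟨A1, A2, rfl⟩ := splitAt A h1
    obtain ⟨R1, R2, hR⟩ := splitAt H.Ru h2
    have hR := congrArg (wc c) hR
    have e1 := H.exch [pc Q1, pc A1, pc R1, pc H.Rl]
    have e2 := H.exch [pc H.Lu, pc H.Ll, pc (H.m0 j'), pc (H.mm j' i), pc A2, pc R2, pc Q3]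
    have := H.C_le i
    simp only [tot_cons, tot_nil, wc_m0, wc_mn, wc_append] at *
    linarith [wc_nonneg H.hc H.Lu]
  have hn : i < H.n := by
    by_contra hn
    have hn : i = H.n := by omega
    have hib : H.mv i = H.b := by rw [hn]; simp
    exact hARl (H.mv i) (by simp) (by rw [hib]; simp)
  obtain ⟨a2, A1, q, rfl, ha2, hq⟩ := lastHit (fun y => y ∈ H.Ll.support) A ⟨w, by simp, by simp⟩
  obtain ⟨L1, L2, hL⟩ := splitAt H.Ll ha2
  have hsub : ∀ y ∈ q.bypass.support, y ∈ q.support := fun y hy => q.support_bypass_subset_support hy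
  simp only [Walk.mem_support_append_iff] at *
  refine ⟨i, a2, L1, L2, q.bypass, hi, hn, hL, ?_, q.bypass_isPath, ?_, ?_, ?_⟩
  · rintro rfl
    have h1 := hA H.a (by simp) (by simp)
    rw [← H.mv_zero] at h1
    have := H.mv_inj (by omega) hin h1
    omega
  · intro y hy hy'
    have hy := hsub y hy
    rcases hy' with (h | h) | h
    · exact absurd h (hALu y (Or.inr hy))
    · exact Or.inr (hA y (Or.inr hy) h)
    · exact absurd h (hARu y (Or.inr hy))
  · intro y hy hy'
    have hy := hsub y hy
    rcases hy' with (h | h) | h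
    · exact Or.inl (hq y hy h)
    · exact Or.inr (hA y (Or.inr hy) h)
    · exact absurd h (hARl y (Or.inr hy))
  · have e1 := H.exch [pc A1, pc L2, pc H.Lu, pc H.M, pc H.Ru, pc H.Rl]
    have h1 := congrArg (wc c) hL
    have h2 := wc_bypass_le H.hc q
    simp only [tot_cons, tot_nil, wc_append] at *
    linarith

theorem v3 (H : HC G c u v w x) {J' J : V} {j' j : ℕ} (hJ' : H.mv j' = J') (hJ : H.mv j = J)
    (hj : j' < j) (hjn : j ≤ H.n) (Q1 : G.Walk u v) (Q2 : G.Walk w J) (Q3 : G.Walk J' x)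
    (hlt : wc c Q1 + wc c Q2 + wc c Q3 <
      wc c H.Lu + wc c H.M + wc c H.Ru + wc c H.Ll + wc c H.Rl) : ContainsBC G u v w x := by
  obtain ⟨j2, a2, Ll1, Ll2, q2, h1, h2, hLl, ha2, hq2, hq2u, hq2l, hw⟩ :=
    H.normQ2 hJ' hJ hj Q1 Q2 Q3 hlt
  obtain ⟨j3, b3, Rl2, Rl1, q3, h1', h2', hRl, hb3, hq3, hq3u, hq3l, hw'⟩ :=
    H.rev.normQ2 (J' := H.mv j2) (J := J') (j' := H.n - j2) (j := H.n - j')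
      (by rw [rev_mv, Nat.sub_sub_self h2.le]) (by rw [rev_mv, Nat.sub_sub_self (by omega), hJ'])
      (by omega) Q1.reverse Q3.reverse (Ll1.append q2).reverse (by
        simp only [wc_reverse, wc_append, rev]; linarith)
  rw [rev_n] at h2'
  have hJ3 : H.rev.mv j3 = H.mv (H.n - j3) := H.rev_mv j3
  have hlt3 : H.n - j3 < j2 := by omega
  have hRl' : H.Rl = Rl1.reverse.append Rl2.reverse := by
    have := congrArg Walk.reverse hRl
    rw [Walk.reverse_append] at this
    rw [← this]
    show H.Rl = H.Rl.reverse.reverse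
    simp
  have hcost : wc c Q1 + wc c Ll1 + wc c q2 + wc c q3 + wc c Rl2 <
      wc c H.Lu + wc c H.M + wc c H.Ru + wc c H.Ll + wc c H.Rl := by
    simp only [wc_reverse] at hw'
    linarith
  have hdis : ∀ y ∈ q2.support, y ∉ q3.support := by
    intro y hy hy'
    obtain ⟨A, B, rfl⟩ := splitAt q2 hy
    obtain ⟨A', B', rfl⟩ := splitAt q3 hy'
    have e := H.exch [pc Q1, pc Ll1, pc A, pc A', pc Rl2]
    have := wc_nonneg H.hc B
    have := wc_nonneg H.hc B'
    simp only [tot_cons, tot_nil, wc_append] at *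
    linarith
  have hb3' : b3 ≠ H.b := hb3
  have hq3u' : ∀ y ∈ q3.support, y ∈ ((H.Lu.append H.M).append H.Ru).support →
      y = H.mv (H.n - j3) ∨ y = b3 := by
    rw [← hJ3]
    simp only [HC.rev, Walk.mem_support_append_iff, Walk.support_reverse, List.mem_reverse] at hq3u ⊢
    grind
  have hq3l' : ∀ y ∈ q3.support, y ∈ ((H.Ll.append H.M).append H.Rl).support →
      y = H.mv (H.n - j3) ∨ y = b3 := by
    rw [← hJ3]
    simp only [HC.rev, Walk.mem_support_append_iff, Walk.support_reverse, List.mem_reverse] at hq3l ⊢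
    grind
  let q3' : G.Walk b3 (H.mv (H.n - j3)) := q3.copy rfl hJ3
  have hq3s : ∀ y, y ∈ q3'.support ↔ y ∈ q3.support := by intro y; simp [q3']
  have hq3w : wc c q3' = wc c q3 := by simp [q3', wc]
  have hq3p : q3'.IsPath := by simpa [q3'] using hq3
  let E : H.Ears :=
    { J' := H.mv (H.n - j3), J := H.mv j2
      M0 := H.m0 _, My := H.mm _ _, Mz := H.mn _
      hM := by rw [← H.mm_spec hlt3.le, ← H.M_split]
      hM0 := by
        rw [← H.mv_zero]; intro h
        have := H.mv_inj (by omega) (by omega) h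
        omega
      hMy := by
        intro h
        have := H.mv_inj (by omega) (by omega) h
        omega
      hMz := by
        rw [← H.mv_n]; intro h
        have := H.mv_inj (by omega) (by omega) h
        omega
      a2 := a2, Ll1 := Ll1, Ll2 := Ll2, hLl := hLl, ha2 := ha2, q2 := q2, hq2 := hq2
      hq2u := hq2u, hq2l := hq2l
      b3 := b3, Rl1 := Rl1.reverse, Rl2 := Rl2.reverse, hRl := hRl', hb3 := hb3'
      q3 := q3'.reverse
      hq3 := hq3p.reverse
      hq3u := by simpa [hq3s] using hq3u'
      hq3l := by simpa [hq3s] using hq3l'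
      hq23 := by simpa [hq3s] using hdis }
  refine E.v3 (Q1 := Q1) ?_
  simp only [Ears.Cheap, E, wc_reverse, hq3w]
  exact hcost

end HC
end NDG

namespace NDG
variable {V : Type*} [DecidableEq V]
set_option linter.unusedSectionVars false
open SimpleGraph

namespace HC
variable {G : SimpleGraph V} {c : Sym2 V → ℝ} {u v w x : V}

theorem norm2 (H : HC G c u v w x) {J' J : V} {j' j : ℕ} (hJ' : H.mv j' = J') (hJ : H.mv j = J)
    (hj : j' < j) (P2 : G.Walk w J) (P3 : G.Walk J' x) (S : ℝ)
    (hR : ∀ R : G.Walk w x, wc c H.Lu + wc c H.M + wc c H.Ru + wc c H.Ll + wc c H.Rl ≤ wc c R + S)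
    (hlt : wc c P2 + wc c P3 + S < wc c H.Lu + wc c H.M + wc c H.Ru + wc c H.Ll + wc c H.Rl) :
    ∃ (i : ℕ) (A : G.Walk w (H.mv i)), j' < i ∧ i ≤ H.n ∧
      (∀ y ∈ A.support, y ∈ H.M.support → y = H.mv i) ∧ wc c A ≤ wc c P2 := by
  subst hJ' hJ
  obtain ⟨z, A, B, rfl, hz, hA⟩ := firstHit (fun y => y ∈ H.M.support) P2 ⟨_, by simp, H.mv_mem j⟩
  obtain ⟨i, hin, rfl⟩ := H.exists_idx hz
  have hB := wc_nonneg H.hc B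
  refine ⟨i, A, ?_, hin, hA, by simp only [wc_append]; linarith⟩
  by_contra hi
  push Not at hi
  have e1 := hR ((A.append (H.mm i j')).append P3)
  have e2 := H.exch [pc H.Lu, pc H.Ll, pc (H.m0 i), pc B, pc (H.mn j), pc H.Ru, pc H.Rl]
  have h1 := H.wc_mm hi
  have h2 := H.C_mono hj.le
  simp only [tot_cons, tot_nil, wc_m0, wc_mn, wc_append] at *
  linarith

/-- normalised data of a four-walk violation -/
structure Four (H : HC G c u v w x) where
  (j' j k k' : ℕ)
  (J' J K K' : V)
  hJ' : H.mv j' = J'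
  hJ : H.mv j = J
  hK : H.mv k = K
  hK' : H.mv k' = K'
  h1 : j' < j
  h2 : j < k
  h3 : k < k'
  h4 : k' ≤ H.n
  P2 : G.Walk w J
  P3 : G.Walk J' x
  P1 : G.Walk K v
  Q : G.Walk u K'
  hP2 : ∀ y ∈ P2.support, y ∈ H.M.support → y = J
  hP3 : ∀ y ∈ P3.support, y ∈ H.M.support → y = J'
  hP1 : ∀ y ∈ P1.support, y ∈ H.M.support → y = K
  hQ : ∀ y ∈ Q.support, y ∈ H.M.support → y = K'
  hlt : wc c P2 + wc c P3 + wc c P1 + wc c Q <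
    wc c H.Lu + wc c H.M + wc c H.Ru + wc c H.Ll + wc c H.Rl
  hno : ¬ ContainsBC G u v w x

namespace Four
variable {H : HC G c u v w x}

/-- swap players and reverse -/
def sr (F : H.Four) : H.swap.rev.Four where
  j' := H.n - F.k'
  j := H.n - F.k
  k := H.n - F.j
  k' := H.n - F.j'
  J' := F.K'
  J := F.K
  K := F.J
  K' := F.J'
  hJ' := by
    have := F.hK'; have := F.h4
    rw [rev_mv, swap_mv]; show H.mv (H.n - _) = _; rw [Nat.sub_sub_self (by omega)]; assumption
  hJ := by
    have := F.hK; have := F.h4; have := F.h3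
    rw [rev_mv, swap_mv]; show H.mv (H.n - _) = _; rw [Nat.sub_sub_self (by omega)]; assumption
  hK := by
    have := F.hJ; have := F.h4; have := F.h3; have := F.h2
    rw [rev_mv, swap_mv]; show H.mv (H.n - _) = _; rw [Nat.sub_sub_self (by omega)]; assumption
  hK' := by
    have := F.hJ'; have := F.h4; have := F.h3; have := F.h2; have := F.h1
    rw [rev_mv, swap_mv]; show H.mv (H.n - _) = _; rw [Nat.sub_sub_self (by omega)]; assumption
  h1 := by have := F.h4; have := F.h3; have := F.h2; have := F.h1; omega
  h2 := by have := F.h4; have := F.h3; have := F.h2; have := F.h1; omega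
  h3 := by have := F.h4; have := F.h3; have := F.h2; have := F.h1; omega
  h4 := by rw [rev_n]; show _ ≤ H.n; omega
  P2 := F.P1.reverse
  P3 := F.Q.reverse
  P1 := F.P2.reverse
  Q := F.P3.reverse
  hP2 := by simpa [HC.rev, HC.swap] using F.hP1
  hP3 := by simpa [HC.rev, HC.swap] using F.hQ
  hP1 := by simpa [HC.rev, HC.swap] using F.hP2
  hQ := by simpa [HC.rev, HC.swap] using F.hP3
  hlt := by
    have := F.hlt
    simp only [HC.rev, HC.swap, wc_reverse]
    linarith
  hno := fun h => F.hno (h.rev.swap)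

theorem nv (F : H.Four) {i' i : ℕ} {I' I : V} (hI' : H.mv i' = I') (hI : H.mv i = I)
    (h : i' < i) (hi : i ≤ H.n) (Q1 : G.Walk u v) (Q2 : G.Walk w I) (Q3 : G.Walk I' x) :
    wc c H.Lu + wc c H.M + wc c H.Ru + wc c H.Ll + wc c H.Rl ≤ wc c Q1 + wc c Q2 + wc c Q3 := by
  by_contra h'
  exact F.hno (H.v3 hI' hI h hi Q1 Q2 Q3 (by linarith))

theorem nvs (F : H.Four) {i' i : ℕ} {I' I : V} (hI' : H.mv i' = I') (hI : H.mv i = I)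
    (h : i' < i) (hi : i ≤ H.n) (Q1 : G.Walk w x) (Q2 : G.Walk u I) (Q3 : G.Walk I' v) :
    wc c H.Lu + wc c H.M + wc c H.Ru + wc c H.Ll + wc c H.Rl ≤ wc c Q1 + wc c Q2 + wc c Q3 := by
  by_contra h'
  refine F.hno (H.swap.v3 hI' hI h hi Q1 Q2 Q3 ?_).swap
  simp only [swap]
  linarith

/-- pieces of M -/
theorem pieces (F : H.Four) : ∃ (m0 : G.Walk H.a F.J') (m1 : G.Walk F.J' F.J) (m2 : G.Walk F.J F.K)
    (m3 : G.Walk F.K F.K') (m4 : G.Walk F.K' H.b),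
    H.M = m0.append (m1.append (m2.append (m3.append m4))) ∧
    wc c H.M = wc c m0 + wc c m1 + wc c m2 + wc c m3 + wc c m4 := by
  obtain ⟨j', j, k, k', J', J, K, K', rfl, rfl, rfl, rfl, h1, h2, h3, h4, -⟩ := F
  have key : H.M = (H.m0 j').append ((H.mm j' j).append ((H.mm j k).append ((H.mm k k').append (H.mn k')))) := by
    rw [H.M_split k', H.mm_spec h3.le, H.mm_spec h2.le, H.mm_spec h1.le]
    simp only [Walk.append_assoc]
  refine ⟨H.m0 j', H.mm j' j, H.mm j k, H.mm k k', H.mn k', key, ?_⟩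
  conv_lhs => rw [key]
  simp only [wc_append]; ring

end Four
end HC
end NDG

namespace NDG
variable {V : Type*} [DecidableEq V]
set_option linter.unusedSectionVars false
open SimpleGraph

namespace HC
namespace Four
variable {G : SimpleGraph V} {c : Sym2 V → ℝ} {u v w x : V}
variable {H : HC G c u v w x}

theorem bounds (F : H.Four) : wc c H.Rl ≤ wc c F.P3 ∧ wc c H.Ru ≤ wc c F.P1 ∧
    wc c H.Ll ≤ wc c F.P2 ∧ wc c H.Lu ≤ wc c F.Q := by
  obtain ⟨m0, m1, m2, m3, m4, hM, wM⟩ := F.pieces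
  have e1 := H.exch [pc H.Lu, pc H.Ll, pc m0, pc m1, pc m2, pc m3, pc m4, pc H.Ru, pc F.P3]
  have e2 := H.exch [pc H.Lu, pc H.Ll, pc m0, pc m1, pc m2, pc m3, pc m4, pc F.P1, pc H.Rl]
  have e3 := H.exch [pc H.Lu, pc F.P2, pc m0, pc m1, pc m2, pc m3, pc m4, pc H.Ru, pc H.Rl]
  have e4 := H.exch [pc F.Q, pc H.Ll, pc m0, pc m1, pc m2, pc m3, pc m4, pc H.Ru, pc H.Rl]
  simp only [tot_cons, tot_nil] at *
  refine ⟨?_, ?_, ?_, ?_⟩ <;> linarith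

theorem P2Rl (F : H.Four) {z : V} (hz : z ∈ F.P2.support) (hz' : z ∈ H.Rl.support) : False := by
  obtain ⟨A, B, h⟩ := splitAt F.P2 hz
  obtain ⟨A', B', h'⟩ := splitAt H.Rl hz'
  have h := congrArg (wc c) h; have h' := congrArg (wc c) h'
  have e := F.nvs F.hK F.hK' F.h3 F.h4 (A.append B') F.Q F.P1
  obtain ⟨b1, b2, b3, b4⟩ := F.bounds
  have := F.hlt
  have := wc_nonneg H.hc B; have := wc_nonneg H.hc A'
  simp only [wc_append] at *
  linarith

theorem P2Ru (F : H.Four) {z : V} (hz : z ∈ F.P2.support) (hz' : z ∈ H.Ru.support) : False := by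
  obtain ⟨A, B, h⟩ := splitAt F.P2 hz
  obtain ⟨A', B', h'⟩ := splitAt H.Ru hz'
  have h := congrArg (wc c) h; have h' := congrArg (wc c) h'
  obtain ⟨m0, m1, m2, m3, m4, hM, wM⟩ := F.pieces
  have e1 := H.exch [pc F.Q, pc A, pc m4, pc A', pc B', pc H.Rl]
  have e2 := H.exch [pc H.Lu, pc H.Ll, pc m0, pc m1, pc B, pc B', pc F.P3]
  obtain ⟨b1, b2, b3, b4⟩ := F.bounds
  have := F.hlt
  have := wc_nonneg H.hc A'; have := wc_nonneg H.hc m2; have := wc_nonneg H.hc m3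
  simp only [tot_cons, tot_nil, wc_append] at *
  linarith

theorem P3Ll (F : H.Four) {z : V} (hz : z ∈ F.P3.support) (hz' : z ∈ H.Ll.support) : False := by
  obtain ⟨A, B, h⟩ := splitAt F.P3 hz
  obtain ⟨A', B', h'⟩ := splitAt H.Ll hz'
  have h := congrArg (wc c) h; have h' := congrArg (wc c) h'
  have e := F.nvs F.hK F.hK' F.h3 F.h4 (A'.append B) F.Q F.P1
  obtain ⟨b1, b2, b3, b4⟩ := F.bounds
  have := F.hlt
  have := wc_nonneg H.hc A; have := wc_nonneg H.hc B'
  simp only [wc_append] at *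
  linarith

theorem E12 (F : H.Four) : ∃ (m2 : G.Walk F.J F.K)
    (m3 : G.Walk F.K F.K') (m4 : G.Walk F.K' H.b), 
  wc c H.Lu + wc c H.Ll + (wc c H.M - wc c m2 - wc c m3 - wc c m4) ≤ wc c F.Q + wc c F.P2 := by
  obtain ⟨m0, m1, m2, m3, m4, hM, wM⟩ := F.pieces
  refine ⟨m2, m3, m4, ?_⟩
  have e2 := H.exch [pc F.Q, pc F.P2, pc m2, pc m3, pc m4, pc H.Ru, pc H.Rl]
  simp only [tot_cons, tot_nil, wc_append] at *
  linarith

theorem P3Ru (F : H.Four) {z : V} (hz : z ∈ F.P3.support) (hz' : z ∈ H.Ru.support) : False := by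
  obtain ⟨A, B, h⟩ := splitAt F.P3 hz
  obtain ⟨A', B', h'⟩ := splitAt H.Ru hz'
  have h := congrArg (wc c) h; have h' := congrArg (wc c) h'
  obtain ⟨m0, m1, m2, m3, m4, hM, wM⟩ := F.pieces
  have e1 := H.exch [pc H.Lu, pc H.Ll, pc m0, pc A, pc B, pc B']
  have e2 := H.exch [pc F.Q, pc F.P2, pc m2, pc m3, pc m4, pc H.Ru, pc H.Rl]
  obtain ⟨b1, b2, b3, b4⟩ := F.bounds
  have := F.hlt
  have := wc_nonneg H.hc A'; have := wc_nonneg H.hc m1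
  simp only [tot_cons, tot_nil, wc_append] at *
  linarith

theorem excl1 (F : H.Four) {z y : V} (hz : z ∈ F.P2.support) (hz' : z ∈ H.Lu.support)
    (hy : y ∈ F.P1.support) (hy' : y ∈ H.Rl.support) : False := by
  obtain ⟨A, B, h⟩ := splitAt F.P2 hz
  obtain ⟨A', B', h'⟩ := splitAt H.Lu hz'
  obtain ⟨D, E, h2⟩ := splitAt F.P1 hy
  obtain ⟨D', E', h2'⟩ := splitAt H.Rl hy'
  have h := congrArg (wc c) h; have h' := congrArg (wc c) h'
  have h2 := congrArg (wc c) h2; have h2' := congrArg (wc c) h2'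
  obtain ⟨m0, m1, m2, m3, m4, hM, wM⟩ := F.pieces
  have e1 := H.exch [pc m2, pc A', pc E', pc D, pc E, pc A, pc B]
  have e2 := H.exch [pc m0, pc m4, pc H.Ll, pc H.Ru, pc F.Q, pc F.P3]
  have := F.hlt
  have := wc_nonneg H.hc D'; have := wc_nonneg H.hc B'; have := wc_nonneg H.hc m1; have := wc_nonneg H.hc m3
  simp only [tot_cons, tot_nil, wc_append] at *
  linarith

theorem excl2 (F : H.Four) {z y : V} (hz : z ∈ F.P2.support) (hz' : z ∈ H.Lu.support)
    (hy : y ∈ F.Q.support) (hy' : y ∈ H.Rl.support) : False := by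
  obtain ⟨A, B, h⟩ := splitAt F.P2 hz
  obtain ⟨A', B', h'⟩ := splitAt H.Lu hz'
  obtain ⟨D, E, h2⟩ := splitAt F.Q hy
  obtain ⟨D', E', h2'⟩ := splitAt H.Rl hy'
  have h := congrArg (wc c) h; have h' := congrArg (wc c) h'
  have h2 := congrArg (wc c) h2; have h2' := congrArg (wc c) h2'
  obtain ⟨m0, m1, m2, m3, m4, hM, wM⟩ := F.pieces
  have e1 := H.exch [pc m2, pc m3, pc A', pc E', pc E, pc F.P1, pc A, pc B]
  have e2 := H.exch [pc m0, pc H.Ll, pc H.Ru, pc D', pc D, pc F.P3]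
  have := F.hlt
  have := wc_nonneg H.hc B'; have := wc_nonneg H.hc m1; have := wc_nonneg H.hc m4
  simp only [tot_cons, tot_nil, wc_append] at *
  linarith

theorem excl3 (F : H.Four) {z y : V} (hz : z ∈ F.P3.support) (hz' : z ∈ H.Lu.support)
    (hy : y ∈ F.P1.support) (hy' : y ∈ H.Rl.support) : False := by
  obtain ⟨A, B, h⟩ := splitAt F.P3 hz
  obtain ⟨A', B', h'⟩ := splitAt H.Lu hz'
  obtain ⟨D, E, h2⟩ := splitAt F.P1 hy
  obtain ⟨D', E', h2'⟩ := splitAt H.Rl hy'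
  have h := congrArg (wc c) h; have h' := congrArg (wc c) h'
  have h2 := congrArg (wc c) h2; have h2' := congrArg (wc c) h2'
  obtain ⟨m0, m1, m2, m3, m4, hM, wM⟩ := F.pieces
  have e1 := H.exch [pc m4, pc B', pc H.Ll, pc H.Ru, pc F.Q, pc B]
  have e2 := H.exch [pc m1, pc m2, pc A', pc E', pc D, pc E, pc F.P2, pc A]
  have := F.hlt
  have := wc_nonneg H.hc D'; have := wc_nonneg H.hc m0; have := wc_nonneg H.hc m3
  simp only [tot_cons, tot_nil, wc_append] at *
  linarith

theorem excl4 (F : H.Four) {z y : V} (hz : z ∈ F.P3.support) (hz' : z ∈ H.Lu.support)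
    (hy : y ∈ F.Q.support) (hy' : y ∈ H.Rl.support) : False := by
  obtain ⟨A, B, h⟩ := splitAt F.P3 hz
  obtain ⟨A', B', h'⟩ := splitAt H.Lu hz'
  obtain ⟨D, E, h2⟩ := splitAt F.Q hy
  obtain ⟨D', E', h2'⟩ := splitAt H.Rl hy'
  have h := congrArg (wc c) h; have h' := congrArg (wc c) h'
  have h2 := congrArg (wc c) h2; have h2' := congrArg (wc c) h2'
  obtain ⟨m0, m1, m2, m3, m4, hM, wM⟩ := F.pieces
  have e1 := H.exch [pc B', pc H.Ll, pc H.Ru, pc D', pc D, pc B]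
  have e2 := H.exch [pc m1, pc m2, pc m3, pc A', pc E', pc E, pc F.P1, pc F.P2, pc A]
  have := F.hlt
  have := wc_nonneg H.hc m0; have := wc_nonneg H.hc m4
  simp only [tot_cons, tot_nil, wc_append] at *
  linarith

theorem P23 (F : H.Four) {z : V} (hz : z ∈ F.P2.support) (hz' : z ∈ F.P3.support) : False := by
  obtain ⟨A, B, h⟩ := splitAt F.P2 hz
  obtain ⟨A', B', h'⟩ := splitAt F.P3 hz'
  have h := congrArg (wc c) h; have h' := congrArg (wc c) h'
  have e := F.nvs F.hK F.hK' F.h3 F.h4 (A.append B') F.Q F.P1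
  have := F.hlt
  have := wc_nonneg H.hc B; have := wc_nonneg H.hc A'
  simp only [wc_append] at *
  linarith

theorem QP2 (F : H.Four) {z : V} (hz : z ∈ F.Q.support) (hz' : z ∈ F.P2.support ∨ z ∈ H.Ll.support) :
    False := by
  obtain ⟨A, B, h⟩ := splitAt F.Q hz
  obtain ⟨m0, m1, m2, m3, m4, hM, wM⟩ := F.pieces
  have h := congrArg (wc c) h
  have e2 := H.exch [pc H.Lu, pc H.Ll, pc m0, pc m1, pc m2, pc F.P1, pc F.P3]
  have := F.hlt
  obtain ⟨b1, b2, b3, b4⟩ := F.bounds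
  have := wc_nonneg H.hc m3
  have key : ∃ D : G.Walk w z, wc c D ≤ wc c F.P2 := by
    rcases hz' with hz' | hz'
    · obtain ⟨A', B', h'⟩ := splitAt F.P2 hz'
      have h' := congrArg (wc c) h'
      have := wc_nonneg H.hc B'
      exact ⟨A', by simp only [wc_append] at h'; linarith⟩
    · obtain ⟨A', B', h'⟩ := splitAt H.Ll hz'
      have h' := congrArg (wc c) h'
      have := wc_nonneg H.hc B'
      exact ⟨A', by simp only [wc_append] at h'; linarith⟩
  obtain ⟨D, hD⟩ := key
  have e1 := H.exch [pc A, pc B, pc D, pc m4, pc H.Ru, pc H.Rl]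
  simp only [tot_cons, tot_nil, wc_append] at *
  linarith

theorem QRlP3 (F : H.Four) {z : V} (hz : z ∈ F.Q.support) (hz' : z ∈ F.P3.support)
    (hz2 : z ∈ H.Rl.support) : False := by
  obtain ⟨A, B, h⟩ := splitAt F.Q hz
  obtain ⟨A', B', h'⟩ := splitAt H.Rl hz2
  obtain ⟨D, E, h2⟩ := splitAt F.P3 hz'
  have h := congrArg (wc c) h; have h' := congrArg (wc c) h'; have h2 := congrArg (wc c) h2
  obtain ⟨m0, m1, m2, m3, m4, hM, wM⟩ := F.pieces
  have e1 := H.exch [pc m0, pc H.Lu, pc H.Ll, pc H.Ru, pc A', pc D, pc E]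
  have e2 := H.exch [pc m2, pc m3, pc B', pc A, pc B, pc F.P1, pc F.P2]
  have := F.hlt
  have := wc_nonneg H.hc m1; have := wc_nonneg H.hc m4
  simp only [tot_cons, tot_nil, wc_append] at *
  linarith

theorem QRu (F : H.Four) {z : V} (hz : z ∈ F.Q.support) (hz' : z ∈ H.Ru.support) : False := by
  obtain ⟨A, B, h⟩ := splitAt F.Q hz
  obtain ⟨A', B', h'⟩ := splitAt H.Ru hz'
  have h := congrArg (wc c) h; have h' := congrArg (wc c) h'
  have e := F.nv F.hJ' F.hJ F.h1 (by have := F.h2; have := F.h3; have := F.h4; omega) (A.append B') F.P2 F.P3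
  obtain ⟨b1, b2, b3, b4⟩ := F.bounds
  have := F.hlt
  have := wc_nonneg H.hc B; have := wc_nonneg H.hc A'
  simp only [wc_append] at *
  linarith

theorem j'pos (F : H.Four) : F.J' ≠ H.a := by
  intro h
  obtain ⟨P, hP⟩ : ∃ P : G.Walk H.a x, wc c P = wc c F.P3 := ⟨F.P3.copy h rfl, by simp [wc]⟩
  have e := F.nvs F.hK F.hK' F.h3 F.h4 (H.Ll.append P) F.Q F.P1
  obtain ⟨b1, b2, b3, b4⟩ := F.bounds
  have := F.hlt
  simp only [wc_append] at *
  linarith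

end Four
end HC
end NDG

namespace NDG
variable {V : Type*} [DecidableEq V]
set_option linter.unusedSectionVars false
open SimpleGraph

namespace HC
namespace Four
variable {G : SimpleGraph V} {c : Sym2 V → ℝ} {u v w x : V}
variable {H : HC G c u v w x}

theorem neMv (F : H.Four) : F.J ≠ H.a ∧ F.K' ≠ H.a ∧ F.J' ≠ H.b ∧ F.J ≠ H.b ∧ F.J' ≠ F.J ∧
    F.J ≠ F.K' := by
  obtain ⟨j', j, k, k', J', J, K, K', rfl, rfl, rfl, rfl, h1, h2, h3, h4, -⟩ := F
  dsimp only
  rw [← H.mv_zero, ← H.mv_n]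
  refine ⟨?_, ?_, ?_, ?_, ?_, ?_⟩ <;> intro h <;> have := H.mv_inj (by omega) (by omega) h <;> omega

theorem final (F : H.Four) (hA2 : ∀ z ∈ F.P2.support, z ∉ H.Lu.support)
    (hA3 : ∀ z ∈ F.P3.support, z ∉ H.Lu.support) : False := by
  obtain ⟨n1, n2, n3, n4, n5, n6⟩ := F.neMv
  obtain ⟨m0, m1, m2, m3, m4, hM, wM⟩ := F.pieces
  have hKM : F.K' ∈ H.M.support := by rw [← F.hK']; exact H.mv_mem _
  obtain ⟨a2, X2, q2, hP2, ha2, hq2⟩ := lastHit (fun y => y ∈ H.Ll.support) F.P2 ⟨w, by simp, by simp⟩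
  obtain ⟨b3, q3, X3, hP3, hb3, hq3⟩ := firstHit (fun y => y ∈ H.Rl.support) F.P3 ⟨x, by simp, by simp⟩
  obtain ⟨b1, Y, q1, hQ, hb1, hq1⟩ := lastHit (fun y => y ∈ H.Lu.support) F.Q ⟨u, by simp, by simp⟩
  obtain ⟨Ll1, Ll2, hLl⟩ := splitAt H.Ll ha2
  obtain ⟨Rl1, Rl2, hRl⟩ := splitAt H.Rl hb3
  have s2 : ∀ y ∈ q2.bypass.support, y ∈ q2.support := fun y hy => q2.support_bypass_subset_support hy
  have s3 : ∀ y ∈ q3.bypass.support, y ∈ q3.support := fun y hy => q3.support_bypass_subset_support hy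
  have s1 : ∀ y ∈ q1.bypass.support, y ∈ q1.support := fun y hy => q1.support_bypass_subset_support hy
  have t2 : ∀ y ∈ q2.support, y ∈ F.P2.support := fun y hy => by rw [hP2]; simp [hy]
  have t3 : ∀ y ∈ q3.support, y ∈ F.P3.support := fun y hy => by rw [hP3]; simp [hy]
  have t1 : ∀ y ∈ q1.support, y ∈ F.Q.support := fun y hy => by rw [hQ]; simp [hy]
  have hcost : wc c q3 + wc c Rl2 ≤ wc c F.P3 := by
    have e := H.exch [pc H.Lu, pc H.Ll, pc H.M, pc H.Ru, pc Rl1, pc X3]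
    have h1 := congrArg (wc c) hP3
    have h2 := congrArg (wc c) hRl
    simp only [tot_cons, tot_nil, wc_append] at *
    linarith
  have hQRl : ∀ z ∈ q1.support, z ∉ Rl2.support := by
    intro z hz hz'
    obtain ⟨A, B, h⟩ := splitAt F.Q (t1 z hz)
    obtain ⟨D, E, h2⟩ := splitAt Rl2 hz'
    have e1 := H.exch [pc m0, pc H.Lu, pc H.Ll, pc H.Ru, pc Rl1, pc q3, pc D, pc E]
    have e2 := H.exch [pc m2, pc m3, pc E, pc A, pc B, pc F.P1, pc F.P2]
    have := F.hlt
    have := wc_nonneg H.hc m1; have := wc_nonneg H.hc m4; have := wc_nonneg H.hc D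
    have h := congrArg (wc c) h; have h2 := congrArg (wc c) h2
    have h3 := congrArg (wc c) hRl
    simp only [tot_cons, tot_nil, wc_append] at *
    linarith
  let E : H.Ears :=
    { J' := F.J', J := F.J
      M0 := m0, My := m1, Mz := m2.append (m3.append m4)
      hM := by rw [hM]; simp only [Walk.append_assoc]
      hM0 := by first | exact F.j'pos.symm | exact F.j'pos
      hMy := by first | exact n5 | exact n5.symm
      hMz := by first | exact n4 | exact n4.symm
      a2 := a2, Ll1 := Ll1, Ll2 := Ll2, hLl := hLl
      ha2 := by
        rintro rfl
        exact n1 (F.hP2 H.a (t2 _ (by simp)) (by simp)).symm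
      q2 := q2.bypass, hq2 := q2.bypass_isPath
      hq2u := by
        intro y hy hy'
        have h1 := t2 y (s2 y hy)
        simp only [Walk.mem_support_append_iff] at hy'
        rcases hy' with (h | h) | h
        · exact absurd h (hA2 y h1)
        · exact Or.inr (F.hP2 y h1 h)
        · exact (F.P2Ru h1 h).elim
      hq2l := by
        intro y hy hy'
        have h1 := t2 y (s2 y hy)
        simp only [Walk.mem_support_append_iff] at hy'
        rcases hy' with (h | h) | h
        · exact Or.inl (hq2 y (s2 y hy) h)
        · exact Or.inr (F.hP2 y h1 h)
        · exact (F.P2Rl h1 h).elim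
      b3 := b3, Rl1 := Rl1, Rl2 := Rl2, hRl := hRl
      hb3 := by
        rintro rfl
        exact n3 (F.hP3 H.b (t3 _ (by simp)) (by simp)).symm
      q3 := q3.bypass, hq3 := q3.bypass_isPath
      hq3u := by
        intro y hy hy'
        have h1 := t3 y (s3 y hy)
        simp only [Walk.mem_support_append_iff] at hy'
        rcases hy' with (h | h) | h
        · exact absurd h (hA3 y h1)
        · exact Or.inl (F.hP3 y h1 h)
        · exact (F.P3Ru h1 h).elim
      hq3l := by
        intro y hy hy'
        have h1 := t3 y (s3 y hy)
        simp only [Walk.mem_support_append_iff] at hy'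
        rcases hy' with (h | h) | h
        · exact (F.P3Ll h1 h).elim
        · exact Or.inl (F.hP3 y h1 h)
        · exact Or.inr (hq3 y (s3 y hy) h)
      hq23 := by
        intro y hy hy'
        exact F.P23 (t2 y (s2 y hy)) (t3 y (s3 y hy')) }
  have htop := E.rev.top q1.bypass.reverse q1.bypass_isPath.reverse
    (Or.inr ⟨by
      show F.K' ∈ (m2.append (m3.append m4)).reverse.support
      simp, n6.symm⟩) (b1 := b1) (by simpa [HC.rev] using hb1)
    (by
      rintro rfl
      exact n2 (F.hQ H.a (t1 _ q1.start_mem_support) (by simp)).symm)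
    (by
      intro y hy hy'
      have hy : y ∈ q1.bypass.support := by simpa using hy
      have h1 := t1 y (s1 y hy)
      simp only [Walk.mem_support_append_iff, HC.rev, Walk.support_reverse, List.mem_reverse] at hy'
      rcases hy' with (h | h) | h
      · exact (F.QRu h1 h).elim
      · exact Or.inl (F.hQ y h1 h)
      · exact Or.inr (hq1 y (s1 y hy) h))
    (by
      intro y hy hy'
      have hy : y ∈ q1.bypass.support := by simpa using hy
      have hy' : y ∈ q2.bypass.support := by simpa [Ears.rev, E] using hy'
      exact F.QP2 (t1 y (s1 y hy)) (Or.inl (t2 y (s2 y hy'))))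
    (by
      intro y hy hy'
      have hy : y ∈ q1.bypass.support := by simpa using hy
      have hy' : y ∈ H.Ll.support := by simpa [HC.rev] using hy'
      exact F.QP2 (t1 y (s1 y hy)) (Or.inr hy'))
    (by
      intro y hy hy'
      have hy : y ∈ q1.bypass.support := by simpa using hy
      have hy' : y ∈ Rl2.support := by simpa [Ears.rev, E] using hy'
      exact hQRl y (s1 y hy) hy')
  exact F.hno (ContainsBC.rev (Or.inl htop))

theorem false (F : H.Four) : False := by
  by_cases h : ∃ z, (z ∈ F.P2.support ∨ z ∈ F.P3.support) ∧ z ∈ H.Lu.support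
  · obtain ⟨z, hz, hz'⟩ := h
    refine F.sr.final ?_ ?_
    · intro y hy hy'
      have hy : y ∈ F.P1.support := by simpa [sr] using hy
      have hy' : y ∈ H.Rl.support := by simpa [HC.rev, HC.swap] using hy'
      rcases hz with hz | hz
      · exact F.excl1 hz hz' hy hy'
      · exact F.excl3 hz hz' hy hy'
    · intro y hy hy'
      have hy : y ∈ F.Q.support := by simpa [sr] using hy
      have hy' : y ∈ H.Rl.support := by simpa [HC.rev, HC.swap] using hy'
      rcases hz with hz | hz
      · exact F.excl2 hz hz' hy hy'
      · exact F.excl4 hz hz' hy hy'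
  · push Not at h
    exact F.final (fun z hz => h z (Or.inl hz)) (fun z hz => h z (Or.inr hz))

end Four

variable {G : SimpleGraph V} {c : Sym2 V → ℝ} {u v w x : V}

theorem swapLu (H : HC G c u v w x) : wc c H.swap.Lu = wc c H.Ll := rfl
theorem swapLl (H : HC G c u v w x) : wc c H.swap.Ll = wc c H.Lu := rfl
theorem swapM (H : HC G c u v w x) : wc c H.swap.M = wc c H.M := rfl
theorem swapRu (H : HC G c u v w x) : wc c H.swap.Ru = wc c H.Rl := rfl
theorem swapRl (H : HC G c u v w x) : wc c H.swap.Rl = wc c H.Ru := rfl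
theorem revLu (H : HC G c u v w x) : wc c H.rev.Lu = wc c H.Ru := wc_reverse _ _
theorem revLl (H : HC G c u v w x) : wc c H.rev.Ll = wc c H.Rl := wc_reverse _ _
theorem revM (H : HC G c u v w x) : wc c H.rev.M = wc c H.M := wc_reverse _ _
theorem revRu (H : HC G c u v w x) : wc c H.rev.Ru = wc c H.Lu := wc_reverse _ _
theorem revRl (H : HC G c u v w x) : wc c H.rev.Rl = wc c H.Ll := wc_reverse _ _

theorem norm3 (H : HC G c u v w x) {J' J : V} {j' j : ℕ} (hJ' : H.mv j' = J') (hJ : H.mv j = J)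
    (hj : j' < j) (hjn : j ≤ H.n) (P2 : G.Walk w J) (P3 : G.Walk J' x) (S : ℝ)
    (hR : ∀ R : G.Walk w x, wc c H.Lu + wc c H.M + wc c H.Ru + wc c H.Ll + wc c H.Rl ≤ wc c R + S)
    (hlt : wc c P2 + wc c P3 + S < wc c H.Lu + wc c H.M + wc c H.Ru + wc c H.Ll + wc c H.Rl) :
    ∃ (i : ℕ) (A : G.Walk (H.mv i) x), i < j ∧
      (∀ y ∈ A.support, y ∈ H.M.support → y = H.mv i) ∧ wc c A ≤ wc c P3 := by
  obtain ⟨i3, A3, hi3, hin3, hA3, hAc3⟩ := H.rev.norm2 (J' := J) (J := J') (j' := H.n - j) (j := H.n - j')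
    (by rw [rev_mv, Nat.sub_sub_self (by omega), hJ]) (by rw [rev_mv, Nat.sub_sub_self (by omega), hJ']) (by omega)
    P3.reverse P2.reverse S
    (fun R => by
      have := hR R.reverse
      simp only [wc_reverse, revLu, revLl, revM, revRu, revRl] at this ⊢
      linarith) (by simp only [wc_reverse, revLu, revLl, revM, revRu, revRl]; linarith)
  rw [rev_n] at hin3
  have h3 : H.rev.mv i3 = H.mv (H.n - i3) := H.rev_mv i3
  refine ⟨H.n - i3, (A3.copy rfl h3).reverse, by omega, ?_, ?_⟩
  · intro y hy hy'
    rw [← h3]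
    exact hA3 y (by simpa using hy) (by simpa [rev] using hy')
  · simpa [wc] using hAc3

/-- both normalisations -/
theorem norm23 (H : HC G c u v w x) {J' J : V} {j' j : ℕ} (hJ' : H.mv j' = J') (hJ : H.mv j = J)
    (hj : j' < j) (P2 : G.Walk w J) (P3 : G.Walk J' x) (S : ℝ)
    (hR : ∀ R : G.Walk w x, wc c H.Lu + wc c H.M + wc c H.Ru + wc c H.Ll + wc c H.Rl ≤ wc c R + S)
    (hlt : wc c P2 + wc c P3 + S < wc c H.Lu + wc c H.M + wc c H.Ru + wc c H.Ll + wc c H.Rl) :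
    ∃ (i i' : ℕ) (A : G.Walk w (H.mv i)) (B : G.Walk (H.mv i') x), i' < i ∧ i ≤ H.n ∧
      (∀ y ∈ A.support, y ∈ H.M.support → y = H.mv i) ∧
      (∀ y ∈ B.support, y ∈ H.M.support → y = H.mv i') ∧ wc c A + wc c B ≤ wc c P2 + wc c P3 := by
  obtain ⟨i, A, hi, hin, hA, hAc⟩ := H.norm2 hJ' hJ hj P2 P3 S hR hlt
  obtain ⟨i', B, hi', hB, hBc⟩ := H.norm3 hJ' rfl hi hin A P3 S hR (by linarith)
  exact ⟨i, i', A, B, hi', hin, hA, hB, by linarith⟩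

/-- V4 with normalised walks up to the first coordinate of each -/
theorem v4 (H : HC G c u v w x) {j' j k k' : ℕ} (hj : j' < j) (hjn : j ≤ H.n) (hk : k < k')
    (hkn : k' ≤ H.n) (P2 : G.Walk w (H.mv j)) (P3 : G.Walk (H.mv j') x) (Q : G.Walk u (H.mv k'))
    (P1 : G.Walk (H.mv k) v)
    (hlt : wc c P2 + wc c P3 + wc c P1 + wc c Q <
      wc c H.Lu + wc c H.M + wc c H.Ru + wc c H.Ll + wc c H.Rl) : ContainsBC G u v w x := by
  by_contra hno
  have nv : ∀ {i' i : ℕ}, i' < i → i ≤ H.n → ∀ (Q1 : G.Walk u v) (Q2 : G.Walk w (H.mv i))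
      (Q3 : G.Walk (H.mv i') x), 
      wc c H.Lu + wc c H.M + wc c H.Ru + wc c H.Ll + wc c H.Rl ≤ wc c Q1 + wc c Q2 + wc c Q3 := by
    intro i' i h hi Q1 Q2 Q3
    by_contra h'
    exact hno (H.v3 rfl rfl h hi Q1 Q2 Q3 (by linarith))
  have nvs : ∀ {i' i : ℕ}, i' < i → i ≤ H.n → ∀ (Q1 : G.Walk w x) (Q2 : G.Walk u (H.mv i))
      (Q3 : G.Walk (H.mv i') v), 
      wc c H.Lu + wc c H.M + wc c H.Ru + wc c H.Ll + wc c H.Rl ≤ wc c Q1 + wc c Q2 + wc c Q3 := by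
    intro i' i h hi Q1 Q2 Q3
    by_contra h'
    refine hno (H.swap.v3 (J' := H.mv i') (J := H.mv i) rfl rfl h hi Q1 Q2 Q3 ?_).swap
    simp only [wc_reverse, revLu, revLl, revM, revRu, revRl, swapLu, swapLl, swapM, swapRu, swapRl]
    linarith
  obtain ⟨i, j', A, A3, hi', hin, hA, hA3, hAc⟩ := H.norm23 rfl rfl hj P2 P3 (wc c P1 + wc c Q)
    (fun R => by linarith [nvs hk hkn R Q P1]) (by linarith)
  obtain ⟨l, k, B, B3, hl', hln, hB, hB3, hBc⟩ : ∃ (i i' : ℕ) (A : G.Walk u (H.mv i))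
      (B : G.Walk (H.mv i') v), i' < i ∧ i ≤ H.n ∧
      (∀ y ∈ A.support, y ∈ H.M.support → y = H.mv i) ∧
      (∀ y ∈ B.support, y ∈ H.M.support → y = H.mv i') ∧ wc c A + wc c B ≤ wc c Q + wc c P1 :=
    H.swap.norm23 (J' := H.mv k) (J := H.mv k') rfl rfl hk Q P1 (wc c P2 + wc c P3)
    (fun R => by
      have := nv hj hjn R P2 P3
      simp only [swapLu, swapLl, swapM, swapRu, swapRl] at this ⊢
      linarith) (by simp only [swapLu, swapLl, swapM, swapRu, swapRl]; linarith)
  have hord : i < k ∨ l < j' := by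
    by_contra hcon
    push Not at hcon
    have e1 : wc c H.Lu + wc c H.Ll + min (H.C i) (H.C l) ≤ wc c B + wc c A := by
      rcases le_total i l with h | h
      · have e1 := H.exch [pc B, pc A, pc (H.mm i l), pc (H.mn l), pc H.Ru, pc H.Rl]
        have h1 := H.wc_mm h
        have := min_le_left (H.C i) (H.C l)
        simp only [tot_cons, tot_nil, wc_mn] at e1
        linarith
      · have e1 := H.exch [pc B, pc A, pc (H.mm l i), pc (H.mn i), pc H.Ru, pc H.Rl]
        have h1 := H.wc_mm h
        have := min_le_right (H.C i) (H.C l)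
        simp only [tot_cons, tot_nil, wc_mn] at e1
        linarith
    have e2 : wc c H.Ru + wc c H.Rl + wc c H.M - max (H.C j') (H.C k) ≤ wc c A3 + wc c B3 := by
      rcases le_total j' k with h | h
      · have e1 := H.exch [pc H.Lu, pc H.Ll, pc (H.m0 j'), pc (H.mm j' k), pc A3, pc B3]
        have h1 := H.wc_mm h
        have := le_max_right (H.C j') (H.C k)
        simp only [tot_cons, tot_nil, wc_m0] at e1
        linarith
      · have e1 := H.exch [pc H.Lu, pc H.Ll, pc (H.m0 k), pc (H.mm k j'), pc A3, pc B3]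
        have h1 := H.wc_mm h
        have := le_max_left (H.C j') (H.C k)
        simp only [tot_cons, tot_nil, wc_m0] at e1
        linarith
    have e3 : max (H.C j') (H.C k) ≤ min (H.C i) (H.C l) := by
      refine max_le (le_min ?_ ?_) (le_min ?_ ?_) <;> apply H.C_mono <;> omega
    linarith
  rcases hord with h | h
  · exact Four.false (H := H)
      { j' := _, j := _, k := _, k' := _, J' := _, J := _, K := _, K' := _
        hJ' := rfl, hJ := rfl, hK := rfl, hK' := rfl
        h1 := hi', h2 := h, h3 := hl', h4 := hln, P2 := A, P3 := A3, P1 := B3, Q := B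
        hP2 := hA, hP3 := hA3, hP1 := hB3, hQ := hB
        hlt := by linarith
        hno := hno }
  · exact Four.false (H := H.swap)
      { j' := _, j := _, k := _, k' := _, J' := _, J := _, K := _, K' := _
        hJ' := rfl, hJ := rfl, hK := rfl, hK' := rfl
        h1 := hl', h2 := h, h3 := hi', h4 := hin, P2 := B, P3 := B3, P1 := A3, Q := A
        hP2 := hB, hP3 := hB3, hP1 := hA3, hQ := hA
        hlt := by
          show wc c B + wc c B3 + wc c A3 + wc c A < _
          simp only [swapLu, swapLl, swapM, swapRu, swapRl]; linarith
        hno := fun h => hno h.swap }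

end HC
end NDG

namespace NDG
variable {V : Type*} [DecidableEq V]
set_option linter.unusedSectionVars false
open SimpleGraph

theorem lp (n : ℕ) (C α β α' β' : ℕ → ℝ) (δ δ' : ℝ) (hC0 : C 0 = 0)
    (hC : ∀ i j, i ≤ j → j ≤ n → C i ≤ C j)
    (hα : α 0 ≤ 0) (hα' : α' 0 ≤ 0) (hβ : β n ≤ 0) (hβ' : β' n ≤ 0)
    (H1 : ∀ i ≤ n, ∀ k ≤ n, min (C i) (C k) ≤ α i + α' k)
    (H2 : ∀ i ≤ n, ∀ k ≤ n, C n - max (C i) (C k) ≤ β k + β' i)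
    (H3 : C n ≤ δ + δ')
    (H3a : ∀ i ≤ n, ∀ j ≤ n, C n ≤ α i + β j + max (C j - C i) 0 + δ')
    (H3b : ∀ i ≤ n, ∀ j ≤ n, C n ≤ α' i + β' j + max (C j - C i) 0 + δ)
    (H3c : ∀ i ≤ n, ∀ j ≤ n, ∀ k ≤ n, ∀ l ≤ n,
      C n ≤ α i + β j + max (C j - C i) 0 + (α' k + β' l + max (C l - C k) 0)) :
    ∃ π : ℕ → ℝ, π 0 = 0 ∧ (∀ i j, i ≤ j → j ≤ n → π i ≤ π j ∧ π j - π i ≤ C j - C i) ∧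
      (∀ j ≤ n, π j ≤ α j ∧ π n - π j ≤ β j ∧ C j - π j ≤ α' j ∧
        (C n - π n) - (C j - π j) ≤ β' j) ∧ π n ≤ δ ∧ C n - π n ≤ δ' := by
  obtain ⟨τ, hτ1, hτ2, hτ3, hτ4⟩ : ∃ τ : ℝ, τ ≤ δ ∧ C n - δ' ≤ τ ∧
      (∀ i ≤ n, ∀ j ≤ n, τ ≤ α i + β j + max (C j - C i) 0) ∧
      (∀ i ≤ n, ∀ j ≤ n, C n - (α' i + β' j + max (C j - C i) 0) ≤ τ) := by
    have hne : ((Finset.range (n+1)) ×ˢ (Finset.range (n+1))).Nonempty := ⟨(0, 0), by simp⟩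
    have hm : ∀ p : ℕ × ℕ, p ∈ ((Finset.range (n+1)) ×ˢ (Finset.range (n+1))) ↔ p.1 ≤ n ∧ p.2 ≤ n := by
      intro p; simp [Nat.lt_succ_iff]
    refine ⟨min δ (((Finset.range (n+1)) ×ˢ (Finset.range (n+1))).inf' hne
      (fun p => α p.1 + β p.2 + max (C p.2 - C p.1) 0)), min_le_left _ _, ?_, ?_, ?_⟩
    · refine le_min (by linarith) ?_
      rw [Finset.le_inf'_iff]
      intro p hp
      rw [hm] at hp
      linarith [H3a _ hp.1 _ hp.2]
    · intro i hi j hj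
      exact (min_le_right _ _).trans (Finset.inf'_le (fun p : ℕ × ℕ => α p.1 + β p.2 + max (C p.2 - C p.1) 0) ((hm (i, j)).2 ⟨hi, hj⟩))
    · intro i hi j hj
      refine le_min (by linarith [H3b i hi j hj]) ?_
      rw [Finset.le_inf'_iff]
      intro p hp
      rw [hm] at hp
      linarith [H3c _ hp.1 _ hp.2 i hi j hj]
  let s : ℕ → ℝ := fun i => min (α i) (τ - C n + C i + β' i)
  have hne : (Finset.range (n+1)).Nonempty := ⟨0, by simp⟩
  let π : ℕ → ℝ := fun j => (Finset.range (n+1)).inf' hne (fun i => s i + max (C j - C i) 0)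
  have hle : ∀ j, ∀ i ≤ n, π j ≤ s i + max (C j - C i) 0 := by
    intro j i hi
    exact Finset.inf'_le (fun i => s i + max (C j - C i) 0) (by simpa [Nat.lt_succ_iff] using hi)
  have hge : ∀ j t, (∀ i ≤ n, t ≤ s i + max (C j - C i) 0) → t ≤ π j := by
    intro j t h
    refine (Finset.le_inf'_iff _ _).2 fun i hi => h i (by simpa [Nat.lt_succ_iff] using hi)
  have hs : ∀ j ≤ n, π j ≤ s j := fun j hj => by simpa using hle j j hj
  have hs1 : ∀ j ≤ n, π j ≤ α j := fun j hj => (hs j hj).trans (min_le_left _ _)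
  have hs2 : ∀ j ≤ n, π j ≤ τ - C n + C j + β' j := fun j hj => (hs j hj).trans (min_le_right _ _)
  have ht1 : ∀ j ≤ n, τ - β j ≤ π j := by
    intro j hj
    apply hge
    intro i hi
    rw [← sub_le_iff_le_add]
    refine le_min ?_ ?_
    · linarith [hτ3 i hi j hj]
    · have := H2 i hi j hj
      have h2 : max (C i) (C j) ≤ C i + max (C j - C i) 0 := by
        apply max_le <;> linarith [le_max_left (C j - C i) 0, le_max_right (C j - C i) 0]
      linarith
  have ht2 : ∀ j ≤ n, C j - α' j ≤ π j := by
    intro j hj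
    apply hge
    intro i hi
    rw [← sub_le_iff_le_add]
    refine le_min ?_ ?_
    · have := H1 i hi j hj
      have h2 : C j - max (C j - C i) 0 ≤ min (C i) (C j) := by
        apply le_min <;> linarith [le_max_left (C j - C i) 0, le_max_right (C j - C i) 0]
      linarith
    · have := hτ4 j hj i hi
      have h2 : max (C i - C j) 0 ≤ C i - C j + max (C j - C i) 0 := by
        apply max_le <;> linarith [le_max_left (C j - C i) 0, le_max_right (C j - C i) 0]
      linarith
  have hn : π n = τ := le_antisymm (by linarith [hs2 n le_rfl]) (by linarith [ht1 n le_rfl])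
  refine ⟨π, ?_, ?_, ?_, ?_, ?_⟩
  · exact le_antisymm (by linarith [hs1 0 (Nat.zero_le n)]) (by linarith [ht2 0 (Nat.zero_le n)])
  · intro i j hij hj
    have hc := hC i j hij hj
    constructor
    · apply hge
      intro k hk
      have : max (C i - C k) 0 ≤ max (C j - C k) 0 := max_le_max (by linarith) le_rfl
      linarith [hle i k hk]
    · suffices π j - (C j - C i) ≤ π i by linarith
      apply hge
      intro k hk
      have : max (C j - C k) 0 ≤ max (C i - C k) 0 + (C j - C i) := by
        apply max_le <;> linarith [le_max_left (C i - C k) 0, le_max_right (C i - C k) 0]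
      linarith [hle j k hk]
  · intro j hj
    refine ⟨hs1 j hj, ?_, ?_, ?_⟩
    · linarith [ht1 j hj]
    · linarith [ht2 j hj]
    · linarith [hs2 j hj]
  · linarith
  · linarith

end NDG

namespace NDG
variable {V : Type*} [DecidableEq V]
set_option linter.unusedSectionVars false
open SimpleGraph

namespace HC
variable {G : SimpleGraph V} {c : Sym2 V → ℝ} {u v w x : V}

/-- inequality types for the linear program, from w-walks to M and x-walks from M -/
theorem ineq3a (H : HC G c u v w x) (hB : ¬ ContainsBC G u v w x) {i j : ℕ} (hi : i ≤ H.n)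
    (hj : j ≤ H.n) (A : G.Walk w (H.mv i)) (B : G.Walk (H.mv j) x) (D : G.Walk u v) :
    H.C H.n ≤ (wc c A - wc c H.Ll) + (wc c B - wc c H.Rl) + max (H.C j - H.C i) 0 +
      (wc c D - wc c H.Lu - wc c H.Ru) := by
  rw [H.C_n]
  rcases le_or_gt i j with h | h
  · have := H.exch [pc A, pc (H.mm i j), pc B, pc D]
    simp only [tot_cons, tot_nil, H.wc_mm h] at this
    linarith [le_max_left (H.C j - H.C i) 0]
  · by_contra hlt
    push Not at hlt
    refine hB (H.v3 (J' := H.mv j) (J := H.mv i) rfl rfl h hi D A B ?_)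
    linarith [le_max_right (H.C j - H.C i) 0]

theorem ineq1 (H : HC G c u v w x) {i k : ℕ} (A : G.Walk w (H.mv i)) (A' : G.Walk u (H.mv k)) :
    min (H.C i) (H.C k) ≤ (wc c A - wc c H.Ll) + (wc c A' - wc c H.Lu) := by
  rcases le_total i k with h | h
  · have := H.exch [pc A, pc A', pc (H.mm i k), pc (H.mn k), pc H.Ru, pc H.Rl]
    simp only [tot_cons, tot_nil, H.wc_mm h, H.wc_mn] at this
    linarith [min_le_left (H.C i) (H.C k)]
  · have := H.exch [pc A, pc A', pc (H.mm k i), pc (H.mn i), pc H.Ru, pc H.Rl]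
    simp only [tot_cons, tot_nil, H.wc_mm h, H.wc_mn] at this
    linarith [min_le_right (H.C i) (H.C k)]

theorem ineq2 (H : HC G c u v w x) {i k : ℕ} (B : G.Walk (H.mv k) x) (B' : G.Walk (H.mv i) v) :
    H.C H.n - max (H.C i) (H.C k) ≤ (wc c B - wc c H.Rl) + (wc c B' - wc c H.Ru) := by
  rw [H.C_n]
  rcases le_total i k with h | h
  · have := H.exch [pc B, pc B', pc (H.mm i k), pc (H.m0 i), pc H.Lu, pc H.Ll]
    simp only [tot_cons, tot_nil, H.wc_mm h, H.wc_m0] at this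
    linarith [le_max_right (H.C i) (H.C k)]
  · have := H.exch [pc B, pc B', pc (H.mm k i), pc (H.m0 k), pc H.Lu, pc H.Ll]
    simp only [tot_cons, tot_nil, H.wc_mm h, H.wc_m0] at this
    linarith [le_max_left (H.C i) (H.C k)]

theorem ineq3c (H : HC G c u v w x) (hB : ¬ ContainsBC G u v w x) {i j k l : ℕ} (hi : i ≤ H.n)
    (hj : j ≤ H.n) (hk : k ≤ H.n) (hl : l ≤ H.n)
    (A : G.Walk w (H.mv i)) (B : G.Walk (H.mv j) x) (A' : G.Walk u (H.mv k))
    (B' : G.Walk (H.mv l) v) :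
    H.C H.n ≤ (wc c A - wc c H.Ll) + (wc c B - wc c H.Rl) + max (H.C j - H.C i) 0 +
      ((wc c A' - wc c H.Lu) + (wc c B' - wc c H.Ru) + max (H.C l - H.C k) 0) := by
  rcases le_or_gt i j with h | h
  · have h2 : H.C H.n ≤ (wc c A' - wc c H.Lu) + (wc c B' - wc c H.Ru) + max (H.C l - H.C k) 0 +
      (wc c ((A.append (H.mm i j)).append B) - wc c H.Ll - wc c H.Rl) :=
      H.swap.ineq3a (fun h => hB h.swap) hk hl A' B' _
    simp only [wc_append, H.wc_mm h] at h2
    linarith [le_max_left (H.C j - H.C i) 0]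
  rcases le_or_gt k l with h' | h'
  · have h2 := H.ineq3a hB hi hj A B ((A'.append (H.mm k l)).append B')
    simp only [wc_append, H.wc_mm h'] at h2
    linarith [le_max_left (H.C l - H.C k) 0]
  by_contra hlt
  push Not at hlt
  refine hB (H.v4 h hi h' hk A B A' B' ?_)
  rw [H.C_n] at hlt
  linarith [le_max_right (H.C j - H.C i) 0, le_max_right (H.C l - H.C k) 0]

/-- the cost shares along M -/
theorem exists_shares [Fintype V] (H : HC G c u v w x) (hB : ¬ ContainsBC G u v w x) :
    ∃ π : ℕ → ℝ, π 0 = 0 ∧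
      (∀ i j, i ≤ j → j ≤ H.n → π i ≤ π j ∧ π j - π i ≤ H.C j - H.C i) ∧
      (∀ j ≤ H.n, (∀ q : G.Walk w (H.mv j), π j + wc c H.Ll ≤ wc c q) ∧
        (∀ q : G.Walk (H.mv j) x, π H.n - π j + wc c H.Rl ≤ wc c q) ∧
        (∀ q : G.Walk u (H.mv j), H.C j - π j + wc c H.Lu ≤ wc c q) ∧
        (∀ q : G.Walk (H.mv j) v, (H.C H.n - π H.n) - (H.C j - π j) + wc c H.Ru ≤ wc c q)) ∧
      (∀ q : G.Walk w x, wc c H.Ll + π H.n + wc c H.Rl ≤ wc c q) ∧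
      (∀ q : G.Walk u v, wc c H.Lu + (H.C H.n - π H.n) + wc c H.Ru ≤ wc c q) := by
  have eA := fun j => exists_min_walk c H.hc (G := G) ⟨H.Ll.append (H.m0 j)⟩
  have eB := fun j => exists_min_walk c H.hc (G := G) ⟨(H.mn j).append H.Rl⟩
  have eA' := fun j => exists_min_walk c H.hc (G := G) ⟨H.Lu.append (H.m0 j)⟩
  have eB' := fun j => exists_min_walk c H.hc (G := G) ⟨(H.mn j).append H.Ru⟩
  choose A _ mA using eA
  choose B _ mB using eB
  choose A' _ mA' using eA'
  choose B' _ mB' using eB'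
  obtain ⟨D, _, mD⟩ := exists_min_walk c H.hc (G := G) ⟨(H.Ll.append H.M).append H.Rl⟩
  obtain ⟨D', _, mD'⟩ := exists_min_walk c H.hc (G := G) ⟨(H.Lu.append H.M).append H.Ru⟩
  obtain ⟨π, h0, h1, h2, h3, h4⟩ := lp H.n H.C (fun j => wc c (A j) - wc c H.Ll)
    (fun j => wc c (B j) - wc c H.Rl) (fun j => wc c (A' j) - wc c H.Lu)
    (fun j => wc c (B' j) - wc c H.Ru) (wc c D - wc c H.Ll - wc c H.Rl)
    (wc c D' - wc c H.Lu - wc c H.Ru) H.C_zero (fun i j h _ => H.C_mono h)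
    (by have := mA 0 (H.Ll.append (H.m0 0)); simp at this; simpa using this)
    (by have := mA' 0 (H.Lu.append (H.m0 0)); simp at this; simpa using this)
    (by have := mB H.n ((H.mn H.n).append H.Rl); simp [H.C_n] at this; simpa using this)
    (by have := mB' H.n ((H.mn H.n).append H.Ru); simp [H.C_n] at this; simpa using this)
    (fun i hi k hk => H.ineq1 (A i) (A' k))
    (fun i hi k hk => H.ineq2 (B k) (B' i))
    (by
      have := H.exch [pc D, pc D']
      simp only [tot_cons, tot_nil] at this
      rw [H.C_n]; linarith)
    (fun i hi j hj => H.ineq3a hB hi hj (A i) (B j) D')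
    (fun i hi j hj => H.swap.ineq3a (fun h => hB h.swap) hi hj (A' i) (B' j) D)
    (fun i hi j hj k hk l hl => H.ineq3c hB hi hj hk hl _ _ _ _)
  refine ⟨π, h0, h1, fun j hj => ?_, fun q => ?_, fun q => ?_⟩
  · obtain ⟨x1, x2, x3, x4⟩ := h2 j hj
    exact ⟨fun q => by linarith [mA j q], fun q => by linarith [mB j q],
      fun q => by linarith [mA' j q], fun q => by linarith [mB' j q]⟩
  · linarith [mD q]
  · linarith [mD' q]

end HC
end NDG

namespace NDG
variable {V : Type*} [DecidableEq V]
set_option linter.unusedSectionVars false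
open SimpleGraph

theorem wc_telescope {G : SimpleGraph V} (ξ : Sym2 V → ℝ) {a b : V} (p : G.Walk a b) :
    ∀ f : ℕ → ℝ, (∀ i < p.length, ξ s(p.getVert i, p.getVert (i+1)) = f (i+1) - f i) →
    wc ξ p = f p.length - f 0 := by
  induction p with
  | nil => intro f _; simp
  | cons h p ih =>
    intro f hf
    have := ih (fun i => f (i+1)) (fun i hi => by
      have := hf (i+1) (by simpa using hi)
      simpa using this)
    have h0 := hf 0 (by simp)
    simp at h0
    simp [this, h0]

theorem wc_congr {G : SimpleGraph V} {ξ c : Sym2 V → ℝ} {a b : V} (p : G.Walk a b)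
    (h : ∀ e ∈ p.edges, ξ e = c e) : wc ξ p = wc c p := by
  unfold wc
  rw [List.map_congr_left h]

namespace HC
variable {G : SimpleGraph V} {c : Sym2 V → ℝ} {u v w x : V}

/-- ξ is a share function with potential π along M -/
structure IsShare (H : HC G c u v w x) (π : ℕ → ℝ) (ξ : Sym2 V → ℝ) : Prop where
  off : ∀ e, e ∉ H.M.edges → ξ e = c e
  on : ∀ i < H.n, ξ s(H.mv i, H.mv (i+1)) = π (i+1) - π i

theorem mem_M_edges (H : HC G c u v w x) {e : Sym2 V} :
    e ∈ H.M.edges ↔ ∃ i < H.n, s(H.mv i, H.mv (i+1)) = e := by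
  induction e with
  | _ y z => exact H.M.mk_mem_edges_iff_exists

theorem exists_isShare (H : HC G c u v w x) (π : ℕ → ℝ) : ∃ ξ, H.IsShare π ξ := by
  classical
  refine ⟨fun e => if h : ∃ i < H.n, s(H.mv i, H.mv (i+1)) = e then
    π (Classical.choose h + 1) - π (Classical.choose h) else c e, ?_, ?_⟩
  · intro e he
    rw [H.mem_M_edges] at he
    simp [he]
  · intro i hi
    have h : ∃ i' < H.n, s(H.mv i', H.mv (i'+1)) = s(H.mv i, H.mv (i+1)) := ⟨i, hi, rfl⟩
    simp only [h, dite_true]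
    obtain ⟨h1, h2⟩ := Classical.choose_spec h
    set i' := Classical.choose h
    have : i' = i := by
      rcases Sym2.eq_iff.1 h2 with ⟨h3, _⟩ | ⟨h3, h4⟩
      · exact H.mv_inj h1.le hi.le h3
      · have e1 := H.mv_inj h1.le (by omega) h3
        have e2 := H.mv_inj (by omega) hi.le h4
        omega
    rw [this]

theorem dist_M (H : HC G c u v w x) {i j : ℕ} (q : G.Walk (H.mv i) (H.mv j)) :
    H.C j - H.C i ≤ wc c q := by
  have := H.exch [pc H.Lu, pc H.Ll, pc (H.m0 i), pc q, pc (H.mn j), pc H.Ru, pc H.Rl]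
  simp only [tot_cons, tot_nil, H.wc_mn, H.wc_m0] at this
  linarith

theorem share_suff (H : HC G c u v w x) {π : ℕ → ℝ} {ξ : Sym2 V → ℝ} (hξ : H.IsShare π ξ)
    (hπ : ∀ i j, i ≤ j → j ≤ H.n → π i ≤ π j ∧ π j - π i ≤ H.C j - H.C i)
    (hβ : ∀ j ≤ H.n, ∀ q : G.Walk (H.mv j) x, π H.n - π j + wc c H.Rl ≤ wc c q)
    {y z : V} (p : G.Walk y z) (hz : z = x) :
    (∃ q : G.Walk y x, wc c q ≤ wc ξ p) ∨
    (∃ j ≤ H.n, ∃ q : G.Walk y (H.mv j), wc c q + (π H.n - π j) + wc c H.Rl ≤ wc ξ p) := by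
  have key : ∀ i ≤ H.n, ∀ j ≤ H.n, ∀ q : G.Walk (H.mv i) (H.mv j), π j - π i ≤ wc c q ∧
      π i - π j ≤ wc c q := by
    intro i hi j hj q
    have h1 := H.dist_M q
    have h2 := H.dist_M q.reverse
    have h3 := wc_nonneg H.hc q
    rw [wc_reverse] at h2
    rcases le_total i j with h | h
    · have := hπ i j h hj
      constructor <;> linarith
    · have := hπ j i h hi
      constructor <;> linarith
  induction p with
  | nil => subst hz; exact Or.inl ⟨.nil, by simp⟩
  | @cons y y' z h p ih =>
    have ih := ih hz
    rw [wc_cons]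
    by_cases he : s(y, y') ∈ H.M.edges
    · right
      obtain ⟨i, hi, hie⟩ := H.mem_M_edges.1 he
      have hon := hξ.on i hi
      rw [hie] at hon
      have hm := (hπ i (i+1) (by omega) hi).1
      have low : ∀ k ≤ H.n, H.mv k = y' → π H.n - π k + wc c H.Rl ≤ wc ξ p := by
        rintro k hk rfl
        rcases ih with ⟨q, hq⟩ | ⟨j, hj, q, hq⟩
        · linarith [hβ k hk q]
        · linarith [(key k hk j hj q).1]
      rcases Sym2.eq_iff.1 hie with ⟨rfl, rfl⟩ | ⟨rfl, rfl⟩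
      · refine ⟨i, hi.le, .nil, ?_⟩
        have := low (i+1) hi rfl
        rw [wc_nil, hon]; linarith
      · refine ⟨i+1, hi, .nil, ?_⟩
        have := low i hi.le rfl
        rw [wc_nil, hon]; linarith
    · rw [hξ.off _ he]
      rcases ih with ⟨q, hq⟩ | ⟨j, hj, q, hq⟩
      · exact Or.inl ⟨.cons h q, by rw [wc_cons]; linarith⟩
      · exact Or.inr ⟨j, hj, .cons h q, by rw [wc_cons]; linarith⟩

theorem share_Pl (H : HC G c u v w x) {π : ℕ → ℝ} {ξ : Sym2 V → ℝ} (hξ : H.IsShare π ξ)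
    (h0 : π 0 = 0) : wc ξ ((H.Ll.append H.M).append H.Rl) = wc c H.Ll + π H.n + wc c H.Rl := by
  have hnd := H.hPl.isTrail.edges_nodup
  simp only [Walk.edges_append, List.nodup_append, List.mem_append] at hnd
  obtain ⟨⟨-, -, h1⟩, -, h2⟩ := hnd
  have hM := wc_telescope ξ H.M π hξ.on
  rw [wc_append, wc_append, wc_congr (c := c) H.Ll, wc_congr (c := c) H.Rl, hM, h0, sub_zero]; rfl
  · exact fun e he => hξ.off e fun hm => h2 e (Or.inr hm) e he rfl
  · exact fun e he => hξ.off e fun hm => h1 e he e hm rfl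

/-- cost shares making both paths shortest -/
theorem exists_xi [Fintype V] (H : HC G c u v w x) (hB : ¬ ContainsBC G u v w x) :
    ∃ ξ ξ' : Sym2 V → ℝ, (∀ e, 0 ≤ ξ e) ∧ (∀ e, 0 ≤ ξ' e) ∧
      (∀ e ∈ H.M.edges, ξ e + ξ' e = c e) ∧ (∀ e, e ∉ H.M.edges → ξ e = c e ∧ ξ' e = c e) ∧
      (∀ q : G.Walk u v, wc ξ ((H.Lu.append H.M).append H.Ru) ≤ wc ξ q) ∧
      (∀ q : G.Walk w x, wc ξ' ((H.Ll.append H.M).append H.Rl) ≤ wc ξ' q) := by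
  obtain ⟨π, h0, h1, h2, h3, h4⟩ := H.exists_shares hB
  obtain ⟨ξ', hξ'⟩ := H.exists_isShare π
  obtain ⟨ξ, hξ⟩ : ∃ ξ, H.swap.IsShare (fun i => H.C i - π i) ξ := H.swap.exists_isShare _
  have hon : ∀ i < H.n, ξ s(H.mv i, H.mv (i+1)) = (H.C (i+1) - π (i+1)) - (H.C i - π i) := hξ.on
  have hcon : ∀ i < H.n, c s(H.mv i, H.mv (i+1)) = H.C (i+1) - H.C i := by
    intro i hi
    obtain ⟨ξc, hξc⟩ := H.exists_isShare (fun i => 0)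
    have hadj : G.Adj (H.mv i) (H.mv (i+1)) := H.M.adj_getVert_succ hi
    apply le_antisymm
    · have := H.wc_mm (Nat.le_succ i)
      have hw : ∀ {a b : V} (p : G.Walk a b), s(a,b) ∈ p.edges → c s(a,b) ≤ wc c p := by
        intro a b p hp
        unfold wc
        exact List.single_le_sum (by simpa using fun e _ => H.hc e) _ (List.mem_map_of_mem hp)
      rw [← this]
      have hs := H.mm_spec (Nat.le_succ i)
      apply hw
      have hmem : s(H.mv i, H.mv (i+1)) ∈ (H.m0 (i+1)).edges := by
        refine (Walk.mk_mem_edges_iff_exists _).2 ⟨i, ?_, ?_⟩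
        · have : H.n = H.M.length := rfl
          have h3 : (H.m0 (i+1)).length = min (i+1) H.M.length := H.M.take_length (i+1)
          rw [h3]; omega
        · simp [m0, Walk.take_getVert, mv]
      rw [hs, Walk.edges_append, List.mem_append] at hmem
      rcases hmem with hmem | hmem
      · exfalso
        have := Walk.snd_mem_support_of_mem_edges _ hmem
        obtain ⟨k, hk, hk2⟩ := Walk.mem_support_iff_exists_getVert.1 this
        have hk3 : k ≤ i := by
          have h3 : (H.m0 i).length = min i H.M.length := H.M.take_length i
          omega
        have hk4 : H.mv k = H.mv (i+1) := by
          rw [← hk]; simp [m0, Walk.take_getVert, mv, hk3]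
        have := H.mv_inj (by omega) (by omega) hk4
        omega
      · exact hmem
    · have := H.dist_M hadj.toWalk
      simpa using this
  refine ⟨ξ, ξ', ?_, ?_, ?_, ?_, ?_, ?_⟩
  · intro e
    by_cases he : e ∈ H.M.edges
    · obtain ⟨i, hi, rfl⟩ := H.mem_M_edges.1 he
      rw [hon i hi]; linarith [(h1 i (i+1) (by omega) hi).2]
    · rw [hξ.off e he]; exact H.hc e
  · intro e
    by_cases he : e ∈ H.M.edges
    · obtain ⟨i, hi, rfl⟩ := H.mem_M_edges.1 he
      rw [hξ'.on i hi]; linarith [(h1 i (i+1) (by omega) hi).1]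
    · rw [hξ'.off e he]; exact H.hc e
  · intro e he
    obtain ⟨i, hi, rfl⟩ := H.mem_M_edges.1 he
    rw [hon i hi, hξ'.on i hi, hcon i hi]; ring
  · intro e he
    exact ⟨hξ.off e he, hξ'.off e he⟩
  · intro q
    have e1 : wc ξ ((H.Lu.append H.M).append H.Ru) = wc c H.Lu + (H.C H.n - π H.n) + wc c H.Ru :=
      H.swap.share_Pl hξ (by simp [h0])
    rw [e1]
    have := H.swap.share_suff hξ (fun i j hij hj => (by
        have := h1 i j hij hj
        show H.C i - π i ≤ H.C j - π j ∧ (H.C j - π j) - (H.C i - π i) ≤ H.C j - H.C i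
        constructor <;> linarith)) (fun j hj q => (h2 j hj).2.2.2 q) q rfl
    rcases this with ⟨q', hq'⟩ | ⟨j, hj, q', hq'⟩
    · linarith [h4 q']
    · have h5 : H.C j - π j + wc c H.Lu ≤ wc c q' := (h2 j hj).2.2.1 q'
      generalize wc c q' = Q at *
      have hq'' : Q + ((H.C H.n - π H.n) - (H.C j - π j)) + wc c H.Ru ≤ wc ξ q := hq'
      linarith
  · intro q
    rw [H.share_Pl hξ' h0]
    rcases H.share_suff hξ' h1 (fun j hj q => (h2 j hj).2.1 q) q rfl with ⟨q', hq'⟩ | ⟨j, hj, q', hq'⟩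
    · linarith [h3 q']
    · have h5 := (h2 j hj).1 q'
      linarith

end HC
end NDG

namespace NDG
variable {V : Type*} [DecidableEq V]
set_option linter.unusedSectionVars false
open SimpleGraph

section
variable {G : SimpleGraph V}

theorem path_unique_of {F : Set (Sym2 V)} (hF : (SimpleGraph.fromEdgeSet F).IsAcyclic) {y z : V}
    (p q : G.Walk y z) (hp : p.IsPath) (hq : q.IsPath) (hpF : ∀ e ∈ p.edges, e ∈ F)
    (hqF : ∀ e ∈ q.edges, e ∈ F) : p = q := by
  have t : ∀ r : G.Walk y z, (∀ e ∈ r.edges, e ∈ F) →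
      ∀ e ∈ r.edges, e ∈ (SimpleGraph.fromEdgeSet F).edgeSet := by
    intro r hr e he
    rw [SimpleGraph.edgeSet_fromEdgeSet]
    exact ⟨hr e he, G.not_isDiag_of_mem_edgeSet (r.edges_subset_edgeSet he)⟩
  have := hF.path_unique ⟨p.transfer _ (t p hpF), hp.transfer _⟩ ⟨q.transfer _ (t q hqF), hq.transfer _⟩
  have h2 : p.transfer _ (t p hpF) = q.transfer _ (t q hqF) := congrArg Subtype.val this
  have key : ∀ p' q' : (SimpleGraph.fromEdgeSet F).Walk y z, p' = q' → 
    ∀ hp' : ∀ e ∈ p'.edges, e ∈ G.edgeSet, ∀ hq' : ∀ e ∈ q'.edges, e ∈ G.edgeSet,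
      p'.transfer G hp' = q'.transfer G hq' := by
    rintro p' _ rfl _ _; rfl
  have h3 := key _ _ h2 (by simpa using fun e he => p.edges_subset_edgeSet he)
    (by simpa using fun e he => q.edges_subset_edgeSet he)
  rw [Walk.transfer_transfer, Walk.transfer_transfer, Walk.transfer_self, Walk.transfer_self] at h3
  exact h3

theorem enforce_of {s₁ t₁ s₂ t₂ : V} {c : Sym2 V → ℝ} (hc : ∀ e, 0 ≤ c e) {F : Finset (Sym2 V)}
    (hF : (SimpleGraph.fromEdgeSet (↑F : Set (Sym2 V))).IsAcyclic)
    (P₁ : Strat G s₁ t₁) (P₂ : Strat G s₂ t₂) (hP₁ : ∀ e ∈ P₁.1.edges, e ∈ F)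
    (hP₂ : ∀ e ∈ P₂.1.edges, e ∈ F) (ξ ξ' : Sym2 V → ℝ) (h0 : ∀ e, 0 ≤ ξ e) (h0' : ∀ e, 0 ≤ ξ' e)
    (hcom : ∀ e, e ∈ P₁.1.edges → e ∈ P₂.1.edges → ξ e + ξ' e = c e)
    (hnc : ∀ e, ¬ (e ∈ P₁.1.edges ∧ e ∈ P₂.1.edges) → ξ e = c e ∧ ξ' e = c e)
    (hm1 : ∀ q : G.Walk s₁ t₁, wc ξ P₁.1 ≤ wc ξ q)
    (hm2 : ∀ q : G.Walk s₂ t₂, wc ξ' P₂.1 ≤ wc ξ' q) : Enforceable G s₁ t₁ s₂ t₂ c F := by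
  refine ⟨P₁, P₂, hP₁, hP₂, fun Q h => Subtype.ext (path_unique_of hF _ _ Q.2 P₁.2 h hP₁),
    fun Q h => Subtype.ext (path_unique_of hF _ _ Q.2 P₂.2 h hP₂), ?_⟩
  let Ξ : Protocol G s₁ t₁ s₂ t₂ := fun Q₁ Q₂ i e =>
    if usedBy Q₁ Q₂ e = {0, 1} then
      if e ∈ P₁.1.edges then
        if e ∈ P₂.1.edges then (if i = 0 then ξ e else ξ' e) else (if i = 0 then 0 else c e)
      else (if i = 0 then c e else 0)
    else c e
  have hub : ∀ (Q₁ : Strat G s₁ t₁) (Q₂ : Strat G s₂ t₂) e, usedBy Q₁ Q₂ e = {0, 1} ↔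
      e ∈ Q₁.1.edges ∧ e ∈ Q₂.1.edges := by
    intro Q₁ Q₂ e
    unfold usedBy
    split_ifs with h1 h2 h2 <;> simp [h1, h2] <;> decide
  have hpne : IsPNE Ξ P₁ P₂ := by
    have e1 : ∀ Q₁ : Strat G s₁ t₁, cost₁ Ξ Q₁ P₂ = wc ξ Q₁.1 := by
      intro Q₁
      rw [← sum_edges_eq_wc _ _ Q₁.2]
      refine Finset.sum_congr rfl fun e he => ?_
      have he : e ∈ Q₁.1.edges := by simpa using he
      by_cases h2 : e ∈ P₂.1.edges
      · have : usedBy Q₁ P₂ e = {0, 1} := (hub _ _ _).2 ⟨he, h2⟩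
        by_cases h1 : e ∈ P₁.1.edges
        · simp [Ξ, this, h1, h2]
        · simp [Ξ, this, h1, (hnc e (by tauto)).1]
      · have : ¬ usedBy Q₁ P₂ e = {0, 1} := fun h => h2 ((hub _ _ _).1 h).2
        simp [Ξ, this, (hnc e (by tauto)).1]
    have e2 : ∀ Q₂ : Strat G s₂ t₂, cost₂ Ξ P₁ Q₂ = wc ξ' Q₂.1 := by
      intro Q₂
      rw [← sum_edges_eq_wc _ _ Q₂.2]
      refine Finset.sum_congr rfl fun e he => ?_
      have he : e ∈ Q₂.1.edges := by simpa using he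
      by_cases h1 : e ∈ P₁.1.edges
      · have : usedBy P₁ Q₂ e = {0, 1} := (hub _ _ _).2 ⟨h1, he⟩
        by_cases h2 : e ∈ P₂.1.edges
        · simp [Ξ, this, h1, h2]
        · simp [Ξ, this, h1, h2, (hnc e (by tauto)).2]
      · have : ¬ usedBy P₁ Q₂ e = {0, 1} := fun h => h1 ((hub _ _ _).1 h).1
        simp [Ξ, this, (hnc e (by tauto)).2]
    constructor
    · intro Q₁; rw [e1, e1]; exact hm1 _
    · intro Q₂; rw [e2, e2]; exact hm2 _
  refine ⟨Ξ, ⟨?_, ?_, ⟨P₁, P₂, hpne⟩, ?_⟩, hpne⟩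
  · intro Q₁ Q₂ i e
    have := hc e
    have := h0 e
    have := h0' e
    simp only [Ξ]
    split_ifs <;> first | assumption | exact le_rfl
  · intro Q₁ Q₂ e hne
    by_cases h : usedBy Q₁ Q₂ e = {0, 1}
    · rw [h, Finset.sum_pair (by decide)]
      simp only [Ξ, h, if_true]
      split_ifs with h1 h2 <;> simp at *
      exact hcom e h1 h2
    · simp only [Ξ, h, if_false]
      have : (usedBy Q₁ Q₂ e).card = 1 := by
        rw [hub] at h
        revert hne
        unfold usedBy
        split_ifs with h1 h2 h2
        · exact (h ⟨h1, h2⟩).elim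
        all_goals simp
      simp [this]
  · intro Q₁ Q₂ R₁ R₂ e h i
    simp only [Ξ, h]

end

theorem enforce_case [Fintype V] {G : SimpleGraph V} {u v w x : V} {c : Sym2 V → ℝ} (hc : ∀ e, 0 ≤ c e)
    {F : Set (Sym2 V)} {T : ℝ} (hT : ∀ l : List (Sym2 V), l.Nodup → (∀ e ∈ l, e ∈ F) → (l.map c).sum ≤ T)
    (hF : (SimpleGraph.fromEdgeSet F).IsAcyclic)
    (hopt : ∀ (p : G.Walk u v) (q : G.Walk w x), T ≤ ∑ e ∈ (p.edges ++ q.edges).toFinset, c e)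
    (hB : ¬ ContainsBC G u v w x) {a b : V} (Lu : G.Walk u a) (M : G.Walk a b) (Ru : G.Walk b v)
    (Ll : G.Walk w a) (M' : G.Walk a b) (Rl : G.Walk b x)
    (hP : ((Lu.append M).append Ru).IsPath) (hQ : ((Ll.append M').append Rl).IsPath)
    (hPF : ∀ e ∈ ((Lu.append M).append Ru).edges, e ∈ F)
    (hQF : ∀ e ∈ ((Ll.append M').append Rl).edges, e ∈ F)
    (hLu : ∀ y ∈ Lu.support, y ∈ ((Ll.append M').append Rl).support → y = a)
    (hRu : ∀ y ∈ Ru.support, y ∈ ((Ll.append M').append Rl).support → y = b) :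
    ∃ ξ ξ' : Sym2 V → ℝ, (∀ e, 0 ≤ ξ e) ∧ (∀ e, 0 ≤ ξ' e) ∧
      (∀ e, e ∈ ((Lu.append M).append Ru).edges → e ∈ ((Ll.append M').append Rl).edges →
        ξ e + ξ' e = c e) ∧
      (∀ e, ¬ (e ∈ ((Lu.append M).append Ru).edges ∧ e ∈ ((Ll.append M').append Rl).edges) →
        ξ e = c e ∧ ξ' e = c e) ∧
      (∀ q : G.Walk u v, wc ξ ((Lu.append M).append Ru) ≤ wc ξ q) ∧
      (∀ q : G.Walk w x, wc ξ' ((Ll.append M').append Rl) ≤ wc ξ' q) := by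
  have hM : M' = M := by
    have h1 := (isPath_append_iff _ _).1 hP
    have h2 := (isPath_append_iff _ _).1 h1.1
    have h3 := (isPath_append_iff _ _).1 hQ
    have h4 := (isPath_append_iff _ _).1 h3.1
    refine path_unique_of hF _ _ h4.2.1 h2.2.1 ?_ ?_
    · intro e he; exact hQF e (by simp [he])
    · intro e he; exact hPF e (by simp [he])
  subst hM
  have hdisj : ∀ y, y ∈ ((Lu.append M').append Ru).support →
      y ∈ ((Ll.append M').append Rl).support → y ∈ M'.support := by
    intro y h1 h2
    simp only [Walk.mem_support_append_iff] at h1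
    rcases h1 with (h | h) | h
    · rw [hLu y h h2]; simp
    · exact h
    · rw [hRu y h h2]; simp
  have hQ1 := (isPath_append_iff _ _).1 hQ
  have hQ2 := (isPath_append_iff _ _).1 hQ1.1
  let H : HC G c u v w x := {
    a := a, b := b, Lu := Lu, M := M', Ru := Ru, Ll := Ll, Rl := Rl, hc := hc, hPu := hP, hPl := hQ
    hforest := by
      refine hF.anti (SimpleGraph.fromEdgeSet_mono ?_)
      rintro e (he | he)
      · exact hPF e he
      · exact hQF e he
    hdisj := hdisj
    hopt := by
      intro p q
      refine le_trans ?_ (hopt p q)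
      have := hT (((Lu.append M').append Ru).edges ++ (Ll.edges ++ Rl.edges)) (by
        have n1 := hP.isTrail.edges_nodup
        have n2 := hQ.isTrail.edges_nodup
        rw [Walk.edges_append, Walk.edges_append] at n2
        simp only [List.nodup_append, List.mem_append] at n2
        rw [List.nodup_append, List.nodup_append]
        refine ⟨n1, ⟨n2.1.1, n2.2.1, fun e he e' he' => n2.2.2 e (Or.inl he) e' he'⟩, ?_⟩
        rintro e he e' he' rfl
        rcases List.mem_append.1 he' with he' | he'
        · refine HC.edge_disj (s := a) (fun r h1 h2 => ?_) he he'
          exact hQ2.2.2 r h2 (hdisj r h1 (by simp [Walk.mem_support_append_iff, h2]))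
        · refine HC.edge_disj (s := b) (fun r h1 h2 => ?_) he he'
          exact hQ1.2.2 r (by simp [Walk.mem_support_append_iff, hdisj r h1 (by simp [Walk.mem_support_append_iff, h2])]) h2)
        (by
          intro e he
          rcases List.mem_append.1 he with he | he
          · exact hPF e he
          · refine hQF e ?_
            simp only [Walk.edges_append, List.mem_append] at he ⊢
            tauto)
      simp only [Walk.edges_append, List.map_append, List.sum_append] at this
      unfold wc
      linarith }
  obtain ⟨ξ, ξ', h1, h2, h3, h4, h5, h6⟩ := H.exists_xi hB
  refine ⟨ξ, ξ', h1, h2, fun e he he' => h3 e (H.hmeet e he he'), fun e he => h4 e fun hm => he ?_, h5, h6⟩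
  have hm : e ∈ M'.edges := hm
  simp [hm]

theorem ContainsBC.rev2 {G : SimpleGraph V} {u v w x : V} (h : ContainsBC G u v x w) :
    ContainsBC G u v w x := by
  unfold ContainsBC at *
  tauto

theorem stronglyEfficient_of [Fintype V] {G : SimpleGraph V} {s₁ t₁ s₂ t₂ : V}
    (hB : ¬ ContainsBC G s₁ t₁ s₂ t₂) : StronglyEfficient G s₁ t₁ s₂ t₂ := by
  intro c hc F hF
  obtain ⟨⟨hFG, hac, ⟨p, hp, hpF⟩, ⟨q, hq, hqF⟩⟩, hmin⟩ := hF
  have hopt : ∀ (p : G.Walk s₁ t₁) (q : G.Walk s₂ t₂), cost c F ≤ ∑ e ∈ (p.edges ++ q.edges).toFinset, c e := by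
    intro p q
    obtain ⟨F', hs, hF'⟩ := exists_steiner p q
    exact (hmin F' hF').trans (Finset.sum_le_sum_of_subset_of_nonneg hs fun e _ _ => hc e)
  have hT : ∀ l : List (Sym2 V), l.Nodup → (∀ e ∈ l, e ∈ (↑F : Set (Sym2 V))) → (l.map c).sum ≤ cost c F := by
    intro l hl hlF
    rw [← List.sum_toFinset _ hl]
    refine Finset.sum_le_sum_of_subset_of_nonneg ?_ fun e _ _ => hc e
    intro e he
    exact_mod_cast hlF e (by simpa using he)
  suffices h : ∃ ξ ξ' : Sym2 V → ℝ, (∀ e, 0 ≤ ξ e) ∧ (∀ e, 0 ≤ ξ' e) ∧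
      (∀ e, e ∈ p.edges → e ∈ q.edges → ξ e + ξ' e = c e) ∧
      (∀ e, ¬ (e ∈ p.edges ∧ e ∈ q.edges) → ξ e = c e ∧ ξ' e = c e) ∧
      (∀ r : G.Walk s₁ t₁, wc ξ p ≤ wc ξ r) ∧ (∀ r : G.Walk s₂ t₂, wc ξ' q ≤ wc ξ' r) by
    obtain ⟨ξ, ξ', h1, h2, h3, h4, h5, h6⟩ := h
    exact enforce_of hc hac ⟨p, hp⟩ ⟨q, hq⟩ hpF hqF ξ ξ' h1 h2 h3 h4 h5 h6
  by_cases hsh : ∃ e, e ∈ p.edges ∧ e ∈ q.edges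
  swap
  · push Not at hsh
    have hnd : (p.edges ++ q.edges).Nodup := by
      rw [List.nodup_append]
      refine ⟨hp.isTrail.edges_nodup, hq.isTrail.edges_nodup, ?_⟩
      rintro e he _ he' rfl
      exact hsh e he he'
    have hle := hT _ hnd (by
      intro e he
      rcases List.mem_append.1 he with he | he
      · exact hpF e he
      · exact hqF e he)
    rw [List.map_append, List.sum_append] at hle
    refine ⟨c, c, hc, hc, fun e h1 h2 => (hsh e h1 h2).elim, fun e _ => ⟨rfl, rfl⟩, fun r => ?_, fun r => ?_⟩
    · have := (hle.trans (hopt r q)).trans (sum_toFinset_le c hc _)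
      rw [List.map_append, List.sum_append] at this
      unfold wc; linarith
    · have := (hle.trans (hopt p r)).trans (sum_toFinset_le c hc _)
      rw [List.map_append, List.sum_append] at this
      unfold wc; linarith
  obtain ⟨e0, he1, he2⟩ := hsh
  obtain ⟨y0, hy1, hy2⟩ : ∃ y, y ∈ p.support ∧ y ∈ q.support := by
    induction e0 with
    | _ y z => exact ⟨y, p.fst_mem_support_of_mem_edges he1, q.fst_mem_support_of_mem_edges he2⟩
  obtain ⟨a, Lu, R, hpR, ha, hLu⟩ := firstHit (fun y => y ∈ q.support) p ⟨y0, hy1, hy2⟩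
  obtain ⟨b, M, Ru, hR, hb, hRu⟩ := lastHit (fun y => y ∈ q.support) R ⟨a, by simp, ha⟩
  have hpe : p = (Lu.append M).append Ru := by rw [hpR, hR, Walk.append_assoc]
  clear hpR hR
  subst hpe
  obtain ⟨Ll, X, hX⟩ := splitAt q ha
  have hbX : b ∈ Ll.support ∨ b ∈ X.support := by
    have := hb
    rw [hX, Walk.mem_support_append_iff] at this
    exact this
  rcases hbX with hb' | hb'
  swap
  · obtain ⟨M', Rl, hM'⟩ := splitAt X hb'
    have hqe : q = (Ll.append M').append Rl := by rw [hX, hM', Walk.append_assoc]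
    clear hX hM'
    subst hqe
    exact enforce_case hc hT hac hopt hB Lu M Ru Ll M' Rl hp hq hpF hqF hLu hRu
  · obtain ⟨Rl, M', hM'⟩ := splitAt Ll hb'
    have hqe : q = (Rl.append M').append X := by rw [hX, hM']
    clear hX hM'
    subst hqe
    have := enforce_case hc hT hac (w := t₂) (x := s₂) (fun p r => by
        have := hopt p r.reverse
        have e : (p.edges ++ r.reverse.edges).toFinset = (p.edges ++ r.edges).toFinset := by
          ext; simp
        rwa [e] at this) (fun h => hB h.rev2) Lu M Ru X.reverse M'.reverse Rl.reverse hp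
        (by have := hq.reverse; simpa [Walk.reverse_append, Walk.append_assoc] using this) hpF
        (fun e he => hqF e (by simp at he ⊢; tauto))
        (fun y h1 h2 => hLu y h1 (by simp [Walk.mem_support_append_iff] at h2 ⊢; tauto))
        (fun y h1 h2 => hRu y h1 (by simp [Walk.mem_support_append_iff] at h2 ⊢; tauto))
    obtain ⟨ξ, ξ', h1, h2, h3, h4, h5, h6⟩ := this
    refine ⟨ξ, ξ', h1, h2, fun e he he' => h3 e he (by simp at he' ⊢; tauto),
      fun e he => h4 e (fun h => he ⟨h.1, by have := h.2; simp at this ⊢; tauto⟩), h5, fun r => ?_⟩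
    have := h6 r.reverse
    simp only [wc_append, wc_reverse] at this ⊢
    linarith

end NDG

namespace NDG
variable {V : Type*} [DecidableEq V]
set_option linter.unusedSectionVars false
open SimpleGraph

/-- existence of an optimal pair of paths that can be enforced by cost shares -/
def EffP (G : SimpleGraph V) (u v w x : V) (c : Sym2 V → ℝ) : Prop :=
  ∃ (P : G.Walk u v) (Q : G.Walk w x), P.IsPath ∧ Q.IsPath ∧
    (∀ (p : G.Walk u v) (q : G.Walk w x),
      ∑ e ∈ (P.edges ++ Q.edges).toFinset, c e ≤ ∑ e ∈ (p.edges ++ q.edges).toFinset, c e) ∧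
    ∃ ξ ξ' : Sym2 V → ℝ, (∀ e, 0 ≤ ξ e ∧ ξ e ≤ c e) ∧ (∀ e, 0 ≤ ξ' e ∧ ξ' e ≤ c e) ∧
      (∀ e, e ∈ P.edges → e ∈ Q.edges → ξ e + ξ' e = c e) ∧
      (∀ e, ¬ (e ∈ P.edges ∧ e ∈ Q.edges) → ξ e = c e ∧ ξ' e = c e) ∧
      (∀ r : G.Walk u v, r.IsPath → wc ξ P ≤ wc ξ r) ∧ (∀ r : G.Walk w x, r.IsPath → wc ξ' Q ≤ wc ξ' r)

theorem EffP.swap {G : SimpleGraph V} {u v w x : V} {c : Sym2 V → ℝ} (h : EffP G u v w x c) :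
    EffP G w x u v c := by
  obtain ⟨P, Q, hP, hQ, ho, ξ, ξ', h1, h2, h3, h4, h5, h6⟩ := h
  refine ⟨Q, P, hQ, hP, fun p q => ?_, ξ', ξ, h2, h1, fun e a b => by rw [add_comm]; exact h3 e b a,
    fun e h => (h4 e (by tauto)).symm, h6, h5⟩
  have := ho q p
  have e1 : (P.edges ++ Q.edges).toFinset = (Q.edges ++ P.edges).toFinset := by ext; simp [or_comm]
  have e2 : (q.edges ++ p.edges).toFinset = (p.edges ++ q.edges).toFinset := by ext; simp [or_comm]
  rwa [e1, e2] at this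

theorem EffP.rev {G : SimpleGraph V} {u v w x : V} {c : Sym2 V → ℝ} (h : EffP G u v w x c) :
    EffP G v u w x c := by
  obtain ⟨P, Q, hP, hQ, ho, ξ, ξ', h1, h2, h3, h4, h5, h6⟩ := h
  refine ⟨P.reverse, Q, hP.reverse, hQ, fun p q => ?_, ξ, ξ', h1, h2, fun e a b => h3 e (by simpa using a) b,
    fun e h => (h4 e (by simpa using h)), fun r hr => ?_, h6⟩
  · have := ho p.reverse q
    have e1 : (P.reverse.edges ++ Q.edges).toFinset = (P.edges ++ Q.edges).toFinset := by ext; simp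
    have e2 : (p.reverse.edges ++ q.edges).toFinset = (p.edges ++ q.edges).toFinset := by ext; simp
    rw [e2] at this
    rwa [e1]
  · have := h5 r.reverse hr.reverse
    simpa using this

theorem Efficient.effP {G : SimpleGraph V} {s₁ t₁ s₂ t₂ : V} (h : Efficient G s₁ t₁ s₂ t₂)
    {c : Sym2 V → ℝ} (hc : ∀ e, 0 ≤ c e) : EffP G s₁ t₁ s₂ t₂ c := by
  classical
  obtain ⟨F, ⟨hF, hmin⟩, P, Q, hPF, hQF, -, -, Ξ, hsep, hpne⟩ := h c hc
  have uP : ∀ (A : Strat G s₁ t₁) (B : Strat G s₂ t₂) e, e ∈ A.1.edges → e ∉ B.1.edges →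
      Ξ A B 0 e = c e := by
    intro A B e h1 h2
    have : usedBy A B e = {0} := by simp [usedBy, h1, h2]
    have hb := hsep.budget A B e (by simp [this])
    rw [this, Finset.sum_singleton] at hb
    exact hb
  have uQ : ∀ (A : Strat G s₁ t₁) (B : Strat G s₂ t₂) e, e ∉ A.1.edges → e ∈ B.1.edges →
      Ξ A B 1 e = c e := by
    intro A B e h1 h2
    have : usedBy A B e = {1} := by simp [usedBy, h1, h2]
    have hb := hsep.budget A B e (by simp [this])
    rw [this, Finset.sum_singleton] at hb
    exact hb
  have uB : ∀ (A : Strat G s₁ t₁) (B : Strat G s₂ t₂) e, e ∈ A.1.edges → e ∈ B.1.edges →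
      usedBy A B e = {0, 1} := by
    intro A B e h1 h2
    simp [usedBy, h1, h2]
  have uPQ : ∀ (A : Strat G s₁ t₁) (B : Strat G s₂ t₂) e, e ∈ A.1.edges → e ∈ B.1.edges →
      Ξ A B 0 e + Ξ A B 1 e = c e := by
    intro A B e h1 h2
    have hb := hsep.budget A B e (by simp [uB A B e h1 h2])
    rw [uB A B e h1 h2, Finset.sum_pair (by decide)] at hb
    exact hb
  refine ⟨P.1, Q.1, P.2, Q.2, ?_, fun e => if e ∈ P.1.edges ∧ e ∈ Q.1.edges then Ξ P Q 0 e else c e,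
    fun e => if e ∈ P.1.edges ∧ e ∈ Q.1.edges then Ξ P Q 1 e else c e, ?_, ?_, ?_, ?_, ?_, ?_⟩
  · intro p q
    obtain ⟨F', hs, hF'⟩ := exists_steiner p q
    have h1 : ∑ e ∈ (P.1.edges ++ Q.1.edges).toFinset, c e ≤ cost c F := by
      refine Finset.sum_le_sum_of_subset_of_nonneg ?_ fun e _ _ => hc e
      intro e he
      simp only [List.mem_toFinset, List.mem_append] at he
      rcases he with he | he
      · exact hPF e he
      · exact hQF e he
    exact h1.trans ((hmin F' hF').trans (Finset.sum_le_sum_of_subset_of_nonneg hs fun e _ _ => hc e))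
  · intro e
    dsimp only
    split_ifs with h
    · exact ⟨hsep.nonneg _ _ _ _, by linarith [uPQ P Q e h.1 h.2, hsep.nonneg P Q 1 e]⟩
    · exact ⟨hc e, le_rfl⟩
  · intro e
    dsimp only
    split_ifs with h
    · exact ⟨hsep.nonneg _ _ _ _, by linarith [uPQ P Q e h.1 h.2, hsep.nonneg P Q 0 e]⟩
    · exact ⟨hc e, le_rfl⟩
  · intro e h1 h2
    simp [h1, h2, uPQ P Q e h1 h2]
  · intro e h
    simp [h]
  · intro r hr
    have := hpne.1 ⟨r, hr⟩
    rw [← sum_edges_eq_wc _ _ P.2, ← sum_edges_eq_wc _ _ hr]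
    refine le_trans (le_of_eq ?_) (this.trans ?_)
    · refine Finset.sum_congr rfl fun e he => ?_
      have he : e ∈ P.1.edges := by simpa using he
      by_cases h : e ∈ Q.1.edges
      · simp [he, h]
      · simp [h, uP P Q e he h]
    · refine Finset.sum_le_sum fun e he => ?_
      have he : e ∈ r.edges := by simpa using he
      by_cases h : e ∈ Q.1.edges
      · split_ifs with hh
        · exact le_of_eq (hsep.separable _ _ _ _ e ((uB ⟨r, hr⟩ Q e he h).trans (uB P Q e hh.1 h).symm) 0)
        · linarith [uPQ ⟨r, hr⟩ Q e he h, hsep.nonneg ⟨r, hr⟩ Q 1 e]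
      · simp [h, uP ⟨r, hr⟩ Q e he h]
  · intro r hr
    have := hpne.2 ⟨r, hr⟩
    rw [← sum_edges_eq_wc _ _ Q.2, ← sum_edges_eq_wc _ _ hr]
    refine le_trans (le_of_eq ?_) (this.trans ?_)
    · refine Finset.sum_congr rfl fun e he => ?_
      have he : e ∈ Q.1.edges := by simpa using he
      by_cases h : e ∈ P.1.edges
      · simp [he, h]
      · simp [h, uQ P Q e h he]
    · refine Finset.sum_le_sum fun e he => ?_
      have he : e ∈ r.edges := by simpa using he
      by_cases h : e ∈ P.1.edges
      · split_ifs with hh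
        · exact le_of_eq (hsep.separable _ _ _ _ e ((uB P ⟨r, hr⟩ e h he).trans (uB P Q e h hh.2).symm) 1)
        · linarith [uPQ P ⟨r, hr⟩ e h he, hsep.nonneg P ⟨r, hr⟩ 0 e]
      · simp [h, uQ P ⟨r, hr⟩ e h he]

/-- a trail all of whose crossing edges are equal to `e` -/
theorem trail_cross {G : SimpleGraph V} {y z : V} (p : G.Walk y z) (hp : p.IsTrail) (S : V → Prop)
    {a b : V} (hab : ¬ (S a ↔ S b))
    (h : ∀ r t, s(r, t) ∈ p.edges → (S r ↔ S t) ∨ s(r, t) = s(a, b)) :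
    s(a, b) ∈ p.edges ↔ ¬ (S y ↔ S z) := by
  induction p with
  | nil => simp
  | @cons y y' z hadj p ih =>
    rw [Walk.isTrail_cons] at hp
    have ih := ih hp.1 (fun r t hrt => h r t (by simp [hrt]))
    rw [Walk.edges_cons, List.mem_cons]
    by_cases he : s(y, y') = s(a, b)
    · have h1 : ¬ (S y ↔ S y') := by
        rcases Sym2.eq_iff.1 he with ⟨rfl, rfl⟩ | ⟨rfl, rfl⟩ <;> tauto
      have h2 : s(a, b) ∉ p.edges := he ▸ hp.2
      have h3 : S y' ↔ S z := by
        by_contra hh; exact h2 (ih.2 hh)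
      simp only [he, true_or, true_iff]
      tauto
    · have := (h y y' (by simp)).resolve_right he
      have h4 : ¬ s(a, b) = s(y, y') := fun h => he h.symm
      simp only [h4, false_or, ih, this]

theorem walk_cross {G : SimpleGraph V} {y z : V} (p : G.Walk y z) (S : V → Prop) (h : ¬ (S y ↔ S z)) :
    ∃ r t, s(r, t) ∈ p.edges ∧ ¬ (S r ↔ S t) := by
  induction p with
  | nil => simp at h
  | @cons y y' z hadj p ih =>
    by_cases h1 : S y ↔ S y'
    · obtain ⟨r, t, h2, h3⟩ := ih (by tauto)
      exact ⟨r, t, by simp [h2], h3⟩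
    · exact ⟨y, y', by simp, h1⟩

/-- A finite model of the bad configuration. -/
structure Model (N ι : Type) [DecidableEq N] [DecidableEq ι] [Fintype ι] where
  l1 : ι → N
  l2 : ι → N
  k : ι → ℕ
  (A B C D : N)
  Iu : Finset ι
  Il : Finset ι
  cut : ι → N → Bool
  hne : ∀ i, l1 i ≠ l2 i
  hinj : ∀ i j, s(l1 i, l2 i) = s(l1 j, l2 j) → i = j
  hfin : ∀ I : Finset ι, (∀ T : N → Bool, (T A ≠ T B ∨ T C ≠ T D) → ∃ i ∈ I, T (l1 i) ≠ T (l2 i)) →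
    ∑ i ∈ I, k i ≤ ∑ i ∈ Iu ∪ Il, k i → I = Iu ∪ Il
  hcut : ∀ i ∈ Iu ∪ Il, ∀ j ∈ Iu ∪ Il, cut i (l1 j) ≠ cut i (l2 j) ↔ i = j
  hcutu : ∀ i ∈ Iu ∪ Il, i ∈ Iu ↔ cut i A ≠ cut i B
  hcutl : ∀ i ∈ Iu ∪ Il, i ∈ Il ↔ cut i C ≠ cut i D

/-- transfer from the model to the graph -/
theorem Model.core {N ι : Type} [DecidableEq N] [DecidableEq ι] [Fintype ι] (Mo : Model N ι)
    {G : SimpleGraph V} {u v w x : V} (φ : V → N) (hu : φ u = Mo.A) (hv : φ v = Mo.B) (hw : φ w = Mo.C)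
    (hx : φ x = Mo.D) (f1 f2 : ι → V) (hf1 : ∀ i, φ (f1 i) = Mo.l1 i) (hf2 : ∀ i, φ (f2 i) = Mo.l2 i)
    (S : Set (Sym2 V)) (hS : ∀ y z, s(y, z) ∈ S → φ y = φ z)
    (p0 : G.Walk u v) (hp0 : ∀ e ∈ p0.edges, e ∈ S ∨ ∃ i ∈ Mo.Iu, e = s(f1 i, f2 i))
    (q0 : G.Walk w x) (hq0 : ∀ e ∈ q0.edges, e ∈ S ∨ ∃ i ∈ Mo.Il, e = s(f1 i, f2 i))
    (heff : ∀ c : Sym2 V → ℝ, (∀ e, 0 ≤ c e) → EffP G u v w x c) :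
    ∃ g g' : ι → ℝ, (∀ i, 0 ≤ g i ∧ g i ≤ Mo.k i) ∧ (∀ i, 0 ≤ g' i ∧ g' i ≤ Mo.k i) ∧
      (∀ i, i ∈ Mo.Iu → i ∈ Mo.Il → g i + g' i = Mo.k i) ∧
      (∀ i, ¬ (i ∈ Mo.Iu ∧ i ∈ Mo.Il) → g i = Mo.k i ∧ g' i = Mo.k i) ∧
      (∀ (J : Finset ι) (r : G.Walk u v), (∀ e ∈ r.edges, e ∈ S ∨ ∃ i ∈ J, e = s(f1 i, f2 i)) →
        ∑ i ∈ Mo.Iu, g i ≤ ∑ i ∈ J, g i) ∧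
      (∀ (J : Finset ι) (r : G.Walk w x), (∀ e ∈ r.edges, e ∈ S ∨ ∃ i ∈ J, e = s(f1 i, f2 i)) →
        ∑ i ∈ Mo.Il, g' i ≤ ∑ i ∈ J, g' i) := by
  classical
  set E : ι → Sym2 V := fun i => s(f1 i, f2 i) with hE
  have hEinj : Function.Injective E := by
    intro i j hij
    apply Mo.hinj
    rw [← hf1, ← hf1, ← hf2, ← hf2]
    have := congrArg (Sym2.map φ) hij
    simpa [hE] using this
  have hES : ∀ i, E i ∉ S := by
    intro i hi
    have := hS _ _ hi
    rw [hf1, hf2] at this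
    exact Mo.hne i this
  let BIG : ℝ := ∑ i ∈ Mo.Iu ∪ Mo.Il, (Mo.k i : ℝ) + 1
  have hBIG : 0 ≤ BIG := by positivity
  let c : Sym2 V → ℝ := fun e => if h : ∃ i, E i = e then Mo.k h.choose else if e ∈ S then 0 else BIG
  have cE : ∀ i, c (E i) = Mo.k i := by
    intro i
    have h : ∃ i', E i' = E i := ⟨i, rfl⟩
    have h2 := h.choose_spec
    simp only [c, h, dite_true]
    rw [hEinj h2]
  have cS : ∀ e ∈ S, c e = 0 := by
    intro e he
    have h : ¬ ∃ i, E i = e := by rintro ⟨i, rfl⟩; exact hES i he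
    simp [c, h, he]
  have cB : ∀ e, e ∈ S ∨ (∃ i, e = E i) ∨ c e = BIG := by
    intro e
    by_cases h : ∃ i, E i = e
    · obtain ⟨i, rfl⟩ := h; exact Or.inr (Or.inl ⟨i, rfl⟩)
    · by_cases h2 : e ∈ S
      · exact Or.inl h2
      · right; right; simp only [c, h, h2, dite_false, if_false]
  have hc : ∀ e, 0 ≤ c e := by
    intro e
    rcases cB e with h | ⟨i, rfl⟩ | h
    · rw [cS e h]
    · rw [cE]; positivity
    · rw [h]; exact hBIG
  obtain ⟨P, Q, hP, hQ, hopt, ξ, ξ', h1, h2, h3, h4, h5, h6⟩ := heff c hc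
  have hsum : ∀ (h : Sym2 V → ℝ), (∀ e, 0 ≤ h e ∧ h e ≤ c e) → ∀ (X : Finset (Sym2 V)) (J : Finset ι),
      (∀ e ∈ X, e ∈ S ∨ ∃ i ∈ J, e = E i) → ∑ e ∈ X, h e ≤ ∑ i ∈ J, h (E i) := by
    intro h hh X J hX
    rw [← Finset.sum_image (f := h) (fun i _ j _ hij => hEinj hij)]
    rw [← Finset.sum_filter_add_sum_filter_not X (fun e => e ∈ S)]
    have z : ∑ e ∈ X with e ∈ S, h e = 0 := by
      apply Finset.sum_eq_zero
      intro e he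
      have := cS e (Finset.mem_filter.1 he).2
      linarith [(hh e).1, (hh e).2]
    rw [z, zero_add]
    refine Finset.sum_le_sum_of_subset_of_nonneg ?_ fun e _ _ => (hh e).1
    intro e he
    obtain ⟨he1, he2⟩ := Finset.mem_filter.1 he
    obtain ⟨i, hi, rfl⟩ := (hX e he1).resolve_left he2
    exact Finset.mem_image_of_mem _ hi
  have hle : ∑ e ∈ (P.edges ++ Q.edges).toFinset, c e ≤ ∑ i ∈ Mo.Iu ∪ Mo.Il, (Mo.k i : ℝ) := by
    refine (hopt p0 q0).trans ?_
    have := hsum c (fun e => ⟨hc e, le_rfl⟩) (p0.edges ++ q0.edges).toFinset (Mo.Iu ∪ Mo.Il) (by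
      intro e he
      simp only [List.mem_toFinset, List.mem_append] at he
      rcases he with he | he
      · rcases hp0 e he with h | ⟨i, hi, rfl⟩
        · exact Or.inl h
        · exact Or.inr ⟨i, by simp [hi], rfl⟩
      · rcases hq0 e he with h | ⟨i, hi, rfl⟩
        · exact Or.inl h
        · exact Or.inr ⟨i, by simp [hi], rfl⟩)
    simpa only [cE] using this
  have hPQ : ∀ e ∈ (P.edges ++ Q.edges).toFinset, e ∈ S ∨ ∃ i, e = E i := by
    intro e he
    rcases cB e with h | h | h
    · exact Or.inl h
    · exact Or.inr h
    · have := Finset.single_le_sum (f := c) (fun e _ => hc e) he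
      rw [h] at this
      simp only [BIG] at this
      linarith
  set I : Finset ι := Finset.univ.filter (fun i => E i ∈ (P.edges ++ Q.edges).toFinset) with hI
  have hmemI : ∀ i, i ∈ I ↔ E i ∈ P.edges ∨ E i ∈ Q.edges := by intro i; simp [hI]
  have hIeq : I = Mo.Iu ∪ Mo.Il := by
    apply Mo.hfin
    · intro T hT
      have key : ∀ {y z : V} (p : G.Walk y z), (∀ e ∈ p.edges, e ∈ (P.edges ++ Q.edges).toFinset) →
          T (φ y) ≠ T (φ z) → ∃ i ∈ I, T (Mo.l1 i) ≠ T (Mo.l2 i) := by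
        intro y z p hp hT
        obtain ⟨r, t, hrt, hne⟩ := walk_cross p (fun y => T (φ y) = true) (by
          intro h; exact hT (Bool.eq_iff_iff.2 h))
        have hne : T (φ r) ≠ T (φ t) := fun h => hne (Bool.eq_iff_iff.1 h)
        rcases hPQ _ (hp _ hrt) with h | ⟨i, hi⟩
        · exact (hne (by rw [hS _ _ h])).elim
        · refine ⟨i, by rw [hI, Finset.mem_filter]; exact ⟨Finset.mem_univ _, hi ▸ hp _ hrt⟩, ?_⟩
          rw [← hf1, ← hf2]
          rcases Sym2.eq_iff.1 hi with ⟨rfl, rfl⟩ | ⟨rfl, rfl⟩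
          · exact hne
          · exact hne.symm
      rcases hT with hT | hT
      · exact key P (fun e he => by simp [he]) (by rwa [hu, hv])
      · exact key Q (fun e he => by simp [he]) (by rwa [hw, hx])
    · have : ∑ i ∈ I, (Mo.k i : ℝ) ≤ ∑ i ∈ Mo.Iu ∪ Mo.Il, (Mo.k i : ℝ) := by
        refine le_trans ?_ hle
        have e1 : ∑ i ∈ I, (Mo.k i : ℝ) = ∑ e ∈ I.image E, c e := by
          rw [Finset.sum_image (fun i _ j _ hij => hEinj hij)]
          exact Finset.sum_congr rfl fun i _ => (cE i).symm
        rw [e1]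
        refine Finset.sum_le_sum_of_subset_of_nonneg ?_ fun e _ _ => hc e
        intro e he
        obtain ⟨i, hi, rfl⟩ := Finset.mem_image.1 he
        exact (Finset.mem_filter.1 hi).2
      exact_mod_cast this
  have cross : ∀ {y z : V} (p : G.Walk y z), p.IsPath → (∀ e ∈ p.edges, e ∈ (P.edges ++ Q.edges).toFinset) →
      ∀ i ∈ Mo.Iu ∪ Mo.Il, (E i ∈ p.edges ↔ Mo.cut i (φ y) ≠ Mo.cut i (φ z)) := by
    intro y z p hp hpe i hi
    have := trail_cross p hp.isTrail (fun y => Mo.cut i (φ y) = true) (a := f1 i) (b := f2 i) (by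
      rw [hf1, hf2, ← Bool.eq_iff_iff]
      exact (Mo.hcut i hi i hi).2 rfl) (by
      intro r t hrt
      rcases hPQ _ (hpe _ hrt) with h | ⟨j, hj⟩
      · left; rw [hS _ _ h]
      · have hjI : j ∈ Mo.Iu ∪ Mo.Il := by
          rw [← hIeq, hI, Finset.mem_filter]; exact ⟨Finset.mem_univ _, hj ▸ hpe _ hrt⟩
        by_cases hij : i = j
        · right; rw [hj, hij]
        · left
          have h7 : ¬ (Mo.cut i (Mo.l1 j) ≠ Mo.cut i (Mo.l2 j)) := fun h => hij ((Mo.hcut i hi j hjI).1 h)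
          push Not at h7
          rw [← hf1, ← hf2] at h7
          rcases Sym2.eq_iff.1 hj with ⟨rfl, rfl⟩ | ⟨rfl, rfl⟩
          · rw [h7]
          · rw [h7])
    rw [← Bool.eq_iff_iff] at this
    exact this
  have memP : ∀ i, E i ∈ P.edges ↔ i ∈ Mo.Iu := by
    intro i
    by_cases hi : i ∈ Mo.Iu ∪ Mo.Il
    · rw [cross P hP (fun e he => by simp [he]) i hi, hu, hv, Mo.hcutu i hi]
    · have h7 : ¬ (E i ∈ P.edges ∨ E i ∈ Q.edges) := by rw [← hmemI, hIeq]; exact hi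
      have : i ∉ Mo.Iu := fun h => hi (by simp [h])
      tauto
  have memQ : ∀ i, E i ∈ Q.edges ↔ i ∈ Mo.Il := by
    intro i
    by_cases hi : i ∈ Mo.Iu ∪ Mo.Il
    · rw [cross Q hQ (fun e he => by simp [he]) i hi, hw, hx, Mo.hcutl i hi]
    · have h7 : ¬ (E i ∈ P.edges ∨ E i ∈ Q.edges) := by rw [← hmemI, hIeq]; exact hi
      have : i ∉ Mo.Il := fun h => hi (by simp [h])
      tauto
  have dev : ∀ {y z : V} (R : G.Walk y z) (hR : R.IsPath) (K : Finset ι) (hK : ∀ i ∈ K, E i ∈ R.edges)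
      (ζ : Sym2 V → ℝ) (hζ : ∀ e, 0 ≤ ζ e ∧ ζ e ≤ c e) (hmin : ∀ r : G.Walk y z, r.IsPath → wc ζ R ≤ wc ζ r)
      (J : Finset ι) (r : G.Walk y z) (hr : ∀ e ∈ r.edges, e ∈ S ∨ ∃ i ∈ J, e = E i),
      ∑ i ∈ K, ζ (E i) ≤ ∑ i ∈ J, ζ (E i) := by
    intro y z R hR K hK ζ hζ hmin J r hr
    have e1 : ∑ i ∈ K, ζ (E i) ≤ wc ζ R := by
      rw [← sum_edges_eq_wc _ _ hR, ← Finset.sum_image (f := ζ) (fun i _ j _ hij => hEinj hij)]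
      refine Finset.sum_le_sum_of_subset_of_nonneg ?_ fun e _ _ => (hζ e).1
      intro e he
      obtain ⟨i, hi, rfl⟩ := Finset.mem_image.1 he
      simpa using hK i hi
    refine e1.trans ((hmin _ r.bypass_isPath).trans ?_)
    rw [← sum_edges_eq_wc _ _ r.bypass_isPath]
    apply hsum ζ hζ
    intro e he
    exact hr e (r.edges_bypass_subset_edges (by simpa using he))
  refine ⟨fun i => ξ (E i), fun i => ξ' (E i), fun i => by rw [← cE i]; exact h1 _,
    fun i => by rw [← cE i]; exact h2 _, fun i hi hi' => ?_, fun i hi => ?_, fun J r hr => ?_, fun J r hr => ?_⟩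
  · rw [← cE i]; exact h3 _ ((memP i).2 hi) ((memQ i).2 hi')
  · rw [← cE i]; exact h4 _ (by rw [memP, memQ]; exact hi)
  · exact dev P hP _ (fun i hi => (memP i).2 hi) ξ h1 h5 J r hr
  · exact dev Q hQ _ (fun i hi => (memQ i).2 hi) ξ' h2 h6 J r hr

end NDG

namespace NDG
variable {V : Type*} [DecidableEq V]
set_option linter.unusedSectionVars false
open SimpleGraph

set_option synthInstance.maxSize 100000 in
set_option synthInstance.maxHeartbeats 4000000 in
set_option maxRecDepth 40000 in
theorem model1_opt : ∀ m1 m2 m3 r l s e1 e2 e3 : Bool,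
    (r || e1) → (l || e2) → (s || e3) → (m3 || e1 || e3) → (m3 || s || e1) → (m3 || r || e3) →
    (m1 || r || e2) → (m1 || e1 || e2) → (m1 || l || e1) → (m1 || m2 || s) → (m2 || e1 || e2 || e3) →
    ((if m1 then 100 else 0) + (if m2 then 4 else 0) + (if m3 then 100 else 0) + (if r then 10000 else 0)
      + (if l then 10000 else 0) + (if s then 10000 else 0) + (if e1 then 10037 else 0)
      + (if e2 then 10080 else 0) + (if e3 then 10085 else 0) ≤ 30204) →
    m1 ∧ m2 ∧ m3 ∧ r ∧ l ∧ s ∧ !e1 ∧ !e2 ∧ !e3 := by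
  decide +kernel

set_option synthInstance.maxSize 100000 in
set_option synthInstance.maxHeartbeats 4000000 in
set_option maxRecDepth 40000 in
theorem model2_opt : ∀ m1 m2 m3 r l s x1 y1 x2 y2 e3 : Bool,
    (s || e3) → (l || x2) → (r || y1) → (m3 || r || e3) → (m3 || y1 || e3) → (m1 || r || y2) →
    (m1 || y1 || y2) → (m3 || s || y1) → (m1 || x1 || x2) → (m1 || l || x1) → (r || x1 || x2 || y2) →
    (r || l || x1 || y2) → (m1 || m2 || s) → (l || x1 || y1 || y2) → (m2 || y1 || y2 || e3) →
    ((if m1 then 100 else 0) + (if m2 then 4 else 0) + (if m3 then 100 else 0) + (if r then 10000 else 0)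
      + (if l then 10000 else 0) + (if s then 10000 else 0) + (if x1 then 60 else 0)
      + (if y1 then 9977 else 0) + (if x2 then 10000 else 0) + (if y2 then 80 else 0)
      + (if e3 then 10085 else 0) ≤ 30204) →
    m1 ∧ m2 ∧ m3 ∧ r ∧ l ∧ s ∧ !x1 ∧ !y1 ∧ !x2 ∧ !y2 ∧ !e3 := by
  decide +kernel

theorem cutTransfer {N ι : Type} [DecidableEq N] [DecidableEq ι] {l1 l2 : ι → N} {A B C D : N}
    {I : Finset ι} (hI : ∀ T : N → Bool, (T A ≠ T B ∨ T C ≠ T D) → ∃ i ∈ I, T (l1 i) ≠ T (l2 i))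
    (T : Finset N) (J : Finset ι)
    (h1 : decide (A ∈ T) ≠ decide (B ∈ T) ∨ decide (C ∈ T) ≠ decide (D ∈ T))
    (h2 : ∀ i, decide (l1 i ∈ T) ≠ decide (l2 i ∈ T) → i ∈ J) : ∃ i ∈ J, i ∈ I := by
  obtain ⟨i, hi, h⟩ := hI (fun n => decide (n ∈ T)) h1
  exact ⟨i, h2 i h, hi⟩

theorem sum_eq_sum_ite {ι : Type} [DecidableEq ι] [Fintype ι] (I : Finset ι) (k : ι → ℕ) :
    ∑ i ∈ I, k i = ∑ i, if i ∈ I then k i else 0 := by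
  simp

/-- first model; nodes A B C D V W X; edges m1 m2 m3 r l s e1 e2 e3 -/
def model1 : Model (Fin 7) (Fin 9) where
  l1 := ![0, 1, 2, 3, 5, 3, 0, 5, 1]
  l2 := ![1, 2, 3, 4, 0, 6, 4, 2, 6]
  k := ![100, 4, 100, 10000, 10000, 10000, 10037, 10080, 10085]
  A := 0
  B := 4
  C := 5
  D := 6
  Iu := {0, 1, 2, 3}
  Il := {4, 0, 1, 2, 5}
  cut := ![fun n => n = 0 ∨ n = 5, fun n => n = 0 ∨ n = 5 ∨ n = 1, fun n => n = 0 ∨ n = 5 ∨ n = 1 ∨ n = 2,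
    fun n => n = 4, fun n => n = 5, fun n => n = 6, fun _ => true, fun _ => true, fun _ => true]
  hne := by decide
  hinj := by decide
  hcut := by decide
  hcutu := by decide
  hcutl := by decide
  hfin := by
    intro I hI hk
    have c (T : Finset (Fin 7)) (J : Finset (Fin 9)) h1 h2 := cutTransfer hI T J h1 h2
    have c1 := c {4} {3, 6} (by decide) (by decide)
    have c2 := c {5} {4, 7} (by decide) (by decide)
    have c3 := c {6} {5, 8} (by decide) (by decide)
    have c4 := c {3, 4, 6} {2, 6, 8} (by decide) (by decide)
    have c5 := c {3, 4} {2, 5, 6} (by decide) (by decide)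
    have c6 := c {3, 6} {2, 3, 8} (by decide) (by decide)
    have c7 := c {1, 2, 3, 6} {0, 3, 7} (by decide) (by decide)
    have c8 := c {1, 2, 3, 4, 6} {0, 6, 7} (by decide) (by decide)
    have c9 := c {1, 2, 3, 4, 5, 6} {0, 4, 6} (by decide) (by decide)
    have c10 := c {1, 6} {0, 1, 5} (by decide) (by decide)
    have c11 := c {2, 3, 4, 6} {1, 6, 7, 8} (by decide) (by decide)
    simp only [Finset.exists_mem_insert, Finset.mem_singleton, exists_eq_left] at c1 c2 c3 c4 c5 c6 c7 c8 c9 c10 c11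
    rw [sum_eq_sum_ite] at hk
    simp only [Fin.sum_univ_succ] at hk
    have hb := model1_opt (decide (0 ∈ I)) (decide (1 ∈ I)) (decide (2 ∈ I)) (decide (3 ∈ I)) (decide (4 ∈ I)) (decide (5 ∈ I)) (decide (6 ∈ I)) (decide (7 ∈ I)) (decide (8 ∈ I))
    simp only [Bool.or_eq_true, decide_eq_true_eq, Bool.not_eq_true', decide_eq_false_iff_not, or_assoc] at hb
    have hb := hb c1 c2 c3 c4 c5 c6 c7 c8 c9 c10 c11 (by simpa [add_assoc] using hk)
    ext i
    fin_cases i <;> simp [hb]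

/-- second model; nodes A B C D V W X H; edges m1 m2 m3 r l s x1 y1 x2 y2 e3 -/
def model2 : Model (Fin 8) (Fin 11) where
  l1 := ![0, 1, 2, 3, 5, 3, 0, 7, 5, 7, 1]
  l2 := ![1, 2, 3, 4, 0, 6, 7, 4, 7, 2, 6]
  k := ![100, 4, 100, 10000, 10000, 10000, 60, 9977, 10000, 80, 10085]
  A := 0
  B := 4
  C := 5
  D := 6
  Iu := {0, 1, 2, 3}
  Il := {4, 0, 1, 2, 5}
  cut := ![fun n => n = 0 ∨ n = 5, fun n => n = 0 ∨ n = 5 ∨ n = 1, fun n => n = 0 ∨ n = 5 ∨ n = 1 ∨ n = 2,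
    fun n => n = 4, fun n => n = 5, fun n => n = 6, fun _ => true, fun _ => true, fun _ => true, fun _ => true,
    fun _ => true]
  hne := by decide
  hinj := by decide
  hcut := by decide
  hcutu := by decide
  hcutl := by decide
  hfin := by
    intro I hI hk
    have c (T : Finset (Fin 8)) (J : Finset (Fin 11)) h1 h2 := cutTransfer hI T J h1 h2
    have c1 := c {6} {5, 10} (by decide) (by decide)
    have c2 := c {5} {4, 8} (by decide) (by decide)
    have c3 := c {4} {3, 7} (by decide) (by decide)
    have c4 := c {3, 6} {2, 3, 10} (by decide) (by decide)
    have c5 := c {3, 4, 6} {2, 7, 10} (by decide) (by decide)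
    have c6 := c {1, 2, 3, 6} {0, 3, 9} (by decide) (by decide)
    have c7 := c {1, 2, 3, 4, 6} {0, 7, 9} (by decide) (by decide)
    have c8 := c {3, 4} {2, 5, 7} (by decide) (by decide)
    have c9 := c {1, 2, 3, 4, 6, 7} {0, 6, 8} (by decide) (by decide)
    have c10 := c {1, 2, 3, 4, 5, 6, 7} {0, 4, 6} (by decide) (by decide)
    have c11 := c {4, 7} {3, 6, 8, 9} (by decide) (by decide)
    have c12 := c {4, 5, 7} {3, 4, 6, 9} (by decide) (by decide)
    have c13 := c {1, 6} {0, 1, 5} (by decide) (by decide)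
    have c14 := c {5, 7} {4, 6, 7, 9} (by decide) (by decide)
    have c15 := c {2, 3, 4, 6} {1, 7, 9, 10} (by decide) (by decide)
    simp only [Finset.exists_mem_insert, Finset.mem_singleton, exists_eq_left] at c1 c2 c3 c4 c5 c6 c7 c8 c9 c10 c11 c12 c13 c14 c15
    rw [sum_eq_sum_ite] at hk
    simp only [Fin.sum_univ_succ] at hk
    have hb := model2_opt (decide (0 ∈ I)) (decide (1 ∈ I)) (decide (2 ∈ I)) (decide (3 ∈ I)) (decide (4 ∈ I)) (decide (5 ∈ I)) (decide (6 ∈ I)) (decide (7 ∈ I)) (decide (8 ∈ I)) (decide (9 ∈ I)) (decide (10 ∈ I))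
    simp only [Bool.or_eq_true, decide_eq_true_eq, Bool.not_eq_true', decide_eq_false_iff_not, or_assoc] at hb
    have hb := hb c1 c2 c3 c4 c5 c6 c7 c8 c9 c10 c11 c12 c13 c14 c15 (by simpa [add_assoc] using hk)
    ext i
    fin_cases i <;> simp [hb]

theorem model1_false {G : SimpleGraph V} {u v w x : V} (φ : V → Fin 7) (hu : φ u = 0) (hv : φ v = 4)
    (hw : φ w = 5) (hx : φ x = 6) (f1 f2 : Fin 9 → V)
    (hf1 : ∀ i, φ (f1 i) = model1.l1 i) (hf2 : ∀ i, φ (f2 i) = model1.l2 i)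
    (S : Set (Sym2 V)) (hS : ∀ y z, s(y, z) ∈ S → φ y = φ z)
    (p0 : G.Walk u v) (hp0 : ∀ e ∈ p0.edges, e ∈ S ∨ ∃ i ∈ ({0, 1, 2, 3} : Finset (Fin 9)), e = s(f1 i, f2 i))
    (q0 : G.Walk w x)
    (hq0 : ∀ e ∈ q0.edges, e ∈ S ∨ ∃ i ∈ ({4, 0, 1, 2, 5} : Finset (Fin 9)), e = s(f1 i, f2 i))
    (r1 : G.Walk u v) (hr1 : ∀ e ∈ r1.edges, e ∈ S ∨ ∃ i ∈ ({6} : Finset (Fin 9)), e = s(f1 i, f2 i))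
    (r2 : G.Walk w x) (hr2 : ∀ e ∈ r2.edges, e ∈ S ∨ ∃ i ∈ ({7, 2, 5} : Finset (Fin 9)), e = s(f1 i, f2 i))
    (r3 : G.Walk w x) (hr3 : ∀ e ∈ r3.edges, e ∈ S ∨ ∃ i ∈ ({4, 0, 8} : Finset (Fin 9)), e = s(f1 i, f2 i))
    (heff : ∀ c : Sym2 V → ℝ, (∀ e, 0 ≤ c e) → EffP G u v w x c) : False := by
  obtain ⟨g, g', h1, h2, h3, h4, h5, h6⟩ :=
    model1.core φ hu hv hw hx f1 f2 hf1 hf2 S hS p0 hp0 q0 hq0 heff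
  have h5 := h5 _ r1 hr1
  have h6' := h6 _ r3 hr3
  have h6 := h6 _ r2 hr2
  have a0 := h3 0 (by decide) (by decide)
  have a1 := h3 1 (by decide) (by decide)
  have a2 := h3 2 (by decide) (by decide)
  have b (i : Fin 9) (hi : ¬ (i ∈ model1.Iu ∧ i ∈ model1.Il)) := h4 i hi
  have b3 := b 3 (by decide)
  have b4 := b 4 (by decide)
  have b5 := b 5 (by decide)
  have b6 := b 6 (by decide)
  have b7 := b 7 (by decide)
  have b8 := b 8 (by decide)
  simp [model1] at h5 h6 h6' a0 a1 a2 b3 b4 b5 b6 b7 b8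
  linarith [h1 1, h2 1, b3.1, b3.2, b4.1, b4.2, b5.1, b5.2, b6.1, b6.2, b7.1, b7.2, b8.1, b8.2]

theorem model2_false {G : SimpleGraph V} {u v w x : V} (φ : V → Fin 8) (hu : φ u = 0) (hv : φ v = 4)
    (hw : φ w = 5) (hx : φ x = 6) (f1 f2 : Fin 11 → V)
    (hf1 : ∀ i, φ (f1 i) = model2.l1 i) (hf2 : ∀ i, φ (f2 i) = model2.l2 i)
    (S : Set (Sym2 V)) (hS : ∀ y z, s(y, z) ∈ S → φ y = φ z)
    (p0 : G.Walk u v) (hp0 : ∀ e ∈ p0.edges, e ∈ S ∨ ∃ i ∈ ({0, 1, 2, 3} : Finset (Fin 11)), e = s(f1 i, f2 i))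
    (q0 : G.Walk w x)
    (hq0 : ∀ e ∈ q0.edges, e ∈ S ∨ ∃ i ∈ ({4, 0, 1, 2, 5} : Finset (Fin 11)), e = s(f1 i, f2 i))
    (r1 : G.Walk u v) (hr1 : ∀ e ∈ r1.edges, e ∈ S ∨ ∃ i ∈ ({6, 7} : Finset (Fin 11)), e = s(f1 i, f2 i))
    (r2 : G.Walk w x) (hr2 : ∀ e ∈ r2.edges, e ∈ S ∨ ∃ i ∈ ({8, 9, 2, 5} : Finset (Fin 11)), e = s(f1 i, f2 i))
    (r3 : G.Walk w x) (hr3 : ∀ e ∈ r3.edges, e ∈ S ∨ ∃ i ∈ ({4, 0, 10} : Finset (Fin 11)), e = s(f1 i, f2 i))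
    (heff : ∀ c : Sym2 V → ℝ, (∀ e, 0 ≤ c e) → EffP G u v w x c) : False := by
  obtain ⟨g, g', h1, h2, h3, h4, h5, h6⟩ :=
    model2.core φ hu hv hw hx f1 f2 hf1 hf2 S hS p0 hp0 q0 hq0 heff
  have h5 := h5 _ r1 hr1
  have h6' := h6 _ r3 hr3
  have h6 := h6 _ r2 hr2
  have a0 := h3 0 (by decide) (by decide)
  have a1 := h3 1 (by decide) (by decide)
  have a2 := h3 2 (by decide) (by decide)
  have b (i : Fin 11) (hi : ¬ (i ∈ model2.Iu ∧ i ∈ model2.Il)) := h4 i hi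
  have b3 := b 3 (by decide)
  have b4 := b 4 (by decide)
  have b5 := b 5 (by decide)
  have b6 := b 6 (by decide)
  have b7 := b 7 (by decide)
  have b8 := b 8 (by decide)
  have b9 := b 9 (by decide)
  have b10 := b 10 (by decide)
  simp [model2] at h5 h6 h6' a0 a1 a2 b3 b4 b5 b6 b7 b8 b9 b10
  linarith [h1 1, h2 1, b3.1, b3.2, b4.1, b4.2, b5.1, b5.2, b6.1, b6.2, b7.1, b7.2, b8.1, b8.2, b9.1, b9.2, b10.1, b10.2]

end NDG

namespace NDG
variable {V : Type*} [DecidableEq V]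
set_option linter.unusedSectionVars false
open SimpleGraph
variable {G : SimpleGraph V}

theorem prefix_split {a b c : V} (S : G.Walk a b) (P : G.Walk a c) (h : S.darts <+: P.darts) :
    ∃ Y : G.Walk b c, P = S.append Y := by
  induction S with
  | nil => exact ⟨P, rfl⟩
  | @cons a a' b hadj S ih =>
    cases P with
    | nil => simp at h
    | @cons _ a'' _ hadj' P =>
      simp only [Walk.darts_cons, List.cons_prefix_cons] at h
      obtain ⟨h1, h2⟩ := h
      have : a' = a'' := congrArg (fun d => d.toProd.2) h1
      subst this
      obtain ⟨Y, rfl⟩ := ih P h2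
      exact ⟨Y, rfl⟩

theorem infix_split {a b u v : V} (S : G.Walk a b) (P : G.Walk u v) (hS : S.edges ≠ [])
    (h : S.darts <:+: P.darts) : ∃ (X : G.Walk u a) (Y : G.Walk b v), P = (X.append S).append Y := by
  induction P with
  | nil =>
    have h1 : S.darts = [] := by simpa using h
    exact (hS (by simp [Walk.edges, h1])).elim
  | @cons u u' v hadj P ih =>
    rw [Walk.darts_cons, List.infix_cons_iff] at h
    rcases h with h | h
    · cases S with
      | nil => simp at hS
      | @cons _ a' _ hadj' S =>
        rw [Walk.darts_cons, List.cons_prefix_cons] at h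
        obtain ⟨h1, h2⟩ := h
        have e1 : a = u := congrArg (fun d => d.toProd.1) h1
        have e2 : a' = u' := congrArg (fun d => d.toProd.2) h1
        subst e1
        subst e2
        obtain ⟨Y, rfl⟩ := prefix_split S P h2
        exact ⟨Walk.nil, Y, rfl⟩
    · obtain ⟨X, Y, rfl⟩ := ih h
      exact ⟨Walk.cons hadj X, Y, rfl⟩

theorem append_split {u c d v : V} (A : G.Walk u c) (B : G.Walk c v) (X : G.Walk u d) (Y : G.Walk d v)
    (h : A.append B = X.append Y) :
    (∃ Z : G.Walk c d, X = A.append Z ∧ B = Z.append Y) ∨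
      (∃ Z : G.Walk d c, A = X.append Z ∧ Y = Z.append B) := by
  induction A with
  | nil => exact Or.inl ⟨X, rfl, h⟩
  | @cons u u' c hadj A ih =>
    cases X with
    | nil => exact Or.inr ⟨Walk.cons hadj A, rfl, h.symm⟩
    | @cons _ u'' _ hadj' X =>
      simp only [Walk.cons_append, Walk.cons.injEq] at h
      obtain ⟨rfl, h⟩ := h
      have h := eq_of_heq h
      rcases ih B X h with ⟨Z, rfl, rfl⟩ | ⟨Z, rfl, rfl⟩
      · exact Or.inl ⟨Z, rfl, rfl⟩
      · exact Or.inr ⟨Z, rfl, rfl⟩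

theorem exists_cons_of {a b : V} (p : G.Walk a b) (h : p.edges ≠ []) :
    ∃ (c : V) (hc : G.Adj a c) (q : G.Walk c b), p = Walk.cons hc q := by
  cases p with
  | nil => simp at h
  | cons hc q => exact ⟨_, hc, q, rfl⟩

theorem exists_concat_of {a b : V} (p : G.Walk a b) (h : p.edges ≠ []) :
    ∃ (c : V) (q : G.Walk a c) (hc : G.Adj c b), p = q.append (Walk.cons hc Walk.nil) := by
  induction p with
  | nil => simp at h
  | @cons a a' b hadj p ih =>
    by_cases hp : p.edges = []
    · cases p with
      | nil => exact ⟨a, Walk.nil, hadj, rfl⟩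
      | cons => simp at hp
    · obtain ⟨c, q, hc, rfl⟩ := ih hp
      exact ⟨c, Walk.cons hadj q, hc, rfl⟩

theorem append_edge_disj {a b c : V} {p : G.Walk a b} {q : G.Walk b c} (h : (p.append q).IsPath) {e : Sym2 V}
    (h1 : e ∈ p.edges) (h2 : e ∈ q.edges) : False := by
  have := h.isTrail.edges_nodup
  rw [Walk.edges_append, List.nodup_append] at this
  exact this.2.2 e h1 e h2 rfl

theorem nil_of_edges {a b : V} {p : G.Walk a b} (h : p.edges = []) : a = b := by
  cases p with
  | nil => rfl
  | cons => simp at h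

theorem split_left {w a b x c d : V} {L : G.Walk w a} {M : G.Walk a b} {R : G.Walk b x} {X : G.Walk w c}
    {S : G.Walk c d} {Y : G.Walk d x} (h : (L.append M).append R = (X.append S).append Y)
    (hp : ((L.append M).append R).IsPath) (h1 : ∃ e ∈ S.edges, e ∈ L.edges) (h2 : ∃ e ∈ S.edges, e ∈ M.edges)
    (h3 : ∃ e ∈ M.edges, e ∉ S.edges) :
    ∃ (Z : G.Walk c a) (N : G.Walk a d) (Y' : G.Walk d b), L = X.append Z ∧ M = N.append Y' ∧
      S = Z.append N ∧ Z.edges ≠ [] ∧ Y'.edges ≠ [] := by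
  obtain ⟨e1, h1, h1'⟩ := h1
  obtain ⟨e2, h2, h2'⟩ := h2
  obtain ⟨e3, h3, h3'⟩ := h3
  rw [← Walk.append_assoc, ← Walk.append_assoc] at h
  rw [← Walk.append_assoc] at hp
  rcases append_split _ _ _ _ h with ⟨Z, rfl, hZ⟩ | ⟨Z, rfl, hZ⟩
  · exact (append_edge_disj hp h1' (by rw [hZ]; simp [h1])).elim
  rcases append_split _ _ _ _ hZ with ⟨Z', rfl, hZ'⟩ | ⟨Z', rfl, hZ'⟩
  · exact (append_edge_disj hp (e := e2) (by simp [h2]) (by simp [h2'])).elim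
  rcases append_split _ _ _ _ hZ' with ⟨Y', rfl, rfl⟩ | ⟨Y', rfl, rfl⟩
  · exact (h3' (by simp [h3])).elim
  refine ⟨Z, Z', Y', rfl, rfl, rfl, ?_, ?_⟩
  · intro h0
    simp only [Walk.edges_append, h0, List.nil_append] at h1
    exact append_edge_disj hp h1' (by simp [h1])
  · intro h0
    simp only [Walk.edges_append, h0, List.append_nil] at h3
    exact h3' (by simp [h3])

theorem split_right {w a b x c d : V} {L : G.Walk w a} {M : G.Walk a b} {R : G.Walk b x} {X : G.Walk w c}
    {S : G.Walk c d} {Y : G.Walk d x} (h : (L.append M).append R = (X.append S).append Y)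
    (hp : ((L.append M).append R).IsPath) (h1 : ∃ e ∈ S.edges, e ∈ R.edges) (h2 : ∃ e ∈ S.edges, e ∈ M.edges) :
    ∃ (Z : G.Walk c b) (W : G.Walk b d), L.append M = X.append Z ∧ R = W.append Y ∧
      S = Z.append W ∧ W.edges ≠ [] := by
  obtain ⟨e1, h1, h1'⟩ := h1
  obtain ⟨e2, h2, h2'⟩ := h2
  rcases append_split _ _ _ _ h with ⟨W, hW, rfl⟩ | ⟨W, hW, rfl⟩
  · rcases append_split _ _ _ _ hW with ⟨Z, hZ, rfl⟩ | ⟨Z, rfl, rfl⟩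
    on_goal 2 => exact (append_edge_disj hp (e := e2) (by simp [h2']) (by simp [h2])).elim
    · refine ⟨Z, W, hZ, rfl, rfl, ?_⟩
      intro h0
      simp only [Walk.edges_append, h0, List.append_nil] at h1
      exact append_edge_disj hp (e := e1) (by rw [hZ]; simp [h1]) h1'
  · exact (append_edge_disj hp (e := e1) (by rw [hW]; simp [h1]) h1').elim

/-- paths in a forest -/
theorem PBC.meetV {u v w x : V} (B : PBC G u v w x) {y : V} (h1 : y ∈ B.Pu.support) (h2 : y ∈ B.Pl.support) :
    y ∈ B.M.support := by
  revert h1 h2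
  obtain ⟨a, b, Lu, M, Ru, Ll, Rl, hM_ne, hPu, hPl, hforest, hmeet, -⟩ := B
  simp only [PBC.Pu, PBC.Pl]
  intro h1 h2
  have eM : ∃ e, e ∈ M.edges := List.exists_mem_of_ne_nil _ hM_ne
  obtain ⟨e0, he0⟩ := eM
  have hPu' := hPu
  have hPl' := hPl
  rw [← Walk.append_assoc] at hPu' hPl'
  by_contra hy
  have ha : y ≠ a := by rintro rfl; simp at hy
  have hb : y ≠ b := by rintro rfl; simp at hy
  simp only [Walk.mem_support_append_iff, hy, or_false] at h1 h2
  rcases h1 with h1 | h1 <;> rcases h2 with h2 | h2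
  · obtain ⟨p1, p2, rfl⟩ := splitAt _ h1
    obtain ⟨r1, r2, rfl⟩ := splitAt _ h2
    have hp2 := (Walk.IsPath.of_append_left hPu').of_append_right
    have hr2 := (Walk.IsPath.of_append_left hPl').of_append_right
    have := path_unique_of hforest p2 r2 hp2 hr2 (fun e he => by simp [he]) (fun e he => by simp [he])
    subst this
    refine ha (nil_of_edges (List.eq_nil_iff_forall_not_mem.2 fun e he => ?_ : p2.edges = []))
    exact append_edge_disj hPu' (e := e) (by simp [he])
      (by simp [hmeet e (by simp [he]) (by simp [he])])
  · obtain ⟨p1, p2, rfl⟩ := splitAt _ h1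
    obtain ⟨r1, r2, rfl⟩ := splitAt _ h2
    have hp2 := (Walk.IsPath.of_append_left hPu').of_append_right
    have hr2 : (M.append r1).IsPath := by
      have := hPl'.of_append_right
      rw [Walk.append_assoc] at this
      exact this.of_append_left
    have := path_unique_of hforest p2 (M.append r1).reverse hp2 hr2.reverse (fun e he => by simp [he])
      (fun e he => by simp at he; rcases he with he | he <;> simp [he])
    exact append_edge_disj hPu' (e := e0) (by rw [Walk.edges_append, this]; simp [he0]) (by simp [he0])
  · obtain ⟨p1, p2, rfl⟩ := splitAt _ h1
    obtain ⟨r1, r2, rfl⟩ := splitAt _ h2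
    have hp1 := (Walk.IsPath.of_append_right hPu).of_append_left
    have hr2 : (r2.append M).IsPath := by
      have := hPl.of_append_left
      rw [← Walk.append_assoc] at this
      exact this.of_append_right
    have := path_unique_of hforest p1 (r2.append M).reverse hp1 hr2.reverse (fun e he => by simp [he])
      (fun e he => by simp at he; rcases he with he | he <;> simp [he])
    exact append_edge_disj hPu (e := e0) (by simp [he0]) (by rw [Walk.edges_append, this]; simp [he0])
  · obtain ⟨p1, p2, rfl⟩ := splitAt _ h1
    obtain ⟨r1, r2, rfl⟩ := splitAt _ h2
    have hp1 := (Walk.IsPath.of_append_right hPu).of_append_left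
    have hr1 := (Walk.IsPath.of_append_right hPl).of_append_left
    have := path_unique_of hforest p1 r1 hp1 hr1 (fun e he => by simp [he]) (fun e he => by simp [he])
    subst this
    refine hb (nil_of_edges (List.eq_nil_iff_forall_not_mem.2 fun e he => ?_ : p1.edges = [])).symm
    exact append_edge_disj hPu (e := e) (by simp [hmeet e (by simp [he]) (by simp [he])]) (by simp [he])

end NDG

namespace NDG
variable {V : Type*} [DecidableEq V]
set_option linter.unusedSectionVars false
open SimpleGraph
variable {G : SimpleGraph V}

/-- the segments of a preliminary bad configuration -/
structure Seg (G : SimpleGraph V) (u v w x : V) where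
  (a b a1 b1 a2 b2 a3 b3 l m n y r s : V)
  Lu : G.Walk u a
  Ll1 : G.Walk w a2
  hl : G.Adj a2 l
  Ll2 : G.Walk l a
  M1 : G.Walk a m
  hm1 : G.Adj m a3
  hm2 : G.Adj a3 n
  M3 : G.Walk n b2
  hm3 : G.Adj b2 y
  M4 : G.Walk y b
  Ru1 : G.Walk b r
  hr : G.Adj r b1
  Ru2 : G.Walk b1 v
  Rl1 : G.Walk b s
  hs : G.Adj s b3
  Rl2 : G.Walk b3 x
  X : G.Walk u a1
  q1 : G.Walk a1 b1
  q2 : G.Walk a2 b2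
  q3 : G.Walk a3 b3

namespace Seg
variable {u v w x : V} (B : Seg G u v w x)
def M : G.Walk B.a B.b :=
  B.M1.append (Walk.cons B.hm1 (Walk.cons B.hm2 (B.M3.append (Walk.cons B.hm3 B.M4))))
def Ll : G.Walk w B.a := B.Ll1.append (Walk.cons B.hl B.Ll2)
def Ru : G.Walk B.b v := B.Ru1.append (Walk.cons B.hr B.Ru2)
def Rl : G.Walk B.b x := B.Rl1.append (Walk.cons B.hs B.Rl2)
def Pu : G.Walk u v := (B.Lu.append B.M).append B.Ru
def Pl : G.Walk w x := (B.Ll.append B.M).append B.Rl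

end Seg

/-- the properties of the segments that are used -/
structure Cfg (G : SimpleGraph V) (u v w x : V) extends Seg G u v w x where
  hq1 : q1.IsPath
  hq2 : q2.IsPath
  hq3 : q3.IsPath
  nq1 : q1.edges ≠ []
  nq2 : q2.edges ≠ []
  nq3 : q3.edges ≠ []
  pu : toSeg.Pu.IsPath
  pl : toSeg.Pl.IsPath
  hX : ∀ z ∈ X.support, z ∈ Lu.support ∨ z ∈ M1.support
  meet : ∀ z, z ∈ toSeg.Pu.support → z ∈ toSeg.Pl.support → z ∈ toSeg.M.support
  c1 : ∀ z ∈ q1.support, z ∈ toSeg.Pu.support → z = a1 ∨ z = b1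
  c2 : ∀ z ∈ q2.support, z ∈ toSeg.Pl.support → z = a2 ∨ z = b2
  c3 : ∀ z ∈ q3.support, z ∈ toSeg.Pl.support → z = a3 ∨ z = b3
  d13 : ∀ z ∈ q1.support, z ∉ q3.support
  d23 : ∀ z ∈ q2.support, z ∉ q3.support
  av2 : ∀ z ∈ q2.support, z ∉ Lu.support ∧ z ∉ toSeg.Ru.support
  av3 : ∀ z ∈ q3.support, z ∉ Lu.support ∧ z ∉ toSeg.Ru.support
  q1Ll1 : ∀ z ∈ q1.support, z ∉ Ll1.support
  q1Rl : ∀ z ∈ q1.support, z ∉ toSeg.Rl.support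
  iv : ∀ (c : V) (p : G.Walk a1 c) (q : G.Walk c b1), q1 = p.append q → c ∈ q2.support →
    ∀ z ∈ q.support, z ∉ Ll2.support

theorem PBC.toSeg {u v w x : V} (B : PBC G u v w x) : ∃ D : Seg G u v w x, ∃ (h1 : D.a = B.a) (h2 : D.b = B.b)
    (h3 : D.a1 = B.a1) (h4 : D.b1 = B.b1) (h5 : D.a2 = B.a2) (h6 : D.b2 = B.b2) (h7 : D.a3 = B.a3)
    (h8 : D.b3 = B.b3), B.Lu = D.Lu.copy rfl h1 ∧ B.M = D.M.copy h1 h2 ∧ B.Ll = D.Ll.copy rfl h1 ∧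
    B.Ru = D.Ru.copy h2 rfl ∧ B.Rl = D.Rl.copy h2 rfl ∧ B.q1 = D.q1.copy h3 h4 ∧ B.q2 = D.q2.copy h5 h6 ∧
    B.q3 = D.q3.copy h7 h8 ∧ (∀ z ∈ D.X.support, z ∈ D.Lu.support ∨ z ∈ D.M1.support) ∧
    (∀ z ∈ B.S2.support, z ∈ D.Pl.support) ∧ (∀ z ∈ B.S2.support, z ∈ D.Ll1.support → z = D.a2) := by
  obtain ⟨a, b, Lu, M, Ru, Ll, Rl, hM_ne, hPu, hPl, hforest, hmeet, hRu_ne, hLl_ne, hRl_ne,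
    a1, b1, q1, S1, hq1path, hq1_ne, hS1, hq1closes, hC1Ru, hC1M,
    a2, b2, q2, S2, hq2path, hq2_ne, hS2, hq2closes, hC2Ll, hC2M, hMC2,
    a3, b3, q3, S3, hq3path, hq3_ne, hS3, hq3closes, hC3Rl, hC3M, hMC3,
    hC_ne, hC_sub, hC1C2, hC1C3⟩ := B
  have ne : ∀ {y z : V} {p : G.Walk y z} {e : Sym2 V}, e ∈ p.edges → p.edges ≠ [] := by
    intro y z p e he h; simp [h] at he
  obtain ⟨X, Y1, e1⟩ := infix_split S1 _ (ne hC1M.choose_spec.1) hS1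
  obtain ⟨X2, Y2, e2⟩ := infix_split S2 _ (ne hC2M.choose_spec.1) hS2
  obtain ⟨X3, Y3, e3⟩ := infix_split S3 _ (ne hC3M.choose_spec.1) hS3
  obtain ⟨Z2, N2, Y, rfl, eM, rfl, nZ2, nY⟩ := split_left e2 hPl hC2Ll hC2M hMC2
  obtain ⟨N3, W3, e3', rfl, rfl, nW3⟩ := split_right e3 hPl hC3Rl hC3M
  obtain ⟨Z, W1, e1', rfl, rfl, nW1⟩ := split_right e1 hPu hC1Ru hC1M
  have hS2l : ∀ z ∈ (Z2.append N2).support, z ∈ X2.support → z = a2 := by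
    intro z hz hz'
    rw [e2, ← Walk.append_assoc, isPath_append_iff] at hPl
    exact hPl.2.2 z hz' (by rw [Walk.mem_support_append_iff]; exact Or.inl hz)
  have hS2s : ∀ z ∈ (Z2.append N2).support, z ∈ (((X2.append Z2).append M).append (W3.append Y3)).support := by
    intro z hz
    rw [e2]; simp only [Walk.mem_support_append_iff] at hz ⊢; tauto
  have dLM : ∀ e, e ∈ (X2.append Z2).edges → e ∈ M.edges → False :=
    fun e he he' => append_edge_disj hPl.of_append_left he he'
  have dMR : ∀ e, e ∈ M.edges → e ∈ (W3.append Y3).edges → False :=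
    fun e he he' => append_edge_disj hPl (by simp [he]) he'
  have dMRu : ∀ e, e ∈ M.edges → e ∈ (W1.append Y1).edges → False :=
    fun e he he' => append_edge_disj hPu (by simp [he]) he'
  rcases append_split _ _ _ _ e3' with ⟨Z3, rfl, eM3⟩ | ⟨Z3, -, rfl⟩
  swap
  · obtain ⟨e, he, he'⟩ := hMC3
    exact (he' (by simp [he])).elim
  have nZ3 : Z3.edges ≠ [] := by
    obtain ⟨e, he, he'⟩ := hMC3
    intro h0
    rw [eM3] at he
    simp [h0] at he
    exact he' (by simp [he])
  rcases append_split N2 Y Z3 N3 (by rw [← eM, eM3]) with ⟨Q, rfl, rfl⟩ | ⟨N, rfl, rfl⟩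
  · obtain ⟨e, he, he2, he3⟩ := hC_ne
    have hMp := hPl.of_append_left.of_append_right
    rw [eM] at hMp
    have g2 : e ∈ N2.edges := by
      rcases (by simpa using he2 : e ∈ Z2.edges ∨ e ∈ N2.edges) with h | h
      · exact (dLM e (by simp [h]) he).elim
      · exact h
    have g3 : e ∈ N3.edges := by
      rcases (by simpa using he3 : e ∈ N3.edges ∨ e ∈ W3.edges) with h | h
      · exact h
      · exact (dMR e he (by simp [h])).elim
    exact (append_edge_disj hMp g2 (by simp [g3])).elim
  have hMp := hPl.of_append_left.of_append_right
  have nN : N.edges ≠ [] := by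
    obtain ⟨e, he, he2, he3⟩ := hC_ne
    intro h0
    have g2 : e ∈ Z3.edges := by
      rcases (by simpa [h0] using he2 : e ∈ Z2.edges ∨ e ∈ Z3.edges) with h | h
      · exact (dLM e (by simp [h]) he).elim
      · exact h
    have g3 : e ∈ Y.edges := by
      rcases (by simpa [h0] using he3 : e ∈ Y.edges ∨ e ∈ W3.edges) with h | h
      · exact h
      · exact (dMR e he (by simp [h])).elim
    rw [eM] at hMp
    exact append_edge_disj hMp (e := e) (by simp [g2]) g3
  have hXs : ∃ Z6 : G.Walk a1 a3, Lu.append Z3 = X.append Z6 ∧ Z6.edges ≠ [] := by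
    obtain ⟨e, he, he1, he2, he3⟩ := hC1C2
    have hp := hPu.of_append_left
    have heZ : e ∈ Z.edges := by
      rcases (by simpa using he1 : e ∈ Z.edges ∨ e ∈ W1.edges) with h | h
      · exact h
      · exact (dMRu e he (by simp [h])).elim
    rw [eM3, Walk.append_assoc] at e1' hp
    rcases append_split _ _ _ _ e1' with ⟨Z6, rfl, h6⟩ | ⟨Z6, h6, rfl⟩
    · exfalso
      refine he3 ?_
      rw [Walk.edges_append, h6]; simp [heZ]
    · refine ⟨Z6, h6, ?_⟩
      intro h0
      rw [Walk.edges_append, h0, List.nil_append] at heZ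
      exact he3 (by rw [Walk.edges_append]; exact List.mem_append_left _ heZ)
  obtain ⟨Z6, e6, nZ6⟩ := hXs
  have pZ6 : (X.append Z6).IsPath := by
    rw [← e6]
    have := hPu.of_append_left
    rw [eM3, Walk.append_assoc] at this
    exact this.of_append_left
  have ha3X : a3 ∉ X.support := by
    intro h
    obtain ⟨z', hz', Z6', rfl⟩ := exists_cons_of Z6 nZ6
    rw [isPath_append_iff] at pZ6
    have h9 := pZ6.2.2 a3 h (by simp)
    subst h9
    have := pZ6.2.1
    rw [Walk.cons_isPath_iff] at this
    exact this.2 (by simp)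
  obtain ⟨l, hl, Ll2, rfl⟩ := exists_cons_of _ nZ2
  obtain ⟨n, hm2, M3, rfl⟩ := exists_cons_of _ nN
  obtain ⟨y, hm3, M4, rfl⟩ := exists_cons_of _ nY
  obtain ⟨m, M1, hm1, rfl⟩ := exists_concat_of _ nZ3
  obtain ⟨s, Rl1, hs, rfl⟩ := exists_concat_of _ nW3
  obtain ⟨r, Ru1, hr, rfl⟩ := exists_concat_of _ nW1
  refine ⟨⟨a, b, a1, b1, a2, b2, a3, b3, l, m, n, y, r, s, Lu, X2, hl, Ll2, M1, hm1, hm2, M3, hm3, M4, Ru1, hr,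
    Y1, Rl1, hs, Y3, X, q1, q2, q3⟩, rfl, rfl, rfl, rfl, rfl, rfl, rfl, rfl, rfl, ?_, rfl, ?_, ?_, rfl, rfl, rfl,
    ?_, ?_, hS2l⟩
  · simp [Seg.M, eM, ← Walk.append_assoc]
  · simp [Seg.Ru, ← Walk.append_assoc]
  · simp [Seg.Rl, ← Walk.append_assoc]
  · intro z hz
    have h1 : z ∈ (X.append Z6).support := by rw [Walk.mem_support_append_iff]; exact Or.inl hz
    rw [← e6] at h1
    have h2 : z ≠ a3 := by rintro rfl; exact ha3X hz
    simp only [Walk.mem_support_append_iff, Walk.support_cons, Walk.support_nil, List.mem_cons,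
      List.not_mem_nil, h2, or_false] at h1
    rcases h1 with h1 | h1 | rfl
    · exact Or.inl h1
    · exact Or.inr h1
    · exact Or.inr (by simp)
  · intro z hz
    have := hS2s z hz
    rw [eM] at this
    simpa only [Seg.Pl, Seg.Ll, Seg.M, Seg.Rl, ← Walk.append_assoc, Walk.cons_append, Walk.nil_append] using this

end NDG

namespace NDG
variable {V : Type*} [DecidableEq V]
set_option linter.unusedSectionVars false
open SimpleGraph
variable {G : SimpleGraph V}

theorem cut_path {a b c d : V} {p : G.Walk a b} {h : G.Adj b c} {q : G.Walk c d}
    (hp : (p.append (Walk.cons h q)).IsPath) {z : V} (h1 : z ∈ p.support) (h2 : z ∈ q.support) : False := by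
  rw [isPath_append_iff, Walk.cons_isPath_iff] at hp
  have := hp.2.2 z h1 (by simp [h2])
  subst this
  exact hp.2.1.2 h2

theorem Seg.mem_M {u v w x : V} (B : Seg G u v w x) (z : V) : z ∈ B.M.support ↔
    z ∈ B.M1.support ∨ z = B.a3 ∨ z ∈ B.M3.support ∨ z ∈ B.M4.support := by
  simp only [Seg.M, Walk.mem_support_append_iff, Walk.support_cons, List.mem_cons]
  constructor
  · rintro (h | rfl | rfl | h | rfl | h) <;> simp [*]
  · rintro (h | rfl | h | h) <;> simp [*]

theorem Seg.mem_Ll {u v w x : V} (B : Seg G u v w x) (z : V) : z ∈ B.Ll.support ↔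
    z ∈ B.Ll1.support ∨ z ∈ B.Ll2.support := by
  simp only [Seg.Ll, Walk.mem_support_append_iff, Walk.support_cons, List.mem_cons]
  constructor
  · rintro (h | rfl | h) <;> simp [*]
  · rintro (h | h) <;> simp [*]

theorem Seg.mem_Ru {u v w x : V} (B : Seg G u v w x) (z : V) : z ∈ B.Ru.support ↔
    z ∈ B.Ru1.support ∨ z ∈ B.Ru2.support := by
  simp only [Seg.Ru, Walk.mem_support_append_iff, Walk.support_cons, List.mem_cons]
  constructor
  · rintro (h | rfl | h) <;> simp [*]
  · rintro (h | h) <;> simp [*]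

theorem Seg.mem_Rl {u v w x : V} (B : Seg G u v w x) (z : V) : z ∈ B.Rl.support ↔
    z ∈ B.Rl1.support ∨ z ∈ B.Rl2.support := by
  simp only [Seg.Rl, Walk.mem_support_append_iff, Walk.support_cons, List.mem_cons]
  constructor
  · rintro (h | rfl | h) <;> simp [*]
  · rintro (h | h) <;> simp [*]

theorem Seg.mem_Pu {u v w x : V} (B : Seg G u v w x) (z : V) : z ∈ B.Pu.support ↔
    z ∈ B.Lu.support ∨ z ∈ B.M.support ∨ z ∈ B.Ru.support := by
  simp only [Seg.Pu, Walk.mem_support_append_iff, or_assoc]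

theorem Seg.mem_Pl {u v w x : V} (B : Seg G u v w x) (z : V) : z ∈ B.Pl.support ↔
    z ∈ B.Ll.support ∨ z ∈ B.M.support ∨ z ∈ B.Rl.support := by
  simp only [Seg.Pl, Walk.mem_support_append_iff, or_assoc]

theorem Seg.excl_aux {u v a m a3 n b2 y b r b1 : V} {Lu : G.Walk u a} {M1 : G.Walk a m} {hm1 : G.Adj m a3}
    {hm2 : G.Adj a3 n} {M3 : G.Walk n b2} {hm3 : G.Adj b2 y} {M4 : G.Walk y b} {Ru1 : G.Walk b r}
    {hr : G.Adj r b1} {Ru2 : G.Walk b1 v}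
    (hp : ((Lu.append (M1.append (Walk.cons hm1 (Walk.cons hm2 (M3.append (Walk.cons hm3 M4)))))).append
      (Ru1.append (Walk.cons hr Ru2))).IsPath) (z : V) :
    ((z ∈ Lu.support ∨ z ∈ M1.support) → z ≠ a3 ∧ z ∉ M3.support ∧ z ∉ M4.support ∧ z ∉ Ru1.support ∧ z ∉ Ru2.support) ∧
    (z = a3 → z ∉ M3.support ∧ z ∉ M4.support ∧ z ∉ Ru1.support ∧ z ∉ Ru2.support) ∧
    (z ∈ M3.support → z ∉ M4.support ∧ z ∉ Ru1.support ∧ z ∉ Ru2.support) ∧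
    ((z ∈ M4.support ∨ z ∈ Ru1.support) → z ∉ Ru2.support) := by
  have k1 : ((Lu.append M1).append (Walk.cons hm1 (Walk.cons hm2 (M3.append (Walk.cons hm3 (M4.append
      (Ru1.append (Walk.cons hr Ru2)))))))).IsPath := by
    simpa only [← Walk.append_assoc, Walk.cons_append] using hp
  have k2 : (Walk.cons hm2 (M3.append (Walk.cons hm3 (M4.append (Ru1.append (Walk.cons hr Ru2)))))).IsPath := by
    have := k1.of_append_right
    rw [Walk.cons_isPath_iff] at this
    exact this.1
  rw [Walk.cons_isPath_iff] at k2
  have k4 := k2.1.of_append_right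
  rw [Walk.cons_isPath_iff, Walk.append_assoc] at k4
  have g1 := fun h1 h2 => cut_path k1 (z := z) h1 h2
  have g2 := k2.2
  have g3 := fun h1 h2 => cut_path k2.1 (z := z) h1 h2
  have g4 := fun h1 h2 => cut_path k4.1 (z := z) h1 h2
  simp only [Walk.mem_support_append_iff, Walk.support_cons, List.mem_cons] at g1 g2 g3 g4
  grind

theorem Seg.exclU {u v w x : V} {B : Seg G u v w x} (hp : B.Pu.IsPath) (z : V) :
    ((z ∈ B.Lu.support ∨ z ∈ B.M1.support) → z ≠ B.a3 ∧ z ∉ B.M3.support ∧ z ∉ B.M4.support ∧ z ∉ B.Ru1.support ∧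
      z ∉ B.Ru2.support) ∧
    (z = B.a3 → z ∉ B.M3.support ∧ z ∉ B.M4.support ∧ z ∉ B.Ru1.support ∧ z ∉ B.Ru2.support) ∧
    (z ∈ B.M3.support → z ∉ B.M4.support ∧ z ∉ B.Ru1.support ∧ z ∉ B.Ru2.support) ∧
    ((z ∈ B.M4.support ∨ z ∈ B.Ru1.support) → z ∉ B.Ru2.support) := Seg.excl_aux hp z

/-- the lower path: additionally the first segment -/
theorem Seg.exclL {u v w x : V} {B : Seg G u v w x} (hp : B.Pl.IsPath) (z : V) :
    ((z ∈ B.Ll2.support ∨ z ∈ B.M1.support) → z ≠ B.a3 ∧ z ∉ B.M3.support ∧ z ∉ B.M4.support ∧ z ∉ B.Rl1.support ∧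
      z ∉ B.Rl2.support) ∧
    (z = B.a3 → z ∉ B.M3.support ∧ z ∉ B.M4.support ∧ z ∉ B.Rl1.support ∧ z ∉ B.Rl2.support) ∧
    (z ∈ B.M3.support → z ∉ B.M4.support ∧ z ∉ B.Rl1.support ∧ z ∉ B.Rl2.support) ∧
    ((z ∈ B.M4.support ∨ z ∈ B.Rl1.support) → z ∉ B.Rl2.support) ∧
    (z ∈ B.Ll1.support → z ∉ B.Ll2.support ∧ z ∉ B.M1.support ∧ z ≠ B.a3 ∧ z ∉ B.M3.support ∧ z ∉ B.M4.support ∧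
      z ∉ B.Rl1.support ∧ z ∉ B.Rl2.support) := by
  have k : (B.Ll1.append (Walk.cons B.hl ((B.Ll2.append B.M).append B.Rl))).IsPath := by
    simpa only [Seg.Pl, Seg.Ll, ← Walk.append_assoc, Walk.cons_append] using hp
  have k2 := k.of_append_right
  rw [Walk.cons_isPath_iff] at k2
  have g := fun h1 h2 => cut_path k (z := z) h1 h2
  obtain ⟨h1, h2, h3, h4⟩ := Seg.excl_aux k2.1 z
  refine ⟨h1, h2, h3, h4, fun h => ?_⟩
  have g := g h
  simp only [Walk.mem_support_append_iff, Seg.mem_M, Seg.mem_Rl] at g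
  grind

end NDG

namespace NDG
variable {V : Type*} [DecidableEq V]
set_option linter.unusedSectionVars false
open SimpleGraph
variable {G : SimpleGraph V}

theorem mem_of_edges_subset {a b c d : V} {p : G.Walk a b} {q : G.Walk c d} (h : ∀ e ∈ p.edges, e ∈ q.edges)
    {z : V} (hz : z ∈ p.support) (hz' : z ≠ a) : z ∈ q.support := by
  induction p with
  | nil => simp at hz; exact (hz' hz).elim
  | @cons a a' b hadj p ih =>
    simp only [Walk.support_cons, List.mem_cons] at hz
    have h1 : s(a, a') ∈ q.edges := h _ (by simp)
    by_cases h2 : z = a'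
    · subst h2
      exact q.snd_mem_support_of_mem_edges h1
    · exact ih (fun e he => h e (by simp [he])) (hz.resolve_left hz') h2

theorem Seg.basic {u v w x : V} {D : Seg G u v w x} (pu : D.Pu.IsPath) (pl : D.Pl.IsPath)
    (meet : ∀ z, z ∈ D.Pu.support → z ∈ D.Pl.support → z ∈ D.M.support)
    (hX : ∀ z ∈ D.X.support, z ∈ D.Lu.support ∨ z ∈ D.M1.support) :
    D.a1 ∉ D.Ll1.support ∧ D.a1 ∉ D.Rl.support ∧ D.b1 ∉ D.Pl.support ∧
    (D.a2 ∉ D.Lu.support ∧ D.a2 ∉ D.Ru.support) ∧ (D.b2 ∉ D.Lu.support ∧ D.b2 ∉ D.Ru.support) ∧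
    (D.a3 ∉ D.Lu.support ∧ D.a3 ∉ D.Ru.support) ∧ (D.b3 ∉ D.Lu.support ∧ D.b3 ∉ D.Ru.support) := by
  have s1 := hX D.a1 (by simp)
  have s2 : D.b1 ∈ D.Ru2.support := by simp
  have s3 : D.a2 ∈ D.Ll1.support := by simp
  have s4 : D.b2 ∈ D.M3.support := by simp
  have s5 : D.b3 ∈ D.Rl2.support := by simp
  clear hX
  simp only [Seg.mem_Pu, Seg.mem_Pl, Seg.mem_M, Seg.mem_Ll, Seg.mem_Rl, Seg.mem_Ru] at meet ⊢
  refine ⟨?_, ?_, ?_, ?_, ?_, ?_, ?_⟩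
  · have h1 := Seg.exclU pu D.a1
    have h2 := Seg.exclL pl D.a1
    have h3 := meet D.a1
    clear meet pu pl s2 s3 s4 s5
    grind
  · have h1 := Seg.exclU pu D.a1
    have h2 := Seg.exclL pl D.a1
    have h3 := meet D.a1
    clear meet pu pl s2 s3 s4 s5
    grind
  · have h1 := Seg.exclU pu D.b1
    have h2 := Seg.exclL pl D.b1
    have h3 := meet D.b1
    clear meet pu pl s1 s3 s4 s5
    grind
  · have h1 := Seg.exclU pu D.a2
    have h2 := Seg.exclL pl D.a2
    have h3 := meet D.a2
    clear meet pu pl s1 s2 s4 s5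
    grind
  · have h1 := Seg.exclU pu D.b2
    have h2 := Seg.exclL pl D.b2
    have h3 := meet D.b2
    clear meet pu pl s1 s2 s3 s5
    grind
  · have h1 := Seg.exclU pu D.a3
    have h2 := Seg.exclL pl D.a3
    have h3 := meet D.a3
    clear meet pu pl s1 s2 s3 s4 s5
    grind
  · have h1 := Seg.exclU pu D.b3
    have h2 := Seg.exclL pl D.b3
    have h3 := meet D.b3
    clear meet pu pl s1 s2 s3 s4
    grind

theorem PBC.toCfg {u v w x : V} (B : PBC G u v w x) (hB : B.IsBC) : Nonempty (Cfg G u v w x) := by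
  obtain ⟨⟨a, b, a1, b1, a2, b2, a3, b3, l, m, n, y, r, s, Lu, Ll1, hl, Ll2, M1, hm1, hm2, M3, hm3, M4, Ru1, hr,
    Ru2, Rl1, hs, Rl2, X, q1, q2, q3⟩, h1, h2, h3, h4, h5, h6, h7, h8, eLu, eM, eLl, eRu, eRl, eq1, eq2, eq3,
    hX, hS2s, hS2l⟩ := B.toSeg
  dsimp only at h1 h2 h3 h4 h5 h6 h7 h8
  subst h1 h2 h3 h4 h5 h6 h7 h8
  simp only [Walk.copy_rfl_rfl] at eLu eM eLl eRu eRl eq1 eq2 eq3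
  subst eLu eq1 eq2 eq3
  set D : Seg G u v w x := ⟨B.a, B.b, B.a1, B.b1, B.a2, B.b2, B.a3, B.b3, l, m, n, y, r, s, B.Lu, Ll1, hl, Ll2, M1,
    hm1, hm2, M3, hm3, M4, Ru1, hr, Ru2, Rl1, hs, Rl2, X, B.q1, B.q2, B.q3⟩ with hD
  have ePu : D.Pu = B.Pu := by rw [Seg.Pu, PBC.Pu, eM, eRu]
  have ePl : D.Pl = B.Pl := by rw [Seg.Pl, PBC.Pl, eM, eLl, eRl]
  have pu : D.Pu.IsPath := by rw [ePu]; exact B.hPu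
  have pl : D.Pl.IsPath := by rw [ePl]; exact B.hPl
  have meet : ∀ z, z ∈ D.Pu.support → z ∈ D.Pl.support → z ∈ D.M.support := by
    rw [ePu, ePl, ← eM]; intro z; exact B.meetV
  have bas := Seg.basic pu pl meet hX
  obtain ⟨k1, k2, k3, k4, k5, k6, k7⟩ := bas
  have c1 : ∀ z ∈ B.q1.support, z ∈ D.Pu.support → z = B.a1 ∨ z = B.b1 := by rw [ePu]; exact B.hq1closes
  have c2 : ∀ z ∈ B.q2.support, z ∈ D.Pl.support → z = B.a2 ∨ z = B.b2 := by rw [ePl]; exact B.hq2closes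
  have c3 : ∀ z ∈ B.q3.support, z ∈ D.Pl.support → z = B.a3 ∨ z = B.b3 := by rw [ePl]; exact B.hq3closes
  have d13 : ∀ z ∈ B.q1.support, z ∉ B.q3.support := by
    rcases hB with h | h | h | h
    · exact h.2.1
    · exact fun z hz hz' => h.1 z hz' hz
    · exact h.2.2.2.1
    · exact fun z hz hz' => h.2.2.1 z hz' hz
  have d23 : ∀ z ∈ B.q2.support, z ∉ B.q3.support := by
    rcases hB with h | h | h | h
    · exact h.2.2.1
    · exact fun z hz hz' => h.2.1 z hz' hz
    · exact h.2.2.2.2.1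
    · exact fun z hz hz' => h.2.2.2.1 z hz' hz
  have hB' : (B.InternDisj B.q1 ∧ B.InternDisj B.q2 ∧ B.InternDisj B.q3) ∨
      (B.AvoidsUpperOuter B.q2 ∧ B.AvoidsUpperOuter B.q3 ∧ B.LlTraverse) := by
    rcases hB with h | h | h | h
    · exact Or.inl h.2.2.2
    · exact Or.inl h.2.2.2.2
    · exact Or.inr h.2.2.2.2.2
    · exact Or.inr h.2.2.2.2.2.2
  have iav : ∀ {y z : V} (q : G.Walk y z), (y ∉ B.Lu.support ∧ y ∉ D.Ru.support) →
      (z ∉ B.Lu.support ∧ z ∉ D.Ru.support) → (B.InternDisj q ∨ B.AvoidsUpperOuter q) →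
      ∀ t ∈ q.support, t ∉ B.Lu.support ∧ t ∉ D.Ru.support := by
    intro y z q hy hz hq t ht
    rcases hq with hq | hq
    · by_cases e1 : t = y
      · rw [e1]; exact hy
      by_cases e2 : t = z
      · rw [e2]; exact hz
      have := (hq t ht e1 e2).1
      rw [← ePu, Seg.mem_Pu] at this
      tauto
    · have := hq t ht
      rwa [eRu] at this
  have av2 := iav B.q2 k4 k5 (by tauto)
  have av3 := iav B.q3 k6 k7 (by tauto)
  have q1Rl : ∀ z ∈ B.q1.support, z ∉ D.Rl.support := by
    rcases hB' with ⟨h, -⟩ | ⟨-, -, h⟩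
    · intro z hz hz'
      by_cases e1 : z = B.a1
      · rw [e1] at hz'; exact k2 hz'
      have hz2 : z ∈ D.Pl.support := by rw [Seg.mem_Pl]; tauto
      by_cases e2 : z = B.b1
      · rw [e2] at hz2; exact k3 hz2
      rw [ePl] at hz2
      exact (h z hz e1 e2).2 hz2
    · rw [← eRl]; exact h.1
  have q1Ll1 : ∀ z ∈ B.q1.support, z ∉ Ll1.support := by
    intro z hz hz'
    have hz2 : z ∈ D.Pl.support := by rw [Seg.mem_Pl, Seg.mem_Ll]; exact Or.inl (Or.inl hz')
    by_cases e1 : z = B.a1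
    · rw [e1] at hz'; exact k1 hz'
    rcases hB' with ⟨h, -⟩ | ⟨-, -, h⟩
    · by_cases e2 : z = B.b1
      · rw [e2] at hz2; exact k3 hz2
      rw [ePl] at hz2
      exact (h z hz e1 e2).2 hz2
    · obtain ⟨-, ha2, y, α, β, eα, hy, hα, hβ⟩ := h
      have hzα : z ∈ α.support := by
        have hz0 := hz
        rw [eα, Walk.mem_support_append_iff] at hz
        rcases hz with hz | hz
        · exact hz
        · have := hβ z hz (by rw [eLl, Seg.mem_Ll]; exact Or.inl hz')
          rw [this]; simp
      have := hS2l z (mem_of_edges_subset hα hzα e1) hz'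
      rw [this] at hz
      exact ha2 hz
  refine ⟨⟨D, B.hq1path, B.hq2path, B.hq3path, B.hq1_ne, B.hq2_ne, B.hq3_ne, pu, pl, hX, meet, c1, c2, c3, d13, d23,
    av2, av3, q1Ll1, q1Rl, ?_⟩⟩
  intro c p q epq hc z hz hz'
  have epq : B.q1 = p.append q := epq
  have hc : c ∈ B.q2.support := hc
  have hz' : z ∈ Ll2.support := hz'
  have hz2 : z ∈ D.Pl.support := by rw [Seg.mem_Pl, Seg.mem_Ll]; exact Or.inl (Or.inr hz')
  have hc1 : c ∈ B.q1.support := by rw [epq]; simp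
  have hz1 : z ∈ B.q1.support := by rw [epq, Walk.mem_support_append_iff]; exact Or.inr hz
  have ha1X := hX B.a1 X.end_mem_support
  have ha1u : B.a1 ∈ D.Pu.support := by rw [Seg.mem_Pu, Seg.mem_M]; tauto
  have hb2u : B.b2 ∈ D.Pu.support := by
    rw [Seg.mem_Pu, Seg.mem_M]; exact Or.inr (Or.inl (Or.inr (Or.inr (Or.inl M3.end_mem_support))))
  have a1b2 : B.a1 ≠ B.b2 := by
    intro h
    have := (Seg.exclU pu B.a1).1 ha1X
    exact this.2.1 (by rw [h]; exact M3.end_mem_support)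
  have hca2 : c ≠ B.a2 := by
    rintro rfl
    exact q1Ll1 _ hc1 (by simp)
  have hcb2 : c ≠ B.b2 := by
    intro h0
    rw [h0] at hc1
    rcases c1 _ hc1 hb2u with h | h
    · exact a1b2 h.symm
    · have k5' : B.b2 ∉ D.Ru.support := k5.2
      rw [h, Seg.mem_Ru] at k5'
      exact k5' (Or.inr Ru2.start_mem_support)
  have hcPl : c ∉ D.Pl.support := by
    intro h
    rcases c2 c hc h with h | h
    · exact hca2 h
    · exact hcb2 h
  have hca1 : c ≠ B.a1 := by
    rintro rfl
    rcases ha1X with h | h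
    · exact (av2 _ hc).1 h
    · exact hcPl (by rw [Seg.mem_Pl, Seg.mem_M]; tauto)
  have hpq := B.hq1path
  rw [epq, isPath_append_iff] at hpq
  have hza1 : z ≠ B.a1 := by
    rintro rfl
    exact hca1 (hpq.2.2 _ (by simp) hz).symm
  rcases hB' with ⟨h, -⟩ | ⟨-, -, h⟩
  · by_cases e2 : z = B.b1
    · rw [e2] at hz2; exact k3 hz2
    rw [ePl] at hz2
    exact (h z hz1 hza1 e2).2 hz2
  · obtain ⟨-, ha2, y, α, β, eα, hy, hα, hβ⟩ := h
    rcases append_split _ _ _ _ (epq.symm.trans eα) with ⟨Z, rfl, rfl⟩ | ⟨Z, rfl, rfl⟩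
    · exact hcPl (hS2s c (mem_of_edges_subset hα (by simp) hca1))
    · have h9 := hβ z (by rw [Walk.mem_support_append_iff]; exact Or.inr hz)
        (by rw [eLl, Seg.mem_Ll]; exact Or.inr hz')
      have h10 := hpq.2.2 z (by rw [h9]; simp) hz
      rw [h10] at hz2
      exact hcPl hz2

end NDG

namespace NDG
variable {V : Type*} [DecidableEq V]
set_option linter.unusedSectionVars false
open SimpleGraph
variable {G : SimpleGraph V}

/-- edges joining two vertices of the same class -/
def sameCl {k : ℕ} (φ : V → Fin k) : Set (Sym2 V) := {e | ∀ y z, e = s(y, z) → φ y = φ z}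

theorem sameCl_of_const {k : ℕ} {φ : V → Fin k} {a b : V} (p : G.Walk a b) (i : Fin k)
    (h : ∀ z ∈ p.support, φ z = i) : ∀ e ∈ p.edges, e ∈ sameCl φ := by
  intro e he y z hyz
  subst hyz
  rw [h _ (p.fst_mem_support_of_mem_edges he), h _ (p.snd_mem_support_of_mem_edges he)]

theorem Cfg.sepA {u v w x : V} (D : Cfg G u v w x) (z : V) :
    (z ∈ D.Ll1.support → z ∉ D.Lu.support ∧ z ∉ D.M1.support ∧ z ≠ D.a3 ∧ z ∉ D.M3.support ∧ z ∉ D.M4.support ∧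
      z ∉ D.Ru1.support ∧ z ∉ D.Ru2.support ∧ z ∉ D.Ll2.support ∧ z ∉ D.Rl1.support ∧ z ∉ D.Rl2.support) ∧
    (z ∈ D.Rl2.support → z ∉ D.Lu.support ∧ z ∉ D.M1.support ∧ z ≠ D.a3 ∧ z ∉ D.M3.support ∧ z ∉ D.M4.support ∧
      z ∉ D.Ru1.support ∧ z ∉ D.Ru2.support ∧ z ∉ D.Ll2.support ∧ z ∉ D.Rl1.support) ∧
    (z ∈ D.Ru2.support → z ∉ D.Lu.support ∧ z ∉ D.M1.support ∧ z ≠ D.a3 ∧ z ∉ D.M3.support ∧ z ∉ D.M4.support ∧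
      z ∉ D.Ru1.support ∧ z ∉ D.Ll2.support ∧ z ∉ D.Rl1.support) ∧
    (z = D.a3 → z ∉ D.Lu.support ∧ z ∉ D.M1.support ∧ z ∉ D.M3.support ∧ z ∉ D.M4.support ∧
      z ∉ D.Ru1.support ∧ z ∉ D.Ll2.support ∧ z ∉ D.Rl1.support) ∧
    (z ∈ D.M3.support → z ∉ D.Lu.support ∧ z ∉ D.M1.support ∧ z ∉ D.M4.support ∧
      z ∉ D.Ru1.support ∧ z ∉ D.Ll2.support ∧ z ∉ D.Rl1.support) ∧
    (z ∈ D.M4.support ∨ z ∈ D.Ru1.support ∨ z ∈ D.Rl1.support → z ∉ D.Lu.support ∧ z ∉ D.M1.support ∧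
      z ∉ D.Ll2.support) := by
  have h1 := Seg.exclU D.pu z
  have h2 := Seg.exclL D.pl z
  have h3 := D.meet z
  simp only [Seg.mem_Pu, Seg.mem_Pl, Seg.mem_M, Seg.mem_Ll, Seg.mem_Rl, Seg.mem_Ru] at h3
  refine ⟨fun h => ?_, fun h => ?_, fun h => ?_, fun h => ?_, fun h => ?_, fun h => ?_⟩ <;> grind (splits := 25)

/-- how the three paths meet the segments -/
theorem Cfg.sepQ {u v w x : V} (D : Cfg G u v w x) (z : V) :
    (z ∈ D.q1.support → z ∉ D.Ll1.support ∧ z ∉ D.Rl1.support ∧ z ∉ D.Rl2.support ∧ z ∉ D.q3.support ∧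
      z ≠ D.a3 ∧ z ∉ D.M3.support ∧ z ∉ D.M4.support ∧ z ∉ D.Ru1.support ∧ (z ∈ D.Ru2.support → z = D.b1)) ∧
    (z ∈ D.q2.support → z ∉ D.Lu.support ∧ z ∉ D.Ru1.support ∧ z ∉ D.Ru2.support ∧ z ∉ D.q3.support ∧
      z ∉ D.Ll2.support ∧ z ∉ D.M1.support ∧ z ≠ D.a3 ∧ z ∉ D.M4.support ∧ z ∉ D.Rl1.support ∧ z ∉ D.Rl2.support ∧
      (z ∈ D.Ll1.support → z = D.a2) ∧ (z ∈ D.M3.support → z = D.b2)) ∧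
    (z ∈ D.q3.support → z ∉ D.Lu.support ∧ z ∉ D.Ru1.support ∧ z ∉ D.Ru2.support ∧ z ∉ D.Ll1.support ∧
      z ∉ D.Ll2.support ∧ z ∉ D.M1.support ∧ z ∉ D.M3.support ∧ z ∉ D.M4.support ∧ z ∉ D.Rl1.support ∧
      (z ∈ D.Rl2.support → z = D.b3)) := by
  have hA := D.sepA z
  have a1 : z = D.a1 → z ∈ D.Lu.support ∨ z ∈ D.M1.support := by
    rintro rfl; exact D.hX _ D.X.end_mem_support
  have b1 : z = D.b1 → z ∈ D.Ru2.support := by rintro rfl; exact D.Ru2.start_mem_support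
  have a2 : z = D.a2 → z ∈ D.Ll1.support := by rintro rfl; exact D.Ll1.end_mem_support
  have b2 : z = D.b2 → z ∈ D.M3.support := by rintro rfl; exact D.M3.end_mem_support
  have b3 : z = D.b3 → z ∈ D.Rl2.support := by rintro rfl; exact D.Rl2.start_mem_support
  have c1 := D.c1 z
  have c2 := D.c2 z
  have c3 := D.c3 z
  have d13 := D.d13 z
  have d23 := D.d23 z
  have av2 := D.av2 z
  have av3 := D.av3 z
  have q1Ll1 := D.q1Ll1 z
  have q1Rl := D.q1Rl z
  simp only [Seg.mem_Pu, Seg.mem_Pl, Seg.mem_M, Seg.mem_Ll, Seg.mem_Rl, Seg.mem_Ru] at c1 c2 c3 av2 av3 q1Rl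
  refine ⟨fun h => ?_, fun h => ?_, fun h => ?_⟩
  · clear av2 av3 c2 c3 a2 b2 b3 d23
    grind
  · clear av3 c1 c3 a1 b1 b3 d13 q1Ll1 q1Rl
    grind
  · clear av2 c1 c2 a1 b1 a2 b2 d13 d23 q1Ll1 q1Rl
    grind

end NDG

namespace NDG
variable {V : Type*} [DecidableEq V]
set_option linter.unusedSectionVars false
open SimpleGraph
variable {G : SimpleGraph V}

set_option maxHeartbeats 4000000 in
theorem Cfg.false1 {u v w x : V} (D : Cfg G u v w x) (d12 : ∀ z ∈ D.q1.support, z ∉ D.q2.support)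
    (heff : ∀ c : Sym2 V → ℝ, (∀ e, 0 ≤ c e) → EffP G u v w x c) : False := by
  obtain ⟨z1, p1, g1, e1⟩ := exists_concat_of D.q1 D.nq1
  obtain ⟨z2, g2, p2, e2⟩ := exists_cons_of D.q2 D.nq2
  obtain ⟨z3, p3, g3, e3⟩ := exists_concat_of D.q3 D.nq3
  have m1 : ∀ z, z ∈ p1.support → z ∈ D.q1.support ∧ z ≠ D.b1 := by
    intro z hz
    refine ⟨by rw [e1]; simp [hz], ?_⟩
    rintro rfl
    have := D.hq1
    rw [e1] at this
    exact cut_path this hz (by simp)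
  have m2 : ∀ z, z ∈ p2.support → z ∈ D.q2.support ∧ z ≠ D.a2 := by
    intro z hz
    refine ⟨by rw [e2]; simp [hz], ?_⟩
    rintro rfl
    have := D.hq2
    rw [e2, Walk.cons_isPath_iff] at this
    exact this.2 hz
  have m3 : ∀ z, z ∈ p3.support → z ∈ D.q3.support ∧ z ≠ D.b3 := by
    intro z hz
    refine ⟨by rw [e3]; simp [hz], ?_⟩
    rintro rfl
    have := D.hq3
    rw [e3] at this
    exact cut_path this hz (by simp)
  obtain ⟨φ, hφ⟩ : ∃ φ : V → Fin 7, φ = fun z => if z ∈ D.Ll1.support then 5 else if z ∈ D.Rl2.support then 6 else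
    if z ∈ D.Ru2.support then 4 else if z ∈ p3.support then 1 else
    if z ∈ D.M3.support ∨ z ∈ p2.support then 2 else
    if z ∈ D.M4.support ∨ z ∈ D.Ru1.support ∨ z ∈ D.Rl1.support then 3 else 0 := ⟨_, rfl⟩
  have kLl1 : ∀ z ∈ D.Ll1.support, φ z = 5 := by
    intro z hz; simp [hφ, hz]
  have kRl2 : ∀ z ∈ D.Rl2.support, φ z = 6 := by
    intro z hz
    have := D.sepA z
    have : z ∉ D.Ll1.support := by grind
    simp only [hφ]
    simp [*]
  have kRu2 : ∀ z ∈ D.Ru2.support, φ z = 4 := by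
    intro z hz
    have := D.sepA z
    have h1 : z ∉ D.Ll1.support := by grind
    have h2 : z ∉ D.Rl2.support := by grind
    simp only [hφ]
    simp [h1, h2, hz]
  have k3 : ∀ z ∈ p3.support, φ z = 1 := by
    intro z hz
    have := (D.sepQ z).2.2 (m3 z hz).1
    have h0 := (m3 z hz).2
    have h1 : z ∉ D.Ll1.support := by grind
    have h2 : z ∉ D.Rl2.support := by grind
    have h3 : z ∉ D.Ru2.support := by grind
    simp only [hφ]
    simp [h1, h2, h3, hz]
  have kM3 : ∀ z ∈ D.M3.support, φ z = 2 := by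
    intro z hz
    have := D.sepA z
    have h1 : z ∉ D.Ll1.support := by grind
    have h2 : z ∉ D.Rl2.support := by grind
    have h3 : z ∉ D.Ru2.support := by grind
    have h4 : z ∉ p3.support := by
      intro h
      have := (D.sepQ z).2.2 (m3 z h).1
      grind
    simp only [hφ]
    simp [h1, h2, h3, h4, hz]
  have k2 : ∀ z ∈ p2.support, φ z = 2 := by
    intro z hz
    have := (D.sepQ z).2.1 (m2 z hz).1
    have h0 := (m2 z hz).2
    have h1 : z ∉ D.Ll1.support := by grind
    have h2 : z ∉ D.Rl2.support := by grind
    have h3 : z ∉ D.Ru2.support := by grind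
    have h4 : z ∉ p3.support := by
      intro h
      exact this.2.2.2.1 (m3 z h).1
    simp only [hφ]
    simp [h1, h2, h3, h4, hz]
  have kD : ∀ z, (z ∈ D.M4.support ∨ z ∈ D.Ru1.support ∨ z ∈ D.Rl1.support) → φ z = 3 := by
    intro z hz
    have hA := D.sepA z
    have h1 : z ∉ D.Ll1.support := by grind
    have h2 : z ∉ D.Rl2.support := by grind
    have h3 : z ∉ D.Ru2.support := by grind
    have h4 : z ∉ p3.support := by
      intro h
      have := (D.sepQ z).2.2 (m3 z h).1
      grind
    have h5 : z ∉ D.M3.support := by grind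
    have h6 : z ∉ p2.support := by
      intro h
      have := (D.sepQ z).2.1 (m2 z h).1
      grind
    simp only [hφ]
    simp [h1, h2, h3, h4, h5, h6, hz]
  have kA : ∀ z, (z ∈ D.Lu.support ∨ z ∈ D.M1.support ∨ z ∈ D.Ll2.support ∨ z ∈ p1.support) → φ z = 0 := by
    intro z hz
    have hA := D.sepA z
    have hQ := (D.sepQ z).1
    have hm := m1 z
    have h1 : z ∉ D.Ll1.support := by grind
    have h2 : z ∉ D.Rl2.support := by grind
    have h3 : z ∉ D.Ru2.support := by grind
    have h4 : z ∉ p3.support := by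
      intro h
      have := (D.sepQ z).2.2 (m3 z h).1
      have := (m3 z h).1
      grind
    have h5 : z ∉ D.M3.support := by grind
    have h6 : z ∉ p2.support := by
      intro h
      have := (D.sepQ z).2.1 (m2 z h).1
      have h7 := d12 z
      have := (m2 z h).1
      grind
    have h7 : z ∉ D.M4.support := by grind
    have h8 : z ∉ D.Ru1.support := by grind
    have h9 : z ∉ D.Rl1.support := by grind
    simp only [hφ]
    simp [h1, h2, h3, h4, h5, h6, h7, h8, h9]
  have kX : ∀ z ∈ D.X.support, φ z = 0 := by
    intro z hz
    have := D.hX z hz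
    exact kA z (by grind)
  have kLu : ∀ z ∈ D.Lu.support, φ z = 0 := fun z hz => kA z (Or.inl hz)
  have kM1 : ∀ z ∈ D.M1.support, φ z = 0 := fun z hz => kA z (Or.inr (Or.inl hz))
  have kLl2 : ∀ z ∈ D.Ll2.support, φ z = 0 := fun z hz => kA z (Or.inr (Or.inr (Or.inl hz)))
  have k1 : ∀ z ∈ p1.support, φ z = 0 := fun z hz => kA z (Or.inr (Or.inr (Or.inr hz)))
  have kM4 : ∀ z ∈ D.M4.support, φ z = 3 := fun z hz => kD z (Or.inl hz)
  have kRu1 : ∀ z ∈ D.Ru1.support, φ z = 3 := fun z hz => kD z (Or.inr (Or.inl hz))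
  have kRl1 : ∀ z ∈ D.Rl1.support, φ z = 3 := fun z hz => kD z (Or.inr (Or.inr hz))
  clear kA kD
  clear hφ
  have tLu := sameCl_of_const _ _ kLu
  have tM1 := sameCl_of_const _ _ kM1
  have tM3 := sameCl_of_const _ _ kM3
  have tM4 := sameCl_of_const _ _ kM4
  have tRu1 := sameCl_of_const _ _ kRu1
  have tRu2 := sameCl_of_const _ _ kRu2
  have tRl1 := sameCl_of_const _ _ kRl1
  have tRl2 := sameCl_of_const _ _ kRl2
  have tLl1 := sameCl_of_const _ _ kLl1
  have tLl2 := sameCl_of_const _ _ kLl2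
  have tX := sameCl_of_const _ _ kX
  have t1 := sameCl_of_const _ _ k1
  have t2 := sameCl_of_const _ _ k2
  have t3 := sameCl_of_const _ _ k3
  refine model1_false φ (kLu _ (by simp)) (kRu2 _ (by simp)) (kLl1 _ (by simp)) (kRl2 _ (by simp))
    ![D.m, D.a3, D.b2, D.r, D.a2, D.s, z1, D.a2, z3] ![D.a3, D.n, D.y, D.b1, D.l, D.b3, D.b1, z2, D.b3]
    ?_ ?_ (sameCl φ) (fun y z h => h y z rfl) D.Pu ?_ D.Pl ?_ ((D.X.append D.q1).append D.Ru2) ?_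
    (((D.Ll1.append D.q2).append (Walk.cons D.hm3 D.M4)).append D.Rl) ?_
    ((D.Ll.append ((D.M1.append (Walk.cons D.hm1 Walk.nil)).append D.q3)).append D.Rl2) ?_ heff
  · intro i
    fin_cases i
    · exact kM1 _ (by simp)
    · exact k3 _ (by simp)
    · exact kM3 _ (by simp)
    · exact kRu1 _ (by simp)
    · exact kLl1 _ (by simp)
    · exact kRl1 _ (by simp)
    · exact k1 _ (by simp)
    · exact kLl1 _ (by simp)
    · exact k3 _ (by simp)
  · intro i
    fin_cases i
    · exact k3 _ (by simp)
    · exact kM3 _ (by simp)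
    · exact kM4 _ (by simp)
    · exact kRu2 _ (by simp)
    · exact kLl2 _ (by simp)
    · exact kRl2 _ (by simp)
    · exact kRu2 _ (by simp)
    · exact k2 _ (by simp)
    · exact kRl2 _ (by simp)
  · intro e he
    simp only [Seg.Pu, Seg.M, Seg.Ru, Walk.edges_append, Walk.edges_cons, List.mem_append, List.mem_cons] at he
    rcases he with (h | h | h | h | h | h | h) | h | h | h
    · exact Or.inl (tLu e h)
    · exact Or.inl (tM1 e h)
    · exact Or.inr ⟨0, by decide, h⟩
    · exact Or.inr ⟨1, by decide, h⟩
    · exact Or.inl (tM3 e h)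
    · exact Or.inr ⟨2, by decide, h⟩
    · exact Or.inl (tM4 e h)
    · exact Or.inl (tRu1 e h)
    · exact Or.inr ⟨3, by decide, h⟩
    · exact Or.inl (tRu2 e h)
  · intro e he
    simp only [Seg.Pl, Seg.M, Seg.Rl, Seg.Ll, Walk.edges_append, Walk.edges_cons, List.mem_append,
      List.mem_cons] at he
    rcases he with ((h | h | h) | h | h | h | h | h | h) | h | h | h
    · exact Or.inl (tLl1 e h)
    · exact Or.inr ⟨4, by decide, h⟩
    · exact Or.inl (tLl2 e h)
    · exact Or.inl (tM1 e h)
    · exact Or.inr ⟨0, by decide, h⟩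
    · exact Or.inr ⟨1, by decide, h⟩
    · exact Or.inl (tM3 e h)
    · exact Or.inr ⟨2, by decide, h⟩
    · exact Or.inl (tM4 e h)
    · exact Or.inl (tRl1 e h)
    · exact Or.inr ⟨5, by decide, h⟩
    · exact Or.inl (tRl2 e h)
  · intro e he
    rw [e1] at he
    simp only [Walk.edges_append, Walk.edges_cons, Walk.edges_nil, List.mem_append, List.mem_cons,
      List.not_mem_nil, or_false] at he
    rcases he with (h | h | h) | h
    · exact Or.inl (tX e h)
    · exact Or.inl (t1 e h)
    · exact Or.inr ⟨6, by decide, h⟩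
    · exact Or.inl (tRu2 e h)
  · intro e he
    rw [e2] at he
    simp only [Seg.Rl, Walk.edges_append, Walk.edges_cons, List.mem_append, List.mem_cons] at he
    rcases he with ((h | h | h) | h | h) | h | h | h
    · exact Or.inl (tLl1 e h)
    · exact Or.inr ⟨7, by decide, h⟩
    · exact Or.inl (t2 e h)
    · exact Or.inr ⟨2, by decide, h⟩
    · exact Or.inl (tM4 e h)
    · exact Or.inl (tRl1 e h)
    · exact Or.inr ⟨5, by decide, h⟩
    · exact Or.inl (tRl2 e h)
  · intro e he
    rw [e3] at he
    simp only [Seg.Ll, Walk.edges_append, Walk.edges_cons, Walk.edges_nil, List.mem_append, List.mem_cons,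
      List.not_mem_nil, or_false] at he
    rcases he with ((h | h | h) | (h | h) | h | h) | h
    · exact Or.inl (tLl1 e h)
    · exact Or.inr ⟨4, by decide, h⟩
    · exact Or.inl (tLl2 e h)
    · exact Or.inl (tM1 e h)
    · exact Or.inr ⟨0, by decide, h⟩
    · exact Or.inl (t3 e h)
    · exact Or.inr ⟨8, by decide, h⟩
    · exact Or.inl (tRl2 e h)

end NDG

namespace NDG
variable {V : Type*} [DecidableEq V]
set_option linter.unusedSectionVars false
open SimpleGraph
variable {G : SimpleGraph V}

theorem mem_nil_edges {a b z : V} {p : G.Walk a b} (h : p.edges = []) (hz : z ∈ p.support) : z = b := by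
  cases p with
  | nil => simpa using hz
  | cons => simp at h

set_option maxHeartbeats 4000000 in
theorem Cfg.false2 {u v w x : V} (D : Cfg G u v w x) (d12 : ∃ z ∈ D.q1.support, z ∈ D.q2.support)
    (heff : ∀ c : Sym2 V → ℝ, (∀ e, 0 ≤ c e) → EffP G u v w x c) : False := by
  obtain ⟨c, q1a, q1b, eq1, hc2, hfirst⟩ : ∃ c, ∃ (p : G.Walk D.a1 c) (q : G.Walk c D.b1), D.q1 = p.append q ∧
      c ∈ D.q2.support ∧ ∀ y ∈ p.support, y ∈ D.q2.support → y = c :=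
    firstHit (fun z => z ∈ D.q2.support) D.q1 d12
  have hc1 : c ∈ D.q1.support := by rw [eq1]; simp
  have iv := D.iv c q1a q1b eq1 hc2
  have sQ := D.sepQ c
  have hca1 : c ≠ D.a1 := by
    intro h0
    have := D.hX _ D.X.end_mem_support
    rw [← h0] at this
    grind
  have hcb1 : c ≠ D.b1 := by
    intro h0
    have : c ∈ D.Ru2.support := by rw [h0]; exact D.Ru2.start_mem_support
    grind
  have hca2 : c ≠ D.a2 := by
    intro h0
    have : c ∈ D.Ll1.support := by rw [h0]; exact D.Ll1.end_mem_support
    grind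
  have hcb2 : c ≠ D.b2 := by
    intro h0
    have : c ∈ D.M3.support := by rw [h0]; exact D.M3.end_mem_support
    grind
  clear sQ
  have hpath := D.hq1
  rw [eq1, isPath_append_iff] at hpath
  obtain ⟨z1, p1, g1, e1⟩ := exists_concat_of q1a (fun h => hca1 (nil_of_edges h).symm)
  obtain ⟨z5, p5, g5, e5⟩ := exists_concat_of q1b (fun h => hcb1 (nil_of_edges h))
  obtain ⟨z2, g2, p2, e2⟩ := exists_cons_of D.q2 D.nq2
  have hcp2 : c ∈ p2.support := by
    rw [e2, Walk.support_cons, List.mem_cons] at hc2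
    exact hc2.resolve_left hca2
  obtain ⟨z4, p4, g4, e4⟩ := exists_concat_of p2 (by
    intro h
    exact hcb2 (mem_nil_edges h hcp2))
  have hcp4 : c ∈ p4.support := by
    rw [e4, Walk.mem_support_append_iff] at hcp2
    rcases hcp2 with h | h
    · exact h
    · simp at h
      rcases h with h | h
      · rw [h]; simp
      · exact (hcb2 h).elim
  have m1 : ∀ z, z ∈ p1.support → z ∈ D.q1.support ∧ z ≠ D.b1 ∧ z ∉ q1b.support ∧ z ∉ D.q2.support := by
    intro z hz
    have hza : z ∈ q1a.support := by rw [e1]; simp [hz]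
    have hzc : z ≠ c := by
      rintro rfl
      have := hpath.1
      rw [e1] at this
      exact cut_path this hz (by simp)
    have hzb : z ∉ q1b.support := fun h => hzc (hpath.2.2 z hza h)
    refine ⟨by rw [eq1, Walk.mem_support_append_iff]; exact Or.inl hza, ?_, hzb, fun h => hzc (hfirst z hza h)⟩
    rintro rfl
    exact hzb (by simp)
  have m5 : ∀ z, z ∈ p5.support → z ∈ D.q1.support ∧ z ≠ D.b1 ∧ z ≠ D.a1 ∧ z ∈ q1b.support := by
    intro z hz
    have hzb : z ∈ q1b.support := by rw [e5]; simp [hz]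
    refine ⟨by rw [eq1, Walk.mem_support_append_iff]; exact Or.inr hzb, ?_, ?_, hzb⟩
    · rintro rfl
      have := hpath.2.1
      rw [e5] at this
      exact cut_path this hz (by simp)
    · rintro rfl
      exact hca1 (hpath.2.2 _ (by simp) hzb).symm
  have m4 : ∀ z, z ∈ p4.support → z ∈ D.q2.support ∧ z ≠ D.a2 ∧ z ≠ D.b2 := by
    intro z hz
    have hz2 : z ∈ p2.support := by rw [e4]; simp [hz]
    have hp := D.hq2
    rw [e2, Walk.cons_isPath_iff] at hp
    refine ⟨by rw [e2]; simp [hz2], ?_, ?_⟩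
    · rintro rfl
      exact hp.2 hz2
    · rintro rfl
      have := hp.1
      rw [e4] at this
      exact cut_path this hz (by simp)
  obtain ⟨z3, p3, g3, e3⟩ := exists_concat_of D.q3 D.nq3
  have m3 : ∀ z, z ∈ p3.support → z ∈ D.q3.support ∧ z ≠ D.b3 := by
    intro z hz
    refine ⟨by rw [e3]; simp [hz], ?_⟩
    rintro rfl
    have := D.hq3
    rw [e3] at this
    exact cut_path this hz (by simp)
  obtain ⟨φ, hφ⟩ : ∃ φ : V → Fin 8, φ = fun z => if z ∈ D.Ll1.support then 5 else if z ∈ D.Rl2.support then 6 else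
    if z ∈ D.Ru2.support then 4 else if z ∈ p3.support then 1 else
    if z ∈ D.M3.support then 2 else if z ∈ p4.support ∨ z ∈ p5.support then 7 else
    if z ∈ D.M4.support ∨ z ∈ D.Ru1.support ∨ z ∈ D.Rl1.support then 3 else 0 := ⟨_, rfl⟩
  have kLl1 : ∀ z ∈ D.Ll1.support, φ z = 5 := by
    intro z hz; simp [hφ, hz]
  have kRl2 : ∀ z ∈ D.Rl2.support, φ z = 6 := by
    intro z hz
    have := D.sepA z
    have : z ∉ D.Ll1.support := by grind
    simp only [hφ]
    simp [*]
  have kRu2 : ∀ z ∈ D.Ru2.support, φ z = 4 := by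
    intro z hz
    have := D.sepA z
    have h1 : z ∉ D.Ll1.support := by grind
    have h2 : z ∉ D.Rl2.support := by grind
    simp only [hφ]
    simp [h1, h2, hz]
  have k3 : ∀ z ∈ p3.support, φ z = 1 := by
    intro z hz
    have := (D.sepQ z).2.2 (m3 z hz).1
    have h0 := (m3 z hz).2
    have h1 : z ∉ D.Ll1.support := by grind
    have h2 : z ∉ D.Rl2.support := by grind
    have h3 : z ∉ D.Ru2.support := by grind
    simp only [hφ]
    simp [h1, h2, h3, hz]
  have kM3 : ∀ z ∈ D.M3.support, φ z = 2 := by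
    intro z hz
    have := D.sepA z
    have h1 : z ∉ D.Ll1.support := by grind
    have h2 : z ∉ D.Rl2.support := by grind
    have h3 : z ∉ D.Ru2.support := by grind
    have h4 : z ∉ p3.support := by
      intro h
      have := (D.sepQ z).2.2 (m3 z h).1
      grind
    simp only [hφ]
    simp [h1, h2, h3, h4, hz]
  have kH : ∀ z, (z ∈ p4.support ∨ z ∈ p5.support) → φ z = 7 := by
    intro z hz
    have hm4 := m4 z
    have hm5 := m5 z
    have hm3 := m3 z
    have hQ1 := (D.sepQ z).1
    have hQ2 := (D.sepQ z).2.1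
    have h1 : z ∉ D.Ll1.support := by grind
    have h2 : z ∉ D.Rl2.support := by grind
    have h3 : z ∉ D.Ru2.support := by grind
    have h4 : z ∉ p3.support := by grind
    have h5 : z ∉ D.M3.support := by grind
    simp only [hφ]
    simp [h1, h2, h3, h4, h5, hz]
  have kD : ∀ z, (z ∈ D.M4.support ∨ z ∈ D.Ru1.support ∨ z ∈ D.Rl1.support) → φ z = 3 := by
    intro z hz
    have hA := D.sepA z
    have hm4 := m4 z
    have hm5 := m5 z
    have hm3 := m3 z
    obtain ⟨hQ1, hQ2, hQ3⟩ := D.sepQ z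
    have h1 : z ∉ D.Ll1.support := by clear hQ1 hQ2 hQ3; grind
    have h2 : z ∉ D.Rl2.support := by clear hQ1 hQ2 hQ3; grind
    have h3 : z ∉ D.Ru2.support := by clear hQ1 hQ2 hQ3; grind
    have h5 : z ∉ D.M3.support := by clear hQ1 hQ2 hQ3; grind
    clear hA
    have h4 : z ∉ p3.support := by grind
    have h6 : z ∉ p4.support := by grind
    have h7 : z ∉ p5.support := by grind
    simp only [hφ]
    simp [h1, h2, h3, h4, h5, h6, h7, hz]
  have kA : ∀ z, (z ∈ D.Lu.support ∨ z ∈ D.M1.support ∨ z ∈ D.Ll2.support ∨ z ∈ p1.support) → φ z = 0 := by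
    intro z hz
    have hA := D.sepA z
    obtain ⟨hQ1, hQ2, hQ3⟩ := D.sepQ z
    have hm1 := m1 z
    have hm4 := m4 z
    have hm5 := m5 z
    have hm3 := m3 z
    have h1 : z ∉ D.Ll1.support := by clear hQ2 hQ3; grind
    have h2 : z ∉ D.Rl2.support := by clear hQ2 hQ3; grind
    have h3 : z ∉ D.Ru2.support := by clear hQ2 hQ3; grind
    have h5 : z ∉ D.M3.support := by clear hQ2 hQ3; grind
    have h8 : z ∉ D.M4.support := by clear hQ2 hQ3; grind
    have h9 : z ∉ D.Ru1.support := by clear hQ2 hQ3; grind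
    have h10 : z ∉ D.Rl1.support := by clear hQ2 hQ3; grind
    clear hA
    have h4 : z ∉ p3.support := by grind
    have h6 : z ∉ p4.support := by grind
    have h7 : z ∉ p5.support := by
      intro h
      have hiv := iv z
      have hc := D.c1 z
      rw [Seg.mem_Pu, Seg.mem_M] at hc
      have hm5 := hm5 h
      grind
    simp only [hφ]
    simp [h1, h2, h3, h4, h5, h6, h7, h8, h9, h10]
  have kX : ∀ z ∈ D.X.support, φ z = 0 := by
    intro z hz
    have := D.hX z hz
    exact kA z (by grind)
  have kLu : ∀ z ∈ D.Lu.support, φ z = 0 := fun z hz => kA z (Or.inl hz)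
  have kM1 : ∀ z ∈ D.M1.support, φ z = 0 := fun z hz => kA z (Or.inr (Or.inl hz))
  have kLl2 : ∀ z ∈ D.Ll2.support, φ z = 0 := fun z hz => kA z (Or.inr (Or.inr (Or.inl hz)))
  have k1 : ∀ z ∈ p1.support, φ z = 0 := fun z hz => kA z (Or.inr (Or.inr (Or.inr hz)))
  have kM4 : ∀ z ∈ D.M4.support, φ z = 3 := fun z hz => kD z (Or.inl hz)
  have k4 : ∀ z ∈ p4.support, φ z = 7 := fun z hz => kH z (Or.inl hz)
  have k5 : ∀ z ∈ p5.support, φ z = 7 := fun z hz => kH z (Or.inr hz)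
  have kRu1 : ∀ z ∈ D.Ru1.support, φ z = 3 := fun z hz => kD z (Or.inr (Or.inl hz))
  have kRl1 : ∀ z ∈ D.Rl1.support, φ z = 3 := fun z hz => kD z (Or.inr (Or.inr hz))
  clear kA kD kH
  clear hφ
  have tLu := sameCl_of_const _ _ kLu
  have tM1 := sameCl_of_const _ _ kM1
  have tM3 := sameCl_of_const _ _ kM3
  have tM4 := sameCl_of_const _ _ kM4
  have tRu1 := sameCl_of_const _ _ kRu1
  have tRu2 := sameCl_of_const _ _ kRu2
  have tRl1 := sameCl_of_const _ _ kRl1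
  have tRl2 := sameCl_of_const _ _ kRl2
  have tLl1 := sameCl_of_const _ _ kLl1
  have tLl2 := sameCl_of_const _ _ kLl2
  have tX := sameCl_of_const _ _ kX
  have t1 := sameCl_of_const _ _ k1
  have t4 := sameCl_of_const _ _ k4
  have t5 := sameCl_of_const _ _ k5
  have t3 := sameCl_of_const _ _ k3
  refine model2_false φ (kLu _ (by simp)) (kRu2 _ (by simp)) (kLl1 _ (by simp)) (kRl2 _ (by simp))
    ![D.m, D.a3, D.b2, D.r, D.a2, D.s, z1, z5, D.a2, z4, z3]
    ![D.a3, D.n, D.y, D.b1, D.l, D.b3, c, D.b1, z2, D.b2, D.b3]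
    ?_ ?_ (sameCl φ) (fun y z h => h y z rfl) D.Pu ?_ D.Pl ?_ ((D.X.append D.q1).append D.Ru2) ?_
    (((D.Ll1.append D.q2).append (Walk.cons D.hm3 D.M4)).append D.Rl) ?_
    ((D.Ll.append ((D.M1.append (Walk.cons D.hm1 Walk.nil)).append D.q3)).append D.Rl2) ?_ heff
  · intro i
    fin_cases i
    · exact kM1 _ (by simp)
    · exact k3 _ (by simp)
    · exact kM3 _ (by simp)
    · exact kRu1 _ (by simp)
    · exact kLl1 _ (by simp)
    · exact kRl1 _ (by simp)
    · exact k1 _ (by simp)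
    · exact k5 _ (by simp)
    · exact kLl1 _ (by simp)
    · exact k4 _ (by simp)
    · exact k3 _ (by simp)
  · intro i
    fin_cases i
    · exact k3 _ (by simp)
    · exact kM3 _ (by simp)
    · exact kM4 _ (by simp)
    · exact kRu2 _ (by simp)
    · exact kLl2 _ (by simp)
    · exact kRl2 _ (by simp)
    · exact k4 _ hcp4
    · exact kRu2 _ (by simp)
    · exact k4 _ (by simp)
    · exact kM3 _ (by simp)
    · exact kRl2 _ (by simp)
  · intro e he
    simp only [Seg.Pu, Seg.M, Seg.Ru, Walk.edges_append, Walk.edges_cons, List.mem_append, List.mem_cons] at he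
    rcases he with (h | h | h | h | h | h | h) | h | h | h
    · exact Or.inl (tLu e h)
    · exact Or.inl (tM1 e h)
    · exact Or.inr ⟨0, by decide, h⟩
    · exact Or.inr ⟨1, by decide, h⟩
    · exact Or.inl (tM3 e h)
    · exact Or.inr ⟨2, by decide, h⟩
    · exact Or.inl (tM4 e h)
    · exact Or.inl (tRu1 e h)
    · exact Or.inr ⟨3, by decide, h⟩
    · exact Or.inl (tRu2 e h)
  · intro e he
    simp only [Seg.Pl, Seg.M, Seg.Rl, Seg.Ll, Walk.edges_append, Walk.edges_cons, List.mem_append,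
      List.mem_cons] at he
    rcases he with ((h | h | h) | h | h | h | h | h | h) | h | h | h
    · exact Or.inl (tLl1 e h)
    · exact Or.inr ⟨4, by decide, h⟩
    · exact Or.inl (tLl2 e h)
    · exact Or.inl (tM1 e h)
    · exact Or.inr ⟨0, by decide, h⟩
    · exact Or.inr ⟨1, by decide, h⟩
    · exact Or.inl (tM3 e h)
    · exact Or.inr ⟨2, by decide, h⟩
    · exact Or.inl (tM4 e h)
    · exact Or.inl (tRl1 e h)
    · exact Or.inr ⟨5, by decide, h⟩
    · exact Or.inl (tRl2 e h)
  · intro e he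
    rw [eq1, e1, e5] at he
    simp only [Walk.edges_append, Walk.edges_cons, Walk.edges_nil, List.mem_append, List.mem_cons,
      List.not_mem_nil, or_false] at he
    rcases he with (h | (h | h) | h | h) | h
    · exact Or.inl (tX e h)
    · exact Or.inl (t1 e h)
    · exact Or.inr ⟨6, by decide, h⟩
    · exact Or.inl (t5 e h)
    · exact Or.inr ⟨7, by decide, h⟩
    · exact Or.inl (tRu2 e h)
  · intro e he
    rw [e2, e4] at he
    simp only [Seg.Rl, Walk.edges_append, Walk.edges_cons, Walk.edges_nil, List.mem_append, List.mem_cons,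
      List.not_mem_nil, or_false] at he
    rcases he with ((h | h | h | h) | h | h) | h | h | h
    · exact Or.inl (tLl1 e h)
    · exact Or.inr ⟨8, by decide, h⟩
    · exact Or.inl (t4 e h)
    · exact Or.inr ⟨9, by decide, h⟩
    · exact Or.inr ⟨2, by decide, h⟩
    · exact Or.inl (tM4 e h)
    · exact Or.inl (tRl1 e h)
    · exact Or.inr ⟨5, by decide, h⟩
    · exact Or.inl (tRl2 e h)
  · intro e he
    rw [e3] at he
    simp only [Seg.Ll, Walk.edges_append, Walk.edges_cons, Walk.edges_nil, List.mem_append, List.mem_cons,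
      List.not_mem_nil, or_false] at he
    rcases he with ((h | h | h) | (h | h) | h | h) | h
    · exact Or.inl (tLl1 e h)
    · exact Or.inr ⟨4, by decide, h⟩
    · exact Or.inl (tLl2 e h)
    · exact Or.inl (tM1 e h)
    · exact Or.inr ⟨0, by decide, h⟩
    · exact Or.inl (t3 e h)
    · exact Or.inr ⟨10, by decide, h⟩
    · exact Or.inl (tRl2 e h)

end NDG

namespace NDG
variable {V : Type*} [DecidableEq V]
set_option linter.unusedSectionVars false
open SimpleGraph
variable {G : SimpleGraph V}

theorem PBC.false_of {u v w x : V} (B : PBC G u v w x) (hB : B.IsBC)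
    (heff : ∀ c : Sym2 V → ℝ, (∀ e, 0 ≤ c e) → EffP G u v w x c) : False := by
  obtain ⟨D⟩ := B.toCfg hB
  by_cases h : ∃ z ∈ D.q1.support, z ∈ D.q2.support
  · exact D.false2 h heff
  · push Not at h
    exact D.false1 h heff

theorem not_containsBC {s₁ t₁ s₂ t₂ : V} (h : Efficient G s₁ t₁ s₂ t₂) : ¬ ContainsBC G s₁ t₁ s₂ t₂ := by
  have e := fun (c : Sym2 V → ℝ) (hc : ∀ e : Sym2 V, 0 ≤ c e) => h.effP hc
  rintro (⟨B, hB⟩ | ⟨B, hB⟩ | ⟨B, hB⟩ | ⟨B, hB⟩ | ⟨B, hB⟩ | ⟨B, hB⟩ | ⟨B, hB⟩ | ⟨B, hB⟩)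
  · exact B.false_of hB e
  · exact B.false_of hB fun c hc => (e c hc).swap.rev.swap
  · exact B.false_of hB fun c hc => (e c hc).rev
  · exact B.false_of hB fun c hc => (e c hc).swap.rev.swap.rev
  · exact B.false_of hB fun c hc => (e c hc).swap
  · exact B.false_of hB fun c hc => (e c hc).rev.swap
  · exact B.false_of hB fun c hc => (e c hc).swap.rev
  · exact B.false_of hB fun c hc => (e c hc).rev.swap.rev

end NDG

namespace NDG
variable {V : Type*} [DecidableEq V]

/-- Main Theorem.  For a two-player network design game on an
undirected graph `G` with terminal pairs `(s₁,t₁)`, `(s₂,t₂)` (each pair being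
connectable), the following are equivalent: (1) `G` contains no subgraph which
is a bad configuration; (2) `(G,(s₁,t₁),(s₂,t₂))` is efficient;
(3) `(G,(s₁,t₁),(s₂,t₂))` is strongly efficient. -/
theorem efficiency_characterization [Fintype V] (G : SimpleGraph V) (s₁ t₁ s₂ t₂ : V)
    (h₁ : G.Reachable s₁ t₁) (h₂ : G.Reachable s₂ t₂) :
    (¬ ContainsBC G s₁ t₁ s₂ t₂ ↔ Efficient G s₁ t₁ s₂ t₂) ∧
    (Efficient G s₁ t₁ s₂ t₂ ↔ StronglyEfficient G s₁ t₁ s₂ t₂) := by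
  have hEB : Efficient G s₁ t₁ s₂ t₂ → ¬ ContainsBC G s₁ t₁ s₂ t₂ := not_containsBC
  have hBS : ¬ ContainsBC G s₁ t₁ s₂ t₂ → StronglyEfficient G s₁ t₁ s₂ t₂ := stronglyEfficient_of
  have hSE : StronglyEfficient G s₁ t₁ s₂ t₂ → Efficient G s₁ t₁ s₂ t₂ := by
    intro h c hc
    obtain ⟨F, hF⟩ := exists_optimal G h₁ h₂ c
    exact ⟨F, hF, h c hc F hF⟩
  exact ⟨⟨fun h => hSE (hBS h), hEB⟩, ⟨fun h => hBS (hEB h), hSE⟩⟩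

end NDG
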